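/- Under assumptions (A.1)–(A.4) with σ_w > 0, there exist σ ≥ σ_w, τ > 0 and a function η : ℝ → ℝ which is odd and satisfies 0 ≤ η(t₁) − η(t₂) ≤ t₁ − t₂ for all t₁ ≥ t₂, such that: (i) for every converging sequence u⁽ᵖ⁾ ∈ ℝᵖ whose empirical measure converges weakly to the law of B + σZ (where B ∼ F_β and Z ∼ N(0,1) are independent) and with (1/p)‖u⁽ᵖ⁾‖² → E[(B+σZ)²], one has (1/p)‖Prox_{τλ⁽ᵖ⁾}(u⁽ᵖ⁾) − η(u⁽ᵖ⁾)‖² → 0, where Prox_{τλ⁽ᵖ⁾} is the SLOPE proximal operator with weight vector τλ⁽ᵖ⁾ and η is applied coordinatewise; (ii) σ² = σ_w² + (1/δ)·E[(η(B+σZ) − B)²]; (iii) 1 = τ·(1 − (1/(δσ))·E[Z·η(B+σZ)]); and (iv) for every pseudo-Lipschitz function ψ : ℝ² → ℝ, (1/p) Σ_{i=1}^p ψ(β̂_i, β_i) converges in probability to E[ψ(η(B+σZ), B)] as p → ∞, where β̂ is the SLOPE estimator. -/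

import Mathlib

open MeasureTheory Filter Finset Topology ProbabilityTheory

/-- The nondecreasing rearrangement of the absolute values of the entries of `x`. -/
noncomputable def sortedAbs {p : ℕ} (x : Fin p → ℝ) : Fin p → ℝ :=
  fun i => |x (Tuple.sort (fun j => |x j|) i)|

/-- The sorted ℓ1 norm `J_λ(x) = ∑ λ_i |x|_(i)`. -/
noncomputable def sortedL1 {p : ℕ} (lam x : Fin p → ℝ) : ℝ :=
  ∑ i, lam i * sortedAbs x i

/-- The SLOPE objective `(1/2)‖y - x‖² + J_λ(x)`. -/
noncomputable def slopeObj {p : ℕ} (lam y x : Fin p → ℝ) : ℝ :=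
  (1 / 2) * ∑ i, (y i - x i) ^ 2 + sortedL1 lam x

open Classical in
/-- The SLOPE proximal operator: the (unique) minimizer of the SLOPE objective. -/
noncomputable def slopeProx {p : ℕ} (lam y : Fin p → ℝ) : Fin p → ℝ :=
  if h : ∃ x : Fin p → ℝ, ∀ z : Fin p → ℝ, slopeObj lam y x ≤ slopeObj lam y z
  then h.choose else y

/-- The empirical measures `(1/p) ∑ δ_{x_i}` of the sequence of vectors `x⁽ᵖ⁾` converge
weakly to the probability measure `μ` (tested against bounded continuous functions). -/
def EmpConverges (x : (p : ℕ) → Fin p → ℝ) (μ : Measure ℝ) : Prop :=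
  ∀ f : BoundedContinuousFunction ℝ ℝ,
    Tendsto (fun p => (∑ i, f (x p i)) / (p : ℝ)) atTop (𝓝 (∫ t, f t ∂μ))

/-- The law of an `n × p` random matrix with i.i.d. `N(0, 1/n)` entries. -/
noncomputable def gaussMatrix (n p : ℕ) : Measure (Fin n → Fin p → ℝ) :=
  Measure.pi fun _ => Measure.pi fun _ => gaussianReal 0 ((n : NNReal))⁻¹

/-! ### Part A: finite-dimensional facts -/

/-- Euclidean norm of a vector. -/
noncomputable def nrm {ι : Type*} [Fintype ι] (x : ι → ℝ) : ℝ :=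
  ‖(WithLp.toLp 2 x : EuclideanSpace ℝ ι)‖

section nrm
variable {ι : Type*} [Fintype ι]

lemma nrm_sq (x : ι → ℝ) : nrm x ^ 2 = x ⬝ᵥ x := by
  rw [nrm, EuclideanSpace.norm_sq_eq]
  simp [dotProduct, sq]

lemma nrm_sq' (x : ι → ℝ) : nrm x ^ 2 = ∑ i, x i ^ 2 := by
  simp [nrm, EuclideanSpace.norm_sq_eq]

lemma nrm_nonneg (x : ι → ℝ) : 0 ≤ nrm x := norm_nonneg _

lemma nrm_add_le (x y : ι → ℝ) : nrm (x + y) ≤ nrm x + nrm y := by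
  unfold nrm; rw [WithLp.toLp_add]; exact norm_add_le _ _

lemma nrm_sub_le (x y : ι → ℝ) : nrm (x - y) ≤ nrm x + nrm y := by
  unfold nrm; rw [WithLp.toLp_sub]; exact norm_sub_le _ _

lemma nrm_smul (c : ℝ) (x : ι → ℝ) : nrm (c • x) = |c| * nrm x := by
  unfold nrm; rw [WithLp.toLp_smul, norm_smul]; rfl

lemma nrm_neg (x : ι → ℝ) : nrm (-x) = nrm x := by
  unfold nrm; rw [WithLp.toLp_neg, norm_neg]

lemma nrm_sub_comm (x y : ι → ℝ) : nrm (x - y) = nrm (y - x) := by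
  rw [← nrm_neg, neg_sub]

lemma nrm_zero : nrm (0 : ι → ℝ) = 0 := by
  unfold nrm; simp

lemma abs_nrm_sub_le (x y : ι → ℝ) : |nrm x - nrm y| ≤ nrm (x - y) := by
  unfold nrm; rw [WithLp.toLp_sub]; exact abs_norm_sub_norm_le _ _

lemma dot_abs_le (x y : ι → ℝ) : |x ⬝ᵥ y| ≤ nrm x * nrm y := by
  have h := Finset.sum_mul_sq_le_sq_mul_sq Finset.univ x y
  rw [← nrm_sq', ← nrm_sq', ← mul_pow] at h
  exact abs_le_of_sq_le_sq h (mul_nonneg (nrm_nonneg _) (nrm_nonneg _))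

lemma dot_le (x y : ι → ℝ) : x ⬝ᵥ y ≤ nrm x * nrm y :=
  (le_abs_self _).trans (dot_abs_le x y)

lemma nrm_eq_sqrt (x : ι → ℝ) : nrm x = Real.sqrt (x ⬝ᵥ x) := by
  rw [← nrm_sq, Real.sqrt_sq (nrm_nonneg _)]

lemma nrm_le_of_sq_le {x : ι → ℝ} {c : ℝ} (hc : 0 ≤ c) (h : x ⬝ᵥ x ≤ c ^ 2) : nrm x ≤ c := by
  rw [← nrm_sq] at h
  exact abs_le_of_sq_le_sq' h hc |>.2

lemma continuous_nrm : Continuous (nrm : (ι → ℝ) → ℝ) := by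
  have : (nrm : (ι → ℝ) → ℝ) = fun x => Real.sqrt (∑ i, x i * x i) := by
    funext x; rw [nrm_eq_sqrt]; rfl
  rw [this]; fun_prop

lemma nrm_eq_zero {x : ι → ℝ} (h : nrm x = 0) : x = 0 := by
  have := nrm_sq x
  rw [h] at this
  have h2 : x ⬝ᵥ x = 0 := by nlinarith
  exact dotProduct_self_eq_zero.1 h2

lemma isBounded_of_nrm {S : Set (ι → ℝ)} {K : ℝ} (h : ∀ x ∈ S, nrm x ≤ K) :
    Bornology.IsBounded S := by
  refine (Metric.isBounded_closedBall (x := (0 : ι → ℝ)) (r := K)).subset fun x hx => ?_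
  rw [mem_closedBall_zero_iff]
  have hK : 0 ≤ K := (nrm_nonneg x).trans (h x hx)
  refine (pi_norm_le_iff_of_nonneg hK).2 fun i => ?_
  refine le_trans ?_ (h x hx)
  rw [Real.norm_eq_abs]
  refine abs_le_of_sq_le_sq ?_ (nrm_nonneg _)
  rw [nrm_sq']
  exact Finset.single_le_sum (f := fun i => x i ^ 2) (fun _ _ => sq_nonneg _) (Finset.mem_univ i)

lemma isCompact_nrm_ball (K : ℝ) : IsCompact {x : ι → ℝ | nrm x ≤ K} := by
  refine Metric.isCompact_of_isClosed_isBounded ?_ (isBounded_of_nrm fun x hx => hx)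
  exact isClosed_le continuous_nrm continuous_const

end nrm

section slope
variable {p : ℕ} {lam : Fin p → ℝ}

lemma sortedAbs_mono (x : Fin p → ℝ) : Monotone (sortedAbs x) :=
  Tuple.monotone_sort (fun j => |x j|)

lemma sum_perm_le (hl : Monotone lam) (x : Fin p → ℝ) (π : Equiv.Perm (Fin p)) :
    ∑ i, lam i * |x (π i)| ≤ sortedL1 lam x := by
  have hmv : Monovary lam (sortedAbs x) := hl.monovary (sortedAbs_mono x)
  have := hmv.sum_mul_comp_perm_le_sum_mul (σ := π.trans (Tuple.sort (fun j => |x j|)).symm)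
  simpa [sortedL1, sortedAbs] using this

lemma sortedL1_congr (hl : Monotone lam) {x x' : Fin p → ℝ} (π : Equiv.Perm (Fin p))
    (h : ∀ i, |x' i| = |x (π i)|) : sortedL1 lam x' = sortedL1 lam x := by
  apply le_antisymm
  · have := sum_perm_le hl x ((Tuple.sort (fun j => |x' j|)).trans π)
    refine le_trans (le_of_eq ?_) this
    simp [sortedL1, sortedAbs, h]
  · have := sum_perm_le hl x' ((Tuple.sort (fun j => |x j|)).trans π.symm)
    refine le_trans (le_of_eq ?_) this
    simp [sortedL1, sortedAbs, h]

lemma sortedL1_add_le (h0 : ∀ i, 0 ≤ lam i) (hl : Monotone lam) (x y : Fin p → ℝ) :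
    sortedL1 lam (x + y) ≤ sortedL1 lam x + sortedL1 lam y := by
  refine le_trans ?_ (add_le_add (sum_perm_le hl x (Tuple.sort (fun j => |(x+y) j|)))
    (sum_perm_le hl y (Tuple.sort (fun j => |(x+y) j|))))
  rw [← Finset.sum_add_distrib]
  refine Finset.sum_le_sum fun i _ => ?_
  rw [← mul_add]
  exact mul_le_mul_of_nonneg_left (abs_add_le _ _) (h0 i)

lemma sortedL1_smul (hl : Monotone lam) (c : ℝ) (x : Fin p → ℝ) :
    sortedL1 lam (c • x) = |c| * sortedL1 lam x := by
  apply le_antisymm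
  · have := sum_perm_le hl x (Tuple.sort (fun j => |(c • x) j|))
    refine le_trans (le_of_eq ?_) (mul_le_mul_of_nonneg_left this (abs_nonneg c))
    rw [Finset.mul_sum]
    refine Finset.sum_congr rfl fun i _ => ?_
    simp only [sortedAbs, Pi.smul_apply, smul_eq_mul, abs_mul]; ring
  · have := sum_perm_le hl (c • x) (Tuple.sort (fun j => |x j|))
    refine le_trans (le_of_eq ?_) this
    rw [sortedL1, Finset.mul_sum]
    refine Finset.sum_congr rfl fun i _ => ?_
    simp only [sortedAbs, Pi.smul_apply, smul_eq_mul, abs_mul]; ring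

lemma sortedL1_nonneg (h0 : ∀ i, 0 ≤ lam i) (x : Fin p → ℝ) : 0 ≤ sortedL1 lam x :=
  Finset.sum_nonneg fun i _ => mul_nonneg (h0 i) (abs_nonneg _)

lemma sortedL1_lam_smul (τ : ℝ) (x : Fin p → ℝ) :
    sortedL1 (fun i => τ * lam i) x = τ * sortedL1 lam x := by
  simp [sortedL1, Finset.mul_sum, mul_assoc]

lemma sum_sortedAbs_sq (x : Fin p → ℝ) : ∑ i, sortedAbs x i ^ 2 = ∑ i, x i ^ 2 := by
  simp only [sortedAbs, sq_abs]
  exact Equiv.sum_comp (Tuple.sort (fun j => |x j|)) (fun i => x i ^ 2)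

lemma sortedL1_le (x : Fin p → ℝ) : sortedL1 lam x ≤ nrm lam * nrm x := by
  have h := dot_le lam (sortedAbs x)
  have h2 : nrm (sortedAbs x) = nrm x := by
    rw [← Real.sqrt_sq (nrm_nonneg x), ← Real.sqrt_sq (nrm_nonneg (sortedAbs x)), nrm_sq', nrm_sq',
      sum_sortedAbs_sq]
  rw [h2] at h
  exact h

lemma sortedL1_sub_le (h0 : ∀ i, 0 ≤ lam i) (hl : Monotone lam) (x y : Fin p → ℝ) :
    sortedL1 lam x - sortedL1 lam y ≤ nrm lam * nrm (x - y) := by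
  have h := sortedL1_add_le h0 hl (x - y) y
  have h2 := sortedL1_le (lam := lam) (x - y)
  rw [sub_add_cancel] at h
  linarith

lemma continuous_sortedL1 (h0 : ∀ i, 0 ≤ lam i) (hl : Monotone lam) :
    Continuous (sortedL1 lam) := by
  rw [continuous_iff_continuousAt]
  intro x
  rw [ContinuousAt, tendsto_iff_norm_sub_tendsto_zero]
  have h1 : Tendsto (fun y => nrm lam * nrm (y - x)) (𝓝 x) (𝓝 0) := by
    have : Continuous (fun y => nrm lam * nrm (y - x)) :=
      continuous_const.mul (continuous_nrm.comp (continuous_id.sub continuous_const))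
    simpa [nrm_zero] using this.tendsto x
  refine squeeze_zero (fun _ => norm_nonneg _) (fun y => ?_) h1
  rw [Real.norm_eq_abs, abs_le]
  constructor
  · have := sortedL1_sub_le h0 hl x y
    rw [nrm_sub_comm] at this; linarith
  · exact sortedL1_sub_le h0 hl y x

lemma sortedL1_zero (hl : Monotone lam) : sortedL1 lam 0 = 0 := by
  have := sortedL1_smul hl 0 (0 : Fin p → ℝ)
  simpa using this

lemma sortedL1_convex (h0 : ∀ i, 0 ≤ lam i) (hl : Monotone lam) (x y : Fin p → ℝ) {t : ℝ}
    (ht0 : 0 ≤ t) (ht1 : t ≤ 1) :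
    sortedL1 lam (x + t • (y - x)) ≤ sortedL1 lam x + t * (sortedL1 lam y - sortedL1 lam x) := by
  have e : x + t • (y - x) = (1 - t) • x + t • y := by
    ext i; simp; ring
  rw [e]
  refine (sortedL1_add_le h0 hl _ _).trans (le_of_eq ?_)
  rw [sortedL1_smul hl, sortedL1_smul hl, abs_of_nonneg ht0, abs_of_nonneg (by linarith)]
  ring

lemma sortedL1_of_mono (hl : Monotone lam) {x : Fin p → ℝ} (hx0 : ∀ i, 0 ≤ x i)
    (hx : Monotone x) : sortedL1 lam x = ∑ i, lam i * x i := by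
  apply le_antisymm
  · have := (hl.monovary hx).sum_mul_comp_perm_le_sum_mul (σ := Tuple.sort (fun j => |x j|))
    refine le_trans (le_of_eq ?_) this
    simp [sortedL1, sortedAbs, abs_of_nonneg (hx0 _)]
  · have := sum_perm_le hl x (Equiv.refl _)
    simpa [abs_of_nonneg (hx0 _)] using this

lemma sortedL1_ge_mean (hl : Monotone lam) (x : Fin p → ℝ) :
    (∑ i, lam i) * (∑ i, |x i|) ≤ p * sortedL1 lam x := by
  have := (hl.monovary (sortedAbs_mono x)).sum_mul_sum_le_card_mul_sum
  have e : ∑ i, sortedAbs x i = ∑ i, |x i| := by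
    simp only [sortedAbs]
    exact Equiv.sum_comp (Tuple.sort (fun j => |x j|)) (fun i => |x i|)
  simpa [e, sortedL1] using this

/-! Minimizers and variational inequalities -/

lemma slopeObj_eq (y x : Fin p → ℝ) :
    slopeObj lam y x = (1/2) * ((y - x) ⬝ᵥ (y - x)) + sortedL1 lam x := by
  simp [slopeObj, dotProduct, sq]

/-- A limiting argument: a quadratic inequality for small `t` gives the linear one. -/
lemma le_of_quad {a b c : ℝ} (t0 : ℝ) (ht0 : 0 < t0)
    (h : ∀ t, 0 < t → t ≤ t0 → t * a ≤ t * b + t ^ 2 * c) : a ≤ b := by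
  by_contra hab
  push Not at hab
  set t := min t0 ((a - b) / (2 * (|c| + 1))) with ht
  have hc : 0 < |c| + 1 := by positivity
  have htp : 0 < t := lt_min ht0 (div_pos (by linarith) (by linarith))
  have h1 := h t htp (min_le_left _ _)
  have h2 : t ≤ (a - b) / (2 * (|c| + 1)) := min_le_right _ _
  rw [le_div_iff₀ (by linarith)] at h2
  have h3 : a ≤ b + t * c := by
    have : t * a ≤ t * (b + t * c) := by nlinarith
    exact le_of_mul_le_mul_left this htp
  nlinarith [le_abs_self c, abs_nonneg c]

lemma vi_of_min (h0 : ∀ i, 0 ≤ lam i) (hl : Monotone lam) {y x : Fin p → ℝ}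
    (h : ∀ z, slopeObj lam y x ≤ slopeObj lam y z) (z : Fin p → ℝ) :
    (y - x) ⬝ᵥ (z - x) ≤ sortedL1 lam z - sortedL1 lam x := by
  refine le_of_quad (c := (1/2) * ((z - x) ⬝ᵥ (z - x))) 1 one_pos fun t ht ht1 => ?_
  have h1 := h (x + t • (z - x))
  have h2 := sortedL1_convex h0 hl x z ht.le ht1
  rw [slopeObj_eq, slopeObj_eq] at h1
  have e : y - (x + t • (z - x)) = (y - x) - t • (z - x) := by abel
  rw [e] at h1
  simp only [sub_dotProduct (y - x), dotProduct_sub _ (y - x), smul_dotProduct, dotProduct_smul,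
    smul_eq_mul, dotProduct_comm (z - x) (y - x)] at h1
  nlinarith

lemma min_of_vi {y x : Fin p → ℝ}
    (h : ∀ z, (y - x) ⬝ᵥ (z - x) ≤ sortedL1 lam z - sortedL1 lam x) (z : Fin p → ℝ) :
    slopeObj lam y x ≤ slopeObj lam y z := by
  rw [slopeObj_eq, slopeObj_eq]
  have h1 := h z
  have e : y - z = (y - x) - (z - x) := by abel
  have h2 : 0 ≤ (z - x) ⬝ᵥ (z - x) := by rw [← nrm_sq]; positivity
  have h3 : (y - z) ⬝ᵥ (y - z) = (y - x) ⬝ᵥ (y - x) - 2 * ((y - x) ⬝ᵥ (z - x))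
      + (z - x) ⬝ᵥ (z - x) := by
    rw [e]
    simp only [sub_dotProduct (y - x), dotProduct_sub _ (y - x),
      dotProduct_comm (z - x) (y - x)]
    ring
  rw [h3]; linarith

lemma exists_min (h0 : ∀ i, 0 ≤ lam i) (hl : Monotone lam) (y : Fin p → ℝ) :
    ∃ x : Fin p → ℝ, ∀ z, slopeObj lam y x ≤ slopeObj lam y z := by
  have hcont : Continuous (slopeObj lam y) := by
    have : slopeObj lam y = fun x => (1 / 2) * ∑ i, (y i - x i) ^ 2 + sortedL1 lam x := rfl
    rw [this]
    have := continuous_sortedL1 h0 hl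
    fun_prop
  set K := nrm y + nrm y with hK
  obtain ⟨x, hxS, hx⟩ := (isCompact_nrm_ball (ι := Fin p) K).exists_isMinOn
    ⟨0, by show nrm 0 ≤ K; rw [nrm_zero]; have := nrm_nonneg y; positivity⟩ hcont.continuousOn
  refine ⟨x, fun z => ?_⟩
  by_cases hz : nrm z ≤ K
  · exact hx hz
  · push Not at hz
    have h1 : slopeObj lam y x ≤ slopeObj lam y 0 :=
      hx (show nrm 0 ≤ K by rw [nrm_zero]; have := nrm_nonneg y; positivity)
    refine h1.trans ?_
    rw [slopeObj_eq, slopeObj_eq, sortedL1_zero hl, ← nrm_sq, ← nrm_sq, sub_zero]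
    have h2 : nrm y ≤ nrm (y - z) := by
      have := abs_nrm_sub_le y z
      have := neg_abs_le (nrm y - nrm z)
      linarith
    have := sortedL1_nonneg h0 z
    have := nrm_nonneg y
    nlinarith

lemma slopeProx_spec (h0 : ∀ i, 0 ≤ lam i) (hl : Monotone lam) (y z : Fin p → ℝ) :
    slopeObj lam y (slopeProx lam y) ≤ slopeObj lam y z := by
  have h := exists_min h0 hl y
  unfold slopeProx
  rw [dif_pos h]
  exact h.choose_spec z

lemma slopeProx_vi (h0 : ∀ i, 0 ≤ lam i) (hl : Monotone lam) (y z : Fin p → ℝ) :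
    (y - slopeProx lam y) ⬝ᵥ (z - slopeProx lam y)
      ≤ sortedL1 lam z - sortedL1 lam (slopeProx lam y) :=
  vi_of_min h0 hl (slopeProx_spec h0 hl y) z

/-- Firm nonexpansiveness from two variational inequalities. -/
lemma firm_of_vi {Q : (Fin p → ℝ) → ℝ} {y x y' x' : Fin p → ℝ}
    (h : (y - x) ⬝ᵥ (x' - x) ≤ Q x' - Q x) (h' : (y' - x') ⬝ᵥ (x - x') ≤ Q x - Q x') :
    (x - x') ⬝ᵥ (x - x') ≤ (x - x') ⬝ᵥ (y - y') := by
  simp only [sub_dotProduct, dotProduct_sub] at *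
  simp only [dotProduct_comm x' x, dotProduct_comm y x, dotProduct_comm y x',
    dotProduct_comm y' x, dotProduct_comm y' x'] at *
  linarith

lemma slopeProx_firm (h0 : ∀ i, 0 ≤ lam i) (hl : Monotone lam) (y y' : Fin p → ℝ) :
    (slopeProx lam y - slopeProx lam y') ⬝ᵥ (slopeProx lam y - slopeProx lam y')
      ≤ (slopeProx lam y - slopeProx lam y') ⬝ᵥ (y - y') :=
  firm_of_vi (Q := sortedL1 lam) (slopeProx_vi h0 hl y _) (slopeProx_vi h0 hl y' _)

lemma slopeProx_unique (h0 : ∀ i, 0 ≤ lam i) (hl : Monotone lam) {y x : Fin p → ℝ}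
    (h : ∀ z, (y - x) ⬝ᵥ (z - x) ≤ sortedL1 lam z - sortedL1 lam x) : slopeProx lam y = x := by
  have := firm_of_vi (Q := sortedL1 lam) (slopeProx_vi h0 hl y x) (h (slopeProx lam y))
  rw [sub_self, dotProduct_zero, ← nrm_sq] at this
  have h2 : nrm (slopeProx lam y - x) = 0 := by
    have := nrm_nonneg (slopeProx lam y - x); nlinarith
  exact sub_eq_zero.1 (nrm_eq_zero h2)

lemma nrm_le_of_sq_le_mul {a b : ℝ} (ha : 0 ≤ a) (hb : 0 ≤ b) (h : a ^ 2 ≤ a * b) : a ≤ b := by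
  rcases eq_or_lt_of_le ha with h1 | h1
  · rw [← h1]; exact hb
  · rw [sq] at h; exact le_of_mul_le_mul_left h h1

lemma slopeProx_nonexp (h0 : ∀ i, 0 ≤ lam i) (hl : Monotone lam) (y y' : Fin p → ℝ) :
    nrm (slopeProx lam y - slopeProx lam y') ≤ nrm (y - y') := by
  refine nrm_le_of_sq_le_mul (nrm_nonneg _) (nrm_nonneg _) ?_
  rw [nrm_sq]
  exact (slopeProx_firm h0 hl y y').trans (dot_le _ _)

/-- Stability in the regularization level. -/
lemma slopeProx_stab (h0 : ∀ i, 0 ≤ lam i) (hl : Monotone lam) {τ τ' : ℝ} (hτ : 0 ≤ τ)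
    (hτ' : 0 ≤ τ') (y y' : Fin p → ℝ) :
    nrm (slopeProx (fun i => τ * lam i) y - slopeProx (fun i => τ' * lam i) y')
      ≤ nrm (y - y') + |τ - τ'| * nrm lam := by
  have a0 : ∀ i, 0 ≤ τ * lam i := fun i => mul_nonneg hτ (h0 i)
  have al : Monotone (fun i => τ * lam i) := hl.const_mul hτ
  have b0 : ∀ i, 0 ≤ τ' * lam i := fun i => mul_nonneg hτ' (h0 i)
  have bl : Monotone (fun i => τ' * lam i) := hl.const_mul hτ'
  set x := slopeProx (fun i => τ * lam i) y with hx
  set x' := slopeProx (fun i => τ' * lam i) y' with hx'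
  have h1 := slopeProx_vi a0 al y x'
  have h2 := slopeProx_vi b0 bl y' x
  rw [← hx, sortedL1_lam_smul, sortedL1_lam_smul] at h1
  rw [← hx', sortedL1_lam_smul, sortedL1_lam_smul] at h2
  refine nrm_le_of_sq_le_mul (nrm_nonneg _)
    (add_nonneg (nrm_nonneg _) (mul_nonneg (abs_nonneg _) (nrm_nonneg _))) ?_
  have h3 : nrm (x - x') ^ 2 ≤ (x - x') ⬝ᵥ (y - y')
      + (τ - τ') * (sortedL1 lam x' - sortedL1 lam x) := by
    rw [nrm_sq]
    simp only [sub_dotProduct, dotProduct_sub] at *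
    simp only [dotProduct_comm x' x, dotProduct_comm y x, dotProduct_comm y x',
      dotProduct_comm y' x, dotProduct_comm y' x'] at *
    linarith
  have h4 := dot_le (x - x') (y - y')
  have h5 : (τ - τ') * (sortedL1 lam x' - sortedL1 lam x) ≤ |τ - τ'| * (nrm lam * nrm (x - x')) := by
    refine (le_abs_self _).trans ?_
    rw [abs_mul]
    refine mul_le_mul_of_nonneg_left (abs_le.2 ⟨?_, ?_⟩) (abs_nonneg _)
    · have := sortedL1_sub_le h0 hl x x'; linarith
    · have := sortedL1_sub_le h0 hl x' x; rw [nrm_sub_comm] at this; linarith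
  nlinarith

/-- Equivariance under signed permutations. -/
lemma slopeProx_equiv (h0 : ∀ i, 0 ≤ lam i) (hl : Monotone lam) (y : Fin p → ℝ)
    (π : Equiv.Perm (Fin p)) (s : Fin p → ℝ) (hs : ∀ i, s i * s i = 1) :
    slopeProx lam (fun i => s i * y (π i)) = fun i => s i * slopeProx lam y (π i) := by
  apply slopeProx_unique h0 hl
  intro z
  have habs : ∀ i, |s i| = 1 := by
    intro i
    have := hs i
    rw [← abs_mul_abs_self] at this
    nlinarith [abs_nonneg (s i)]
  set z' : Fin p → ℝ := fun i => s (π.symm i) * z (π.symm i) with hz'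
  have h := slopeProx_vi h0 hl y z'
  have e1 : sortedL1 lam z' = sortedL1 lam z :=
    sortedL1_congr hl π.symm (fun i => by simp [hz', abs_mul, habs])
  have e2 : sortedL1 lam (fun i => s i * slopeProx lam y (π i)) = sortedL1 lam (slopeProx lam y) :=
    sortedL1_congr hl π (fun i => by simp [abs_mul, habs])
  rw [e2, ← e1]
  refine le_trans (le_of_eq ?_) h
  simp only [dotProduct, Pi.sub_apply]
  rw [← Equiv.sum_comp π (fun i => (y i - slopeProx lam y i) * (z' i - slopeProx lam y i))]
  refine Finset.sum_congr rfl fun i _ => ?_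
  simp only [hz', Equiv.symm_apply_apply]
  linear_combination (y (π i) - slopeProx lam y (π i)) * (- slopeProx lam y (π i)) * (hs i)

lemma slopeProx_pair (h0 : ∀ i, 0 ≤ lam i) (hl : Monotone lam) (y : Fin p → ℝ) (i j : Fin p) :
    (slopeProx lam y i - slopeProx lam y j) ^ 2
      ≤ (slopeProx lam y i - slopeProx lam y j) * (y i - y j) := by
  rcases eq_or_ne i j with rfl | hij
  · simp
  have e := slopeProx_equiv h0 hl y (Equiv.swap i j) (fun _ => 1) (by simp)
  have h := slopeProx_firm h0 hl y (fun k => 1 * y (Equiv.swap i j k))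
  rw [e] at h
  simp only [one_mul, dotProduct, Pi.sub_apply] at h
  have key : ∀ f : Fin p → ℝ, (∀ k, k ≠ i → k ≠ j → f k = 0) → ∑ k, f k = f i + f j := by
    intro f hf
    rw [← Finset.sum_pair hij]
    symm
    apply Finset.sum_subset (Finset.subset_univ _)
    intro k _ hk
    simp at hk
    exact hf k hk.1 hk.2
  rw [key _ (fun k h1 h2 => by rw [Equiv.swap_apply_of_ne_of_ne h1 h2]; simp),
    key _ (fun k h1 h2 => by rw [Equiv.swap_apply_of_ne_of_ne h1 h2]; simp)] at h
  simp only [Equiv.swap_apply_left, Equiv.swap_apply_right] at h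
  nlinarith

lemma slopeProx_single (h0 : ∀ i, 0 ≤ lam i) (hl : Monotone lam) (y : Fin p → ℝ) (i : Fin p) :
    slopeProx lam y i ^ 2 ≤ slopeProx lam y i * y i := by
  classical
  have e := slopeProx_equiv h0 hl y (Equiv.refl _) (fun k => if k = i then -1 else 1)
    (by intro k; split_ifs <;> norm_num)
  have h := slopeProx_firm h0 hl y (fun k => (if k = i then -1 else 1) * y (Equiv.refl _ k))
  rw [e] at h
  simp only [dotProduct, Pi.sub_apply, Equiv.refl_apply] at h
  rw [Finset.sum_eq_single i (by intro k _ hk; simp [hk]) (by simp),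
    Finset.sum_eq_single i (by intro k _ hk; simp [hk]) (by simp)] at h
  simp only [if_true] at h
  nlinarith

lemma slopeProx_pos (h0 : ∀ i, 0 ≤ lam i) (hl : Monotone lam) {y : Fin p → ℝ}
    (hy : ∀ i, 0 ≤ y i) (i : Fin p) : 0 ≤ slopeProx lam y i ∧ slopeProx lam y i ≤ y i := by
  have h := slopeProx_single h0 hl y i
  have hy := hy i
  constructor
  · by_contra hn
    push Not at hn
    nlinarith [mul_nonpos_of_nonpos_of_nonneg hn.le hy]
  · by_contra hn
    push Not at hn
    nlinarith

lemma slopeProx_mono (h0 : ∀ i, 0 ≤ lam i) (hl : Monotone lam) {y : Fin p → ℝ}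
    {i j : Fin p} (hy : y j ≤ y i) : 0 ≤ slopeProx lam y i - slopeProx lam y j ∧
      slopeProx lam y i - slopeProx lam y j ≤ y i - y j := by
  have h := slopeProx_pair h0 hl y i j
  have hy : 0 ≤ y i - y j := by linarith
  constructor
  · by_contra hn
    push Not at hn
    nlinarith [mul_nonpos_of_nonpos_of_nonneg hn.le hy]
  · by_contra hn
    push Not at hn
    nlinarith

/-- Euler identity for the proximal operator. -/
lemma slopeProx_euler (h0 : ∀ i, 0 ≤ lam i) (hl : Monotone lam) (y : Fin p → ℝ) :
    (y - slopeProx lam y) ⬝ᵥ slopeProx lam y = sortedL1 lam (slopeProx lam y) := by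
  have h1 := slopeProx_vi h0 hl y 0
  have h2 := slopeProx_vi h0 hl y ((2 : ℝ) • slopeProx lam y)
  rw [sortedL1_zero hl, zero_sub, dotProduct_neg] at h1
  rw [sortedL1_smul hl] at h2
  have e : (2 : ℝ) • slopeProx lam y - slopeProx lam y = slopeProx lam y := by
    rw [two_smul]; abel
  rw [e, abs_of_pos (by norm_num : (0:ℝ) < 2)] at h2
  linarith

end slope

set_option linter.unusedSectionVars false

/-- standard Gaussian on `E → ℝ` -/
noncomputable def gam (E : Type*) [Fintype E] : Measure (E → ℝ) :=
  Measure.pi fun _ => gaussianReal 0 1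

instance gam_prob (E : Type*) [Fintype E] : IsProbabilityMeasure (gam E) := by
  unfold gam; infer_instance

lemma stein1 {g g' : ℝ → ℝ} (hg : ∀ x, HasDerivAt g (g' x) x) (hg' : Continuous g')
    {C : ℝ} (hC : ∀ x, |g x| ≤ C) (hC' : ∀ x, |g' x| ≤ C) :
    ∫ x, x * g x ∂gaussianReal 0 1 = ∫ x, g' x ∂gaussianReal 0 1 := by
  rw [integral_gaussianReal_eq_integral_smul (by norm_num),
    integral_gaussianReal_eq_integral_smul (by norm_num)]
  have hgc : Continuous g := continuous_iff_continuousAt.2 fun x => (hg x).continuousAt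
  have hpd : ∀ x, HasDerivAt (gaussianPDFReal 0 1) (-x * gaussianPDFReal 0 1 x) x := by
    intro x
    have h1 : HasDerivAt (fun x : ℝ => -x ^ 2 / 2) (-x) x := by
      have := ((hasDerivAt_pow 2 x).neg).div_const 2
      exact this.congr_deriv (by push_cast; ring)
    have h2 := (h1.exp).const_mul ((Real.sqrt (2 * Real.pi * 1))⁻¹)
    have e : gaussianPDFReal 0 1 = fun x => (Real.sqrt (2 * Real.pi * 1))⁻¹ * Real.exp (-x ^ 2 / 2) := by
      ext y; simp [gaussianPDFReal_def]
    rw [e]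
    exact h2.congr_deriv (by ring)
  have hi := integrable_gaussianPDFReal 0 1
  have hi1 : Integrable (fun x : ℝ => x * gaussianPDFReal 0 1 x) := by
    have e : (fun x : ℝ => x * gaussianPDFReal 0 1 x)
        = fun x => (Real.sqrt (2 * Real.pi * 1))⁻¹ * (x * Real.exp (-(1/2) * x ^ 2)) := by
      ext y; simp [gaussianPDFReal_def]; ring_nf
    rw [e]
    exact (integrable_mul_exp_neg_mul_sq (by norm_num)).const_mul _
  have ig : Integrable (fun x => g x * gaussianPDFReal 0 1 x) :=
    hi.bdd_mul (c := C) hgc.aestronglyMeasurable (Eventually.of_forall fun x => by simpa using hC x)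
  have ig' : Integrable (fun x => g' x * gaussianPDFReal 0 1 x) :=
    hi.bdd_mul (c := C) hg'.aestronglyMeasurable (Eventually.of_forall fun x => by simpa using hC' x)
  have ig1 : Integrable (fun x => g x * (x * gaussianPDFReal 0 1 x)) :=
    hi1.bdd_mul (c := C) hgc.aestronglyMeasurable (Eventually.of_forall fun x => by simpa using hC x)
  have := integral_mul_deriv_eq_deriv_mul_of_integrable (u := g) (v := gaussianPDFReal 0 1)
    (u' := g') (v' := fun x => -x * gaussianPDFReal 0 1 x) (fun x _ => hg x) (fun x _ => hpd x)
    (by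
      refine ig1.neg.congr (Eventually.of_forall fun x => ?_)
      simp) ig' ig
  have h2 : ∫ x, gaussianPDFReal 0 1 x • (x * g x) = - ∫ x, g x * (-x * gaussianPDFReal 0 1 x) := by
    rw [← integral_neg]; congr 1; ext x; simp; ring
  rw [h2, this, neg_neg]
  congr 1; ext x; simp; ring

section
variable {E : Type*} [Fintype E] [DecidableEq E]

lemma mp_update (e : E) : MeasurePreserving (fun q : (E → ℝ) × ℝ => Function.update q.1 e q.2)
    ((gam E).prod (gaussianReal 0 1)) (gam E) := by
  have hm : Measurable (fun q : (E → ℝ) × ℝ => Function.update q.1 e q.2) := by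
    rw [measurable_pi_iff]; intro i
    by_cases h : i = e
    · subst h; simpa using measurable_snd
    · simp [Function.update_of_ne h]; fun_prop
  refine ⟨hm, ?_⟩
  symm
  refine Measure.pi_eq fun s hs => ?_
  rw [Measure.map_apply hm (MeasurableSet.univ_pi hs)]
  have : (fun q : (E → ℝ) × ℝ => Function.update q.1 e q.2) ⁻¹' (Set.univ.pi s)
      = (Set.univ.pi (Function.update s e Set.univ)) ×ˢ s e := by
    ext ⟨x, z⟩
    simp only [Set.mem_preimage, Set.mem_pi, Set.mem_univ, true_implies, Set.mem_prod]
    constructor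
    · intro h
      refine ⟨fun i => ?_, by simpa using h e⟩
      by_cases hi : i = e
      · subst hi; simp
      · simpa [hi] using h i
    · rintro ⟨h1, h2⟩ i
      by_cases hi : i = e
      · subst hi; simpa using h2
      · simpa [hi] using h1 i
  rw [this, Measure.prod_prod, gam, Measure.pi_pi]
  rw [← Finset.mul_prod_erase _ _ (Finset.mem_univ e), ← Finset.mul_prod_erase univ (f := fun i => gaussianReal 0 1 (s i)) (Finset.mem_univ e)]
  simp only [Function.update_self, measure_univ, one_mul]
  rw [mul_comm]
  congr 1
  apply Finset.prod_congr rfl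
  intro i hi
  rw [Function.update_of_ne (Finset.ne_of_mem_erase hi)]

lemma mp_eval (e : E) : MeasurePreserving (fun x : E → ℝ => x e) (gam E) (gaussianReal 0 1) :=
  measurePreserving_eval _ e

lemma memLp_coord (e : E) (q : ENNReal) (hq : q ≠ ⊤) : MemLp (fun x : E → ℝ => x e) q (gam E) :=
  (memLp_id_gaussianReal' q hq).comp_measurePreserving (mp_eval e)

lemma integrable_coord (e : E) : Integrable (fun x : E → ℝ => x e) (gam E) :=
  memLp_one_iff_integrable.1 (memLp_coord e 1 (by simp))

lemma integrable_bdd {g : (E → ℝ) → ℝ} (hg : Continuous g) {C : ℝ} (hC : ∀ x, |g x| ≤ C) :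
    Integrable g (gam E) :=
  Integrable.of_bound hg.aestronglyMeasurable C (Eventually.of_forall fun x => by simpa using hC x)

lemma integrable_coord_mul (e : E) {g : (E → ℝ) → ℝ} (hg : Continuous g) {C : ℝ}
    (hC : ∀ x, |g x| ≤ C) : Integrable (fun x => x e * g x) (gam E) :=
  ((integrable_coord e).bdd_mul (c := C) hg.aestronglyMeasurable
    (Eventually.of_forall fun x => by simpa using hC x)).congr
      (Eventually.of_forall fun x => by simp [mul_comm])

lemma stein (e : E) {g : (E → ℝ) → ℝ} {ge : (E → ℝ) → ℝ}
    (hg : Continuous g) (hge : Continuous ge)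
    (hd : ∀ (x : E → ℝ) (t : ℝ), HasDerivAt (fun t => g (Function.update x e t))
      (ge (Function.update x e t)) t)
    {C : ℝ} (hC : ∀ x, |g x| ≤ C) (hC' : ∀ x, |ge x| ≤ C) :
    ∫ x, x e * g x ∂(gam E) = ∫ x, ge x ∂(gam E) := by
  have mp := mp_update e
  have i1 := integrable_coord_mul e hg hC
  have i2 := integrable_bdd hge hC'
  rw [← mp.map_eq] at i1 i2 ⊢
  rw [integral_map mp.aemeasurable i1.aestronglyMeasurable,
    integral_map mp.aemeasurable i2.aestronglyMeasurable]
  have i1' : Integrable (fun q : (E → ℝ) × ℝ => Function.update q.1 e q.2 e * g (Function.update q.1 e q.2)) _ :=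
    i1.comp_measurable mp.measurable
  have i2' : Integrable (fun q : (E → ℝ) × ℝ => ge (Function.update q.1 e q.2)) _ :=
    i2.comp_measurable mp.measurable
  rw [integral_prod _ i1', integral_prod _ i2']
  congr 1; ext x
  simp only [Function.update_self]
  refine stein1 (hd x) (hge.comp (by fun_prop)) (fun z => hC _) (fun z => hC' _)
end

set_option linter.unusedSectionVars false

/-- twice differentiable with bounded derivatives (explicit partial derivatives) -/
structure IsC2b {ι : Type*} [Fintype ι] (f : (ι → ℝ) → ℝ) (f1 : ι → (ι → ℝ) → ℝ)
    (f2 : ι → ι → (ι → ℝ) → ℝ) (C : ℝ) : Prop where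
  d1 : ∀ x, HasFDerivAt f (∑ a, f1 a x • (ContinuousLinearMap.proj a : (ι → ℝ) →L[ℝ] ℝ)) x
  d2 : ∀ a x, HasFDerivAt (f1 a) (∑ b, f2 a b x • (ContinuousLinearMap.proj b : (ι → ℝ) →L[ℝ] ℝ)) x
  c2 : ∀ a b, Continuous (f2 a b)
  b0 : ∀ x, |f x| ≤ C
  b1 : ∀ a x, |f1 a x| ≤ C
  b2 : ∀ a b x, |f2 a b x| ≤ C

section
variable {ι : Type*} [Fintype ι] {f : (ι → ℝ) → ℝ} {f1 : ι → (ι → ℝ) → ℝ}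
    {f2 : ι → ι → (ι → ℝ) → ℝ} {C : ℝ}

lemma IsC2b.cont (h : IsC2b f f1 f2 C) : Continuous f :=
  continuous_iff_continuousAt.2 fun x => (h.d1 x).continuousAt
lemma IsC2b.cont1 (h : IsC2b f f1 f2 C) (a : ι) : Continuous (f1 a) :=
  continuous_iff_continuousAt.2 fun x => (h.d2 a x).continuousAt

variable {E : Type*} [Fintype E] [DecidableEq E]

lemma stein_lin (h : IsC2b f f1 f2 C) (L : ι → E → ℝ) (a : ι) (e : E) :
    ∫ x, x e * f1 a (fun b => L b ⬝ᵥ x) ∂(gam E)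
      = ∑ b, L b e * ∫ x, f2 a b (fun b => L b ⬝ᵥ x) ∂(gam E) := by
  have hL : Continuous (fun (x : E → ℝ) (b : ι) => L b ⬝ᵥ x) := by
    refine continuous_pi fun b => ?_
    unfold dotProduct; fun_prop
  have hc2 : ∀ b, Continuous fun x : E → ℝ => f2 a b (fun b => L b ⬝ᵥ x) :=
    fun b => (h.c2 a b).comp hL
  have key := stein e (g := fun x => f1 a (fun b => L b ⬝ᵥ x))
    (ge := fun x => ∑ b, L b e * f2 a b (fun b => L b ⬝ᵥ x))
    (C := C + ∑ b, |L b e| * C) ((h.cont1 a).comp hL)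
    (continuous_finsetSum _ fun b _ => continuous_const.mul (hc2 b))
    (by
      intro x t
      have hw : HasDerivAt (fun t => fun b => L b ⬝ᵥ (Function.update x e t)) (fun b => L b e) t := by
        rw [hasDerivAt_pi]; intro b
        have := (hasDerivAt_update x e t)
        rw [hasDerivAt_pi] at this
        have h2 : HasDerivAt (fun t => ∑ i, L b i * Function.update x e t i)
            (∑ i, L b i * (Pi.single e (1:ℝ) : E → ℝ) i) t :=
          HasDerivAt.fun_sum fun i _ => (this i).const_mul (L b i)
        exact h2.congr_deriv (by simp [Pi.single_apply])
      exact ((h.d2 a _).comp_hasDerivAt t hw).congr_deriv (by simp [mul_comm]))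
    (fun x => (h.b1 a _).trans (le_add_of_nonneg_right (Finset.sum_nonneg fun b _ =>
      mul_nonneg (abs_nonneg _) ((abs_nonneg _).trans (h.b0 0)))))
    (fun x => by
      refine (Finset.abs_sum_le_sum_abs _ _).trans ((Finset.sum_le_sum fun b _ => ?_).trans
        (le_add_of_nonneg_left ((abs_nonneg _).trans (h.b0 0))))
      rw [abs_mul]
      exact mul_le_mul_of_nonneg_left (h.b2 a b _) (abs_nonneg _))
  rw [key, integral_finsetSum]
  · simp_rw [integral_const_mul]
  · intro b _
    exact (integrable_bdd (hc2 b) (fun x => h.b2 a b _)).const_mul _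

lemma integrable_dot (L : E → ℝ) : Integrable (fun x : E → ℝ => L ⬝ᵥ x) (gam E) := by
  unfold dotProduct
  exact integrable_finsetSum _ fun e _ => (integrable_coord e).const_mul _

lemma interp_deriv (h : IsC2b f f1 f2 C) (M N : ι → E → ℝ) (hMN : ∀ a b, M a ⬝ᵥ N b = 0) (θ : ℝ) :
    HasDerivAt (fun θ => ∫ x, f (fun a => (Real.sin θ • M a + Real.cos θ • N a) ⬝ᵥ x) ∂(gam E))
      (Real.sin θ * Real.cos θ * ∑ a, ∑ b, (M a ⬝ᵥ M b - N a ⬝ᵥ N b) *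
        ∫ x, f2 a b (fun a => (Real.sin θ • M a + Real.cos θ • N a) ⬝ᵥ x) ∂(gam E)) θ := by
  have hcont : ∀ θ : ℝ, Continuous (fun (x : E → ℝ) (a : ι) =>
      (Real.sin θ • M a + Real.cos θ • N a) ⬝ᵥ x) := by
    intro θ
    refine continuous_pi fun b => ?_
    unfold dotProduct; fun_prop
  have hC0 : 0 ≤ C := (abs_nonneg _).trans (h.b0 0)
  have hint2 : ∀ a, Integrable (fun x : E → ℝ => f1 a (fun a => (Real.sin θ • M a + Real.cos θ • N a) ⬝ᵥ x) *
      ((Real.cos θ • M a - Real.sin θ • N a) ⬝ᵥ x)) (gam E) := fun a =>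
    (integrable_dot _).bdd_mul (c := C) ((h.cont1 a).comp (hcont θ)).aestronglyMeasurable
      (Eventually.of_forall fun x => by simpa using h.b1 a _)
  have D := hasDerivAt_integral_of_dominated_loc_of_deriv_le (μ := gam E)
    (F := fun θ x => f (fun a => (Real.sin θ • M a + Real.cos θ • N a) ⬝ᵥ x))
    (F' := fun θ x => ∑ a, f1 a (fun a => (Real.sin θ • M a + Real.cos θ • N a) ⬝ᵥ x) *
      ((Real.cos θ • M a - Real.sin θ • N a) ⬝ᵥ x))
    (x₀ := θ) (s := Set.univ) (bound := fun x => ∑ a, C * (|M a ⬝ᵥ x| + |N a ⬝ᵥ x|)) Filter.univ_mem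
    (Eventually.of_forall fun θ => (h.cont.comp (hcont θ)).aestronglyMeasurable)
    (integrable_bdd (h.cont.comp (hcont θ)) (fun x => h.b0 _))
    (integrable_finsetSum _ fun a _ => hint2 a).aestronglyMeasurable
    (by
      refine Eventually.of_forall fun x θ _ => ?_
      rw [Real.norm_eq_abs]
      refine (Finset.abs_sum_le_sum_abs _ _).trans (Finset.sum_le_sum fun a _ => ?_)
      rw [abs_mul]
      refine mul_le_mul (h.b1 a _) ?_ (abs_nonneg _) hC0
      rw [sub_dotProduct, smul_dotProduct, smul_dotProduct, smul_eq_mul, smul_eq_mul]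
      refine (abs_sub _ _).trans ?_
      rw [abs_mul, abs_mul]
      exact add_le_add (mul_le_of_le_one_left (abs_nonneg _) (Real.abs_cos_le_one _))
        (mul_le_of_le_one_left (abs_nonneg _) (Real.abs_sin_le_one _)))
    (integrable_finsetSum _ fun a _ =>
      (((integrable_dot _).abs).add ((integrable_dot _).abs)).const_mul _)
    (by
      refine Eventually.of_forall fun x θ _ => ?_
      have hw : HasDerivAt (fun θ => fun a => (Real.sin θ • M a + Real.cos θ • N a) ⬝ᵥ x)
          (fun a => (Real.cos θ • M a - Real.sin θ • N a) ⬝ᵥ x) θ := by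
        rw [hasDerivAt_pi]; intro a
        simp only [add_dotProduct, sub_dotProduct, smul_dotProduct, smul_eq_mul]
        exact (((Real.hasDerivAt_sin θ).mul_const _).add ((Real.hasDerivAt_cos θ).mul_const _)).congr_deriv
          (by ring)
      exact ((h.d1 _).comp_hasDerivAt θ hw).congr_deriv (by simp))
  refine D.2.congr_deriv ?_
  rw [integral_finsetSum _ fun a _ => hint2 a, Finset.mul_sum]
  refine Finset.sum_congr rfl fun a _ => ?_
  have e1 : ∀ x : E → ℝ, f1 a (fun a => (Real.sin θ • M a + Real.cos θ • N a) ⬝ᵥ x) *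
      ((Real.cos θ • M a - Real.sin θ • N a) ⬝ᵥ x) = ∑ e, (Real.cos θ • M a - Real.sin θ • N a) e *
      (x e * f1 a (fun a => (Real.sin θ • M a + Real.cos θ • N a) ⬝ᵥ x)) := by
    intro x
    rw [dotProduct, Finset.mul_sum]
    exact Finset.sum_congr rfl fun e _ => by ring
  simp_rw [e1]
  have hi3 : ∀ e, Integrable (fun x : E → ℝ => (Real.cos θ • M a - Real.sin θ • N a) e *
      (x e * f1 a (fun a => (Real.sin θ • M a + Real.cos θ • N a) ⬝ᵥ x))) (gam E) := fun e =>
    (integrable_coord_mul e ((h.cont1 a).comp (hcont θ)) (fun x => h.b1 a _)).const_mul _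
  rw [integral_finsetSum _ fun e _ => hi3 e]
  simp_rw [integral_const_mul]
  have hs := stein_lin h (fun a => Real.sin θ • M a + Real.cos θ • N a) a
  simp_rw [hs, Finset.mul_sum]
  rw [Finset.sum_comm]
  refine Finset.sum_congr rfl fun b _ => ?_
  simp_rw [← mul_assoc]
  rw [← Finset.sum_mul]
  congr 1
  have : ∑ i, (Real.cos θ • M a - Real.sin θ • N a) i * (Real.sin θ • M b + Real.cos θ • N b) i
    = (Real.cos θ • M a - Real.sin θ • N a) ⬝ᵥ (Real.sin θ • M b + Real.cos θ • N b) := rfl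
  rw [this]
  simp only [add_dotProduct, sub_dotProduct, smul_dotProduct, dotProduct_add, dotProduct_smul, smul_eq_mul,
    hMN, dotProduct_comm (N a) (M b)]
  ring

lemma interp_le (h : IsC2b f f1 f2 C) (M N : ι → E → ℝ) (hMN : ∀ a b, M a ⬝ᵥ N b = 0)
    (hs : ∀ a b x, 0 ≤ (M a ⬝ᵥ M b - N a ⬝ᵥ N b) * f2 a b x) :
    ∫ x, f (fun a => N a ⬝ᵥ x) ∂(gam E) ≤ ∫ x, f (fun a => M a ⬝ᵥ x) ∂(gam E) := by
  have hd := interp_deriv h M N hMN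
  have hm := monotoneOn_of_deriv_nonneg (convex_Icc 0 (Real.pi / 2))
    (fun θ _ => (hd θ).continuousAt.continuousWithinAt)
    (fun θ _ => (hd θ).differentiableAt.differentiableWithinAt)
    (by
      intro θ hθ
      rw [interior_Icc] at hθ
      rw [(hd θ).deriv]
      refine mul_nonneg (mul_nonneg (Real.sin_nonneg_of_nonneg_of_le_pi hθ.1.le (by linarith [hθ.2, hθ.1]))
        (Real.cos_nonneg_of_neg_pi_div_two_le_of_le (by linarith [hθ.1, Real.pi_pos]) hθ.2.le)) ?_
      refine Finset.sum_nonneg fun a _ => Finset.sum_nonneg fun b _ => ?_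
      rw [← integral_const_mul]
      exact integral_nonneg fun x => hs a b _)
  have := hm (Set.left_mem_Icc.2 (by positivity)) (Set.right_mem_Icc.2 (by positivity)) (by positivity)
  simpa using this
end

set_option linter.unusedSectionVars false

/-- existence of bounded second-order data -/
def C2b {ι : Type*} [Fintype ι] (f : (ι → ℝ) → ℝ) : Prop :=
  ∃ f1 f2 C, IsC2b f f1 f2 C

section
variable {ι : Type*} [Fintype ι] [DecidableEq ι]

lemma C2b.const (c : ℝ) : C2b (fun _ : ι → ℝ => c) :=
  ⟨fun _ _ => 0, fun _ _ _ => 0, |c|,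
    { d1 := fun x => by simpa using hasFDerivAt_const c x
      d2 := fun a x => by simpa using hasFDerivAt_const (0:ℝ) x
      c2 := fun _ _ => continuous_const
      b0 := fun _ => le_rfl
      b1 := fun _ _ => by simp
      b2 := fun _ _ _ => by simp }⟩

lemma C2b.one_sub {f : (ι → ℝ) → ℝ} (hf : C2b f) : C2b (fun x => 1 - f x) := by
  obtain ⟨f1, f2, C, h⟩ := hf
  refine ⟨fun a x => - f1 a x, fun a b x => - f2 a b x, 1 + C, ?_⟩
  have hC : 0 ≤ C := (abs_nonneg _).trans (h.b0 0)
  exact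
    { d1 := fun x => ((h.d1 x).const_sub 1).congr_fderiv (by ext v; simp)
      d2 := fun a x => (h.d2 a x).neg.congr_fderiv (by ext v; simp)
      c2 := fun a b => (h.c2 a b).neg
      b0 := fun x => (abs_sub _ _).trans (by simpa using h.b0 x)
      b1 := fun a x => by rw [abs_neg]; linarith [h.b1 a x]
      b2 := fun a b x => by rw [abs_neg]; linarith [h.b2 a b x] }

lemma C2b.mul {f g : (ι → ℝ) → ℝ} (hf : C2b f) (hg : C2b g) : C2b (fun x => f x * g x) := by
  obtain ⟨f1, f2, C, h⟩ := hf
  obtain ⟨g1, g2, D, k⟩ := hg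
  have hC : 0 ≤ C := (abs_nonneg _).trans (h.b0 0)
  have hD : 0 ≤ D := (abs_nonneg _).trans (k.b0 0)
  have hCD : 0 ≤ C * D := mul_nonneg hC hD
  have bb : ∀ u v : ℝ, |u| ≤ C → |v| ≤ D → |u * v| ≤ C * D := fun u v hu hv => by
    rw [abs_mul]; exact mul_le_mul hu hv (abs_nonneg _) hC
  refine ⟨fun a x => f1 a x * g x + f x * g1 a x,
    fun a b x => f2 a b x * g x + f1 a x * g1 b x + f1 b x * g1 a x + f x * g2 a b x, 4 * (C * D), ?_⟩
  exact
    { d1 := fun x => ((h.d1 x).mul (k.d1 x)).congr_fderiv (by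
        ext v; simp [Finset.mul_sum, ← Finset.sum_add_distrib]
        exact Finset.sum_congr rfl fun a _ => by ring)
      d2 := fun a x => (((h.d2 a x).mul (k.d1 x)).add ((h.d1 x).mul (k.d2 a x))).congr_fderiv (by
        ext v; simp [Finset.mul_sum, ← Finset.sum_add_distrib]
        exact Finset.sum_congr rfl fun a _ => by ring)
      c2 := fun a b => ((((h.c2 a b).mul k.cont).add ((h.cont1 a).mul (k.cont1 b))).add
        ((h.cont1 b).mul (k.cont1 a))).add (h.cont.mul (k.c2 a b))
      b0 := fun x => (bb _ _ (h.b0 x) (k.b0 x)).trans (by linarith)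
      b1 := fun a x => (abs_add_le _ _).trans (by
        linarith [bb _ _ (h.b1 a x) (k.b0 x), bb _ _ (h.b0 x) (k.b1 a x)])
      b2 := fun a b x => (abs_add_le _ _).trans (by
        have h1 := abs_add_le (f2 a b x * g x + f1 a x * g1 b x) (f1 b x * g1 a x)
        have h2 := abs_add_le (f2 a b x * g x) (f1 a x * g1 b x)
        linarith [bb _ _ (h.b1 a x) (k.b1 b x), bb _ _ (h.b1 b x) (k.b1 a x),
          bb _ _ (h.b0 x) (k.b2 a b x), bb _ _ (h.b2 a b x) (k.b0 x)]) }

lemma C2b.prod {κ : Type*} (s : Finset κ) {f : κ → (ι → ℝ) → ℝ} (hf : ∀ k, C2b (f k)) :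
    C2b (fun x => ∏ k ∈ s, f k x) := by
  classical
  induction s using Finset.induction_on with
  | empty => simpa using C2b.const 1
  | insert a s ha ih =>
    simp_rw [Finset.prod_insert ha]
    exact (hf a).mul ih

lemma C2b.coord (a : ι) {g g' g'' : ℝ → ℝ} (h1 : ∀ t, HasDerivAt g (g' t) t)
    (h2 : ∀ t, HasDerivAt g' (g'' t) t) (hc : Continuous g'') {C : ℝ}
    (b0 : ∀ t, |g t| ≤ C) (b1 : ∀ t, |g' t| ≤ C) (b2 : ∀ t, |g'' t| ≤ C) :
    C2b (fun x : ι → ℝ => g (x a)) := by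
  have hC : 0 ≤ C := (abs_nonneg _).trans (b0 0)
  have hp : ∀ x : ι → ℝ, HasFDerivAt (fun x : ι → ℝ => x a)
      (ContinuousLinearMap.proj a : (ι → ℝ) →L[ℝ] ℝ) x := fun x => hasFDerivAt_apply a x
  refine ⟨fun b x => if b = a then g' (x a) else 0,
    fun b c x => if b = a then (if c = a then g'' (x a) else 0) else 0, C, ?_⟩
  exact
    { d1 := fun x => ((h1 (x a)).comp_hasFDerivAt x (hp x)).congr_fderiv (by
        ext v; simp)
      d2 := fun b x => by
        by_cases hb : b = a
        · simp only [hb, if_true]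
          exact ((h2 (x a)).comp_hasFDerivAt x (hp x)).congr_fderiv (by ext v; simp)
        · simpa [hb] using hasFDerivAt_const (0:ℝ) x
      c2 := fun b c => by
        split_ifs
        · exact hc.comp (continuous_apply a)
        · exact continuous_const
        · exact continuous_const
      b0 := fun x => b0 _
      b1 := fun b x => by split_ifs; exacts [b1 _, by simpa using hC]
      b2 := fun b c x => by split_ifs; exacts [b2 _, by simpa using hC, by simpa using hC] }

lemma deriv_nonneg_of_right {g : ℝ → ℝ} {g' : ℝ} (h : HasDerivAt g g' 0)
    (hg : ∀ s, 0 ≤ s → g 0 ≤ g s) : 0 ≤ g' := by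
  have h1 := h.tendsto_slope_zero_right
  refine ge_of_tendsto h1 ?_
  filter_upwards [self_mem_nhdsWithin] with t ht
  have ht : 0 < t := ht
  have := hg t ht.le
  simp only [zero_add, smul_eq_mul]
  exact mul_nonneg (inv_nonneg.2 ht.le) (by linarith)

lemma IsC2b.partial {f : (ι → ℝ) → ℝ} {f1 : ι → (ι → ℝ) → ℝ}
    (d1 : ∀ x, HasFDerivAt f (∑ a, f1 a x • (ContinuousLinearMap.proj a : (ι → ℝ) →L[ℝ] ℝ)) x)
    (a : ι) (x : ι → ℝ) :
    HasDerivAt (fun s : ℝ => f (x + s • Pi.single a 1)) (f1 a x) 0 := by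
  have hw : HasDerivAt (fun s : ℝ => x + s • (Pi.single a 1 : ι → ℝ)) (Pi.single a 1) 0 := by
    simpa using ((hasDerivAt_id (0:ℝ)).smul_const (Pi.single a 1 : ι → ℝ)).const_add x
  have h0 := d1 (x + (0:ℝ) • Pi.single a 1)
  exact (h0.comp_hasDerivAt (0:ℝ) hw).congr_deriv (by simp [Pi.single_apply])

lemma IsC2b.sign {f : (ι → ℝ) → ℝ} {f1 : ι → (ι → ℝ) → ℝ} {f2 : ι → ι → (ι → ℝ) → ℝ} {C : ℝ}
    (h : IsC2b f f1 f2 C) (a b : ι)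
    (hd : ∀ (x : ι → ℝ) (s t : ℝ), 0 ≤ s → 0 ≤ t → f (x + t • Pi.single b 1) + f (x + s • Pi.single a 1) ≤
      f (x + t • Pi.single b 1 + s • Pi.single a 1) + f x) (x : ι → ℝ) : 0 ≤ f2 a b x := by
  refine deriv_nonneg_of_right (IsC2b.partial (h.d2 a) b x) fun t ht => ?_
  have h1 := (IsC2b.partial h.d1 a (x + t • Pi.single b 1)).sub (IsC2b.partial h.d1 a x)
  have := deriv_nonneg_of_right h1 (fun s hs => by
    have := hd x s t hs ht
    simp only [Pi.sub_apply, zero_smul, add_zero]; linarith)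
  simp only [zero_smul, add_zero]; linarith
end

lemma smooth_data : ∃ s s' s'' : ℝ → ℝ, ∃ C : ℝ, (∀ t, HasDerivAt s (s' t) t) ∧
    (∀ t, HasDerivAt s' (s'' t) t) ∧ Continuous s'' ∧ (∀ t, |s t| ≤ C) ∧ (∀ t, |s' t| ≤ C) ∧
    (∀ t, |s'' t| ≤ C) ∧ Monotone s ∧ (∀ t, 0 ≤ s t) ∧ (∀ t, s t ≤ 1) ∧ (∀ t ≤ 0, s t = 0) ∧
    (∀ t, 1 ≤ t → s t = 1) := by
  set s := Real.smoothTransition with hs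
  have hcd : ContDiff ℝ 2 s := Real.smoothTransition.contDiff
  have hcd1 : ContDiff ℝ 1 (deriv s) := by
    have : ContDiff ℝ (1 + 1) s := by simpa [one_add_one_eq_two] using hcd
    exact (contDiff_succ_iff_deriv.1 this).2.2
  have hcs : HasCompactSupport (deriv s) := by
    refine HasCompactSupport.of_support_subset_isCompact (isCompact_Icc (a := (0:ℝ)) (b := 1)) ?_
    intro x hx
    by_contra hn
    rw [Set.mem_Icc, not_and_or, not_le, not_le] at hn
    apply hx
    rcases hn with hn | hn
    · have : s =ᶠ[𝓝 x] fun _ => 0 := by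
        filter_upwards [Iio_mem_nhds hn] with y hy
        exact Real.smoothTransition.zero_of_nonpos (le_of_lt hy)
      rw [this.deriv_eq]; simp
    · have : s =ᶠ[𝓝 x] fun _ => 1 := by
        filter_upwards [Ioi_mem_nhds hn] with y hy
        exact Real.smoothTransition.one_of_one_le (le_of_lt hy)
      rw [this.deriv_eq]; simp
  have hc2 : Continuous (deriv (deriv s)) := hcd1.continuous_deriv le_rfl
  obtain ⟨C1, hC1⟩ := hcs.exists_bound_of_continuous hcd1.continuous
  obtain ⟨C2, hC2⟩ := hcs.deriv.exists_bound_of_continuous hc2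
  refine ⟨s, deriv s, deriv (deriv s), max 1 (max C1 C2), ?_, ?_, hc2, ?_, ?_, ?_, ?_,
    Real.smoothTransition.nonneg, Real.smoothTransition.le_one,
    fun t => Real.smoothTransition.zero_of_nonpos, fun t => Real.smoothTransition.one_of_one_le⟩
  · exact fun t => (hcd.differentiable (by norm_num) t).hasDerivAt
  · exact fun t => (hcd1.differentiable (by norm_num) t).hasDerivAt
  · intro t
    rw [abs_of_nonneg (Real.smoothTransition.nonneg t)]
    exact (Real.smoothTransition.le_one t).trans (le_max_left _ _)
  · exact fun t => (hC1 t).trans ((le_max_left _ _).trans (le_max_right _ _))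
  · exact fun t => (hC2 t).trans ((le_max_right _ _).trans (le_max_right _ _))
  · exact Real.smoothTransition.monotone

set_option linter.unusedSectionVars false

section
variable {I J E : Type*} [Fintype I] [Fintype J] [Fintype E] [DecidableEq I] [DecidableEq J] [DecidableEq E]

lemma gordon_smooth (M N : I × J → E → ℝ) (hMN : ∀ a b, M a ⬝ᵥ N b = 0)
    (hrow : ∀ a b : I × J, a.1 = b.1 → M a ⬝ᵥ M b = N a ⬝ᵥ N b)
    (hne : ∀ a b : I × J, N a ⬝ᵥ N b ≤ M a ⬝ᵥ M b)
    (k : I × J → ℝ → ℝ) (hk : ∀ a, C2b (fun x : I × J → ℝ => k a (x a)))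
    (k0 : ∀ a t, 0 ≤ k a t) (k1 : ∀ a t, k a t ≤ 1) (ka : ∀ a, Antitone (k a)) :
    ∫ x, ∏ i, (1 - ∏ j, k (i, j) (N (i, j) ⬝ᵥ x)) ∂(gam E) ≤
      ∫ x, ∏ i, (1 - ∏ j, k (i, j) (M (i, j) ⬝ᵥ x)) ∂(gam E) := by
  set R : I → (I × J → ℝ) → ℝ := fun i x => 1 - ∏ j, k (i, j) (x (i, j)) with hR
  have hf : C2b (fun x : I × J → ℝ => ∏ i, R i x) :=
    C2b.prod _ fun i => (C2b.prod _ fun j => hk (i, j)).one_sub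
  obtain ⟨f1, f2, C, h⟩ := hf
  have R0 : ∀ i x, 0 ≤ R i x := fun i x => by
    have : ∏ j, k (i, j) (x (i, j)) ≤ 1 := Finset.prod_le_one (fun j _ => k0 _ _) (fun j _ => k1 _ _)
    simp only [hR]; linarith
  have Rmono : ∀ i (x y : I × J → ℝ), (∀ a, x a ≤ y a) → R i x ≤ R i y := fun i x y hxy => by
    simp only [hR]
    have : ∏ j, k (i, j) (y (i, j)) ≤ ∏ j, k (i, j) (x (i, j)) :=
      Finset.prod_le_prod (fun j _ => k0 _ _) (fun j _ => ka _ (hxy _))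
    linarith
  have Rc : ∀ i (x y : I × J → ℝ), (∀ j, x (i, j) = y (i, j)) → R i x = R i y := fun i x y hxy => by
    simp only [hR, hxy]
  refine interp_le h M N hMN ?_
  intro a b x
  by_cases hab : a.1 = b.1
  · rw [hrow a b hab]; simp
  refine mul_nonneg (by linarith [hne a b]) (h.sign a b ?_ x)
  intro x s t hs ht
  have hb : b.1 ∈ Finset.univ.erase a.1 := Finset.mem_erase.2 ⟨fun h => hab h.symm, Finset.mem_univ _⟩
  have split : ∀ y, ∏ i, R i y = R a.1 y * (R b.1 y * ∏ i ∈ (Finset.univ.erase a.1).erase b.1, R i y) := by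
    intro y
    rw [← Finset.mul_prod_erase _ _ (Finset.mem_univ a.1), ← Finset.mul_prod_erase _ _ hb]
  have rest : ∀ (z : I × J → ℝ), (∀ i, i ≠ a.1 → i ≠ b.1 → ∀ j, z (i, j) = x (i, j)) →
      ∏ i ∈ (Finset.univ.erase a.1).erase b.1, R i z = ∏ i ∈ (Finset.univ.erase a.1).erase b.1, R i x := by
    intro z hz
    refine Finset.prod_congr rfl fun i hi => Rc _ _ _ (hz i ?_ ?_)
    · exact Finset.ne_of_mem_erase (Finset.mem_of_mem_erase hi)
    · exact Finset.ne_of_mem_erase hi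
  have sa : ∀ i j, i ≠ a.1 → (Pi.single a (1:ℝ) : I × J → ℝ) (i, j) = 0 := fun i j hij => by
    rw [Pi.single_apply, if_neg]; rintro rfl; exact hij rfl
  have sb : ∀ i j, i ≠ b.1 → (Pi.single b (1:ℝ) : I × J → ℝ) (i, j) = 0 := fun i j hij => by
    rw [Pi.single_apply, if_neg]; rintro rfl; exact hij rfl
  have hba : b.1 ≠ a.1 := fun h => hab h.symm
  rw [split, split (x + s • Pi.single a 1), split (x + t • Pi.single b 1 + s • Pi.single a 1), split x]
  rw [rest (x + t • Pi.single b 1) (by intro i h1 h2 j; simp [sb i j h2]),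
    rest (x + s • Pi.single a 1) (by intro i h1 h2 j; simp [sa i j h1]),
    rest (x + t • Pi.single b 1 + s • Pi.single a 1) (by intro i h1 h2 j; simp [sa i j h1, sb i j h2]),
    Rc a.1 (x + t • Pi.single b 1) x (by intro j; simp [sb _ j hab]),
    Rc b.1 (x + s • Pi.single a 1) x (by intro j; simp [sa _ j hba]),
    Rc a.1 (x + t • Pi.single b 1 + s • Pi.single a 1) (x + s • Pi.single a 1) (by intro j; simp [sb _ j hab]),
    Rc b.1 (x + t • Pi.single b 1 + s • Pi.single a 1) (x + t • Pi.single b 1) (by intro j; simp [sa _ j hba])]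
  have p1 : R a.1 x ≤ R a.1 (x + s • Pi.single a 1) := Rmono _ _ _ fun c => by
    simp only [Pi.add_apply, Pi.smul_apply, smul_eq_mul, Pi.single_apply]
    split_ifs <;> simp [hs]
  have p2 : R b.1 x ≤ R b.1 (x + t • Pi.single b 1) := Rmono _ _ _ fun c => by
    simp only [Pi.add_apply, Pi.smul_apply, smul_eq_mul, Pi.single_apply]
    split_ifs <;> simp [ht]
  have p3 : 0 ≤ ∏ i ∈ (Finset.univ.erase a.1).erase b.1, R i x := Finset.prod_nonneg fun i _ => R0 i x
  nlinarith [mul_nonneg (mul_nonneg (sub_nonneg.2 p1) (sub_nonneg.2 p2)) p3]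

lemma gordon_fin (M N : I × J → E → ℝ) (hMN : ∀ a b, M a ⬝ᵥ N b = 0)
    (hrow : ∀ a b : I × J, a.1 = b.1 → M a ⬝ᵥ M b = N a ⬝ᵥ N b)
    (hne : ∀ a b : I × J, N a ⬝ᵥ N b ≤ M a ⬝ᵥ M b) (c : I × J → ℝ) :
    (gam E) {x | ∃ i, ∀ j, M (i, j) ⬝ᵥ x < c (i, j)} ≤ (gam E) {x | ∃ i, ∀ j, N (i, j) ⬝ᵥ x < c (i, j)} := by
  obtain ⟨s, s', s'', C, h1, h2, hc, b0, b1, b2, sm, s0, s1, sz, so⟩ := smooth_data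
  have hsc : Continuous s := continuous_iff_continuousAt.2 fun x => (h1 x).continuousAt
  let k : ℕ → I × J → ℝ → ℝ := fun m a t => s (m * (c a - t))
  have hineq : ∀ m : ℕ, ∫ x, ∏ i, (1 - ∏ j, k m (i, j) (N (i, j) ⬝ᵥ x)) ∂(gam E) ≤
      ∫ x, ∏ i, (1 - ∏ j, k m (i, j) (M (i, j) ⬝ᵥ x)) ∂(gam E) := by
    intro m
    refine gordon_smooth M N hMN hrow hne (k m) ?_ (fun a t => s0 _) (fun a t => s1 _) ?_
    · intro a
      have hl : ∀ t : ℝ, HasDerivAt (fun t : ℝ => (m:ℝ) * (c a - t)) (-(m:ℝ)) t := fun t =>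
        (((hasDerivAt_id t).const_sub (c a)).const_mul (m:ℝ)).congr_deriv (by simp)
      refine C2b.coord a (g := k m a) (g' := fun t => s' (m * (c a - t)) * (-(m:ℝ)))
        (g'' := fun t => s'' (m * (c a - t)) * (-(m:ℝ)) * (-(m:ℝ))) (C := C + C * m + C * m * m) ?_ ?_ ?_ ?_ ?_ ?_
      · exact fun t => (h1 _).comp t (hl t)
      · exact fun t => ((h2 _).comp t (hl t)).mul_const _
      · exact ((hc.comp (by fun_prop)).mul continuous_const).mul continuous_const
      all_goals
        intro t
        have hC : 0 ≤ C := (abs_nonneg _).trans (b0 0)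
        have q1 : 0 ≤ C * m := by positivity
        have q2 : 0 ≤ C * m * m := by positivity
      · linarith [b0 ((m:ℝ) * (c a - t))]
      · rw [abs_mul, abs_neg, Nat.abs_cast]
        have := mul_le_mul_of_nonneg_right (b1 ((m:ℝ) * (c a - t))) (Nat.cast_nonneg (α := ℝ) m)
        linarith
      · rw [abs_mul, abs_mul, abs_neg, Nat.abs_cast]
        have := mul_le_mul_of_nonneg_right (mul_le_mul_of_nonneg_right (b2 ((m:ℝ) * (c a - t)))
          (Nat.cast_nonneg (α := ℝ) m)) (Nat.cast_nonneg (α := ℝ) m)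
        linarith
    · intro a t t' htt
      exact sm (mul_le_mul_of_nonneg_left (by linarith) (Nat.cast_nonneg m))
  have hlim : ∀ L : I × J → E → ℝ, Tendsto (fun m : ℕ => ∫ x, ∏ i, (1 - ∏ j, k m (i, j) (L (i, j) ⬝ᵥ x)) ∂(gam E))
      atTop (𝓝 (1 - (gam E).real {x | ∃ i, ∀ j, L (i, j) ⬝ᵥ x < c (i, j)})) := by
    intro L
    have hLc : ∀ a, Continuous fun x : E → ℝ => L a ⬝ᵥ x := fun a => by unfold dotProduct; fun_prop
    have hms : MeasurableSet {x | ∃ i, ∀ j, L (i, j) ⬝ᵥ x < c (i, j)} := by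
      simp only [Set.ofPred_exists, Set.ofPred_forall]
      exact MeasurableSet.iUnion fun i => MeasurableSet.iInter fun j =>
        measurableSet_lt (hLc _).measurable measurable_const
    have e : 1 - (gam E).real {x | ∃ i, ∀ j, L (i, j) ⬝ᵥ x < c (i, j)} =
        ∫ x, ({x | ∃ i, ∀ j, L (i, j) ⬝ᵥ x < c (i, j)}ᶜ).indicator 1 x ∂(gam E) := by
      rw [integral_indicator_one hms.compl, probReal_compl_eq_one_sub hms]
    rw [e]
    refine tendsto_integral_of_dominated_convergence (fun _ => 1) ?_ (integrable_const _) ?_ ?_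
    · intro m
      refine Continuous.aestronglyMeasurable ?_
      refine continuous_finsetProd _ fun i _ => continuous_const.sub (continuous_finsetProd _ fun j _ => ?_)
      exact hsc.comp (continuous_const.mul (continuous_const.sub (hLc _)))
    · intro m
      refine Eventually.of_forall fun x => ?_
      have hp : ∀ i, ∏ j, k m (i, j) (L (i, j) ⬝ᵥ x) ≤ 1 ∧ 0 ≤ ∏ j, k m (i, j) (L (i, j) ⬝ᵥ x) := fun i =>
        ⟨Finset.prod_le_one (fun j _ => s0 _) (fun j _ => s1 _), Finset.prod_nonneg fun j _ => s0 _⟩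
      rw [Real.norm_eq_abs, abs_of_nonneg (Finset.prod_nonneg fun i _ => by linarith [hp i])]
      exact Finset.prod_le_one (fun i _ => by linarith [hp i]) (fun i _ => by linarith [hp i])
    · refine Eventually.of_forall fun x => ?_
      have ht : ∀ a, Tendsto (fun m => k m a (L a ⬝ᵥ x)) atTop (𝓝 (if L a ⬝ᵥ x < c a then 1 else 0)) := by
        intro a
        split_ifs with hlt
        · refine tendsto_const_nhds.congr' ?_
          have := (tendsto_natCast_atTop_atTop (R := ℝ)).atTop_mul_const (sub_pos.2 hlt)
          filter_upwards [this.eventually_ge_atTop 1] with m hm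
          exact (so _ hm).symm
        · refine tendsto_const_nhds.congr fun m => ?_
          exact (sz _ (mul_nonpos_of_nonneg_of_nonpos (Nat.cast_nonneg m) (by linarith))).symm
      have := tendsto_finsetProd (Finset.univ : Finset I) fun i _ => (tendsto_const_nhds (x := (1:ℝ))).sub
        (tendsto_finsetProd (Finset.univ : Finset J) fun j _ => ht (i, j))
      convert this using 2
      by_cases hx : ∃ i, ∀ j, L (i, j) ⬝ᵥ x < c (i, j)
      · rw [Set.indicator_of_notMem (by simpa using hx)]
        obtain ⟨i, hi⟩ := hx
        symm
        refine Finset.prod_eq_zero (Finset.mem_univ i) ?_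
        simp [hi]
      · rw [Set.indicator_of_mem (by simpa using hx)]
        push Not at hx
        symm
        simp only [Pi.one_apply]
        refine Finset.prod_eq_one fun i _ => ?_
        obtain ⟨j, hj⟩ := hx i
        rw [Finset.prod_eq_zero (Finset.mem_univ j) (by rw [if_neg (not_lt.2 hj)]), sub_zero]
  have := le_of_tendsto_of_tendsto' (hlim N) (hlim M) hineq
  have h3 : (gam E).real {x | ∃ i, ∀ j, M (i, j) ⬝ᵥ x < c (i, j)} ≤
    (gam E).real {x | ∃ i, ∀ j, N (i, j) ⬝ᵥ x < c (i, j)} := by linarith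
  exact (ENNReal.toReal_le_toReal (measure_ne_top _ _) (measure_ne_top _ _)).1 h3
end

set_option linter.unusedSectionVars false

section
variable {E : Type*} [Fintype E] [DecidableEq E]

lemma meas_ev (M : ℕ → ℕ → E → ℝ) (c : ℕ → ℕ → ℝ) (i j : ℕ) :
    MeasurableSet {x : E → ℝ | M i j ⬝ᵥ x < c i j} :=
  measurableSet_lt (by unfold dotProduct; fun_prop) measurable_const

lemma gordon_nat (M N : ℕ → ℕ → E → ℝ) (hMN : ∀ i j k l, M i j ⬝ᵥ N k l = 0)
    (hrow : ∀ i j l, M i j ⬝ᵥ M i l = N i j ⬝ᵥ N i l)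
    (hne : ∀ i j k l, N i j ⬝ᵥ N k l ≤ M i j ⬝ᵥ M k l) (c : ℕ → ℕ → ℝ) :
    (gam E) {x | ∃ i, ∀ j, M i j ⬝ᵥ x < c i j} ≤ (gam E) {x | ∃ i, ∀ j, N i j ⬝ᵥ x < c i j} := by
  have hfin : ∀ k l : ℕ, (gam E) {x | ∃ i < k, ∀ j < l, M i j ⬝ᵥ x < c i j} ≤
      (gam E) {x | ∃ i < k, ∀ j < l, N i j ⬝ᵥ x < c i j} := by
    intro k l
    have := gordon_fin (I := Fin k) (J := Fin l) (fun a => M a.1 a.2) (fun a => N a.1 a.2)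
      (fun a b => hMN _ _ _ _) (fun a b h => by
        have : (a.1 : ℕ) = b.1 := by rw [h]
        simp only [this]; exact hrow _ _ _) (fun a b => hne _ _ _ _) (fun a => c a.1 a.2)
    have e : ∀ L : ℕ → ℕ → E → ℝ, {x | ∃ i < k, ∀ j < l, L i j ⬝ᵥ x < c i j} =
        {x | ∃ i : Fin k, ∀ j : Fin l, L i j ⬝ᵥ x < c i j} := by
      intro L; ext x
      constructor
      · rintro ⟨i, hi, h⟩; exact ⟨⟨i, hi⟩, fun j => h j j.2⟩
      · rintro ⟨i, h⟩; exact ⟨i, i.2, fun j hj => h ⟨j, hj⟩⟩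
    rw [e, e]; exact this
  have hms : ∀ k l, MeasurableSet {x | ∃ i < k, ∀ j < l, N i j ⬝ᵥ x < c i j} := by
    intro k l
    have : {x | ∃ i < k, ∀ j < l, N i j ⬝ᵥ x < c i j} =
        ⋃ i, ⋃ (_ : i < k), ⋂ j, ⋂ (_ : j < l), {x | N i j ⬝ᵥ x < c i j} := by
      ext x; simp
    rw [this]
    exact MeasurableSet.iUnion fun i => MeasurableSet.iUnion fun _ => MeasurableSet.iInter fun j =>
      MeasurableSet.iInter fun _ => meas_ev N c i j
  have hl : ∀ k : ℕ, (gam E) {x | ∃ i < k, ∀ j, M i j ⬝ᵥ x < c i j} ≤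
      (gam E) {x | ∃ i, ∀ j, N i j ⬝ᵥ x < c i j} := by
    intro k
    have hanti : Antitone fun l : ℕ => {x | ∃ i < k, ∀ j < l, N i j ⬝ᵥ x < c i j} := by
      intro l l' hll x
      rintro ⟨i, hi, h⟩
      exact ⟨i, hi, fun j hj => h j (hj.trans_le hll)⟩
    have ht := tendsto_measure_iInter_atTop (μ := gam E) (fun l => (hms k l).nullMeasurableSet) hanti
      ⟨0, measure_ne_top _ _⟩
    refine (ge_of_tendsto' ht fun l => ?_).trans (measure_mono ?_)
    · refine le_trans (measure_mono ?_) (hfin k l)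
      rintro x ⟨i, hi, h⟩
      exact ⟨i, hi, fun j _ => h j⟩
    · intro x hx
      rw [Set.mem_iInter] at hx
      by_contra hn
      simp only [Set.mem_ofPred_eq, not_exists, not_forall] at hn
      choose J hJ using hn
      obtain ⟨i, hi, h⟩ := hx ((Finset.range k).sup J + 1)
      exact hJ i (h (J i) (Nat.lt_succ_of_le (Finset.le_sup (Finset.mem_range.2 hi))))
  have hmono : Monotone fun k : ℕ => {x | ∃ i < k, ∀ j, M i j ⬝ᵥ x < c i j} := by
    intro l l' hll x
    rintro ⟨i, hi, h⟩
    exact ⟨i, hi.trans_le hll, h⟩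
  have ht := tendsto_measure_iUnion_atTop (μ := gam E) hmono
  refine le_trans (measure_mono ?_) (le_of_tendsto' ht hl)
  rintro x ⟨i, h⟩
  exact Set.mem_iUnion.2 ⟨i + 1, i, Nat.lt_succ_self i, h⟩
end

lemma mpG {n p : ℕ} (hn : 0 < n) : MeasurePreserving
    (fun (A : Fin n → Fin p → ℝ) (q : Fin n × Fin p) => Real.sqrt n * A q.1 q.2)
    (gaussMatrix n p) (gam (Fin n × Fin p)) := by
  have hm : Measurable (fun (A : Fin n → Fin p → ℝ) (q : Fin n × Fin p) => Real.sqrt n * A q.1 q.2) := by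
    fun_prop
  refine ⟨hm, ?_⟩
  symm
  refine Measure.pi_eq fun s hs => ?_
  rw [Measure.map_apply hm (MeasurableSet.univ_pi hs)]
  have : (fun (A : Fin n → Fin p → ℝ) (q : Fin n × Fin p) => Real.sqrt n * A q.1 q.2) ⁻¹' (Set.univ.pi s)
      = Set.univ.pi fun i => Set.univ.pi fun j => (fun x : ℝ => Real.sqrt n * x) ⁻¹' s (i, j) := by
    ext A
    simp [Set.mem_pi]
  rw [this, gaussMatrix, Measure.pi_pi]
  simp_rw [Measure.pi_pi]
  rw [← Finset.univ_product_univ, Finset.prod_product]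
  refine Finset.prod_congr rfl fun i _ => Finset.prod_congr rfl fun j _ => ?_
  rw [← Measure.map_apply (by fun_prop) (hs _), gaussianReal_map_const_mul]
  congr 2
  · simp
  · ext
    have : (n:ℝ) ≠ 0 := by positivity
    simp [Real.sq_sqrt, this]

lemma mp_sum {E₁ E₂ : Type*} [Fintype E₁] [Fintype E₂] :
    MeasurePreserving (fun q : (E₁ → ℝ) × (E₂ → ℝ) => (Sum.elim q.1 q.2 : E₁ ⊕ E₂ → ℝ))
      ((gam E₁).prod (gam E₂)) (gam (E₁ ⊕ E₂)) := by
  have := measurePreserving_sumPiEquivProdPi_symm (fun _ : E₁ ⊕ E₂ => gaussianReal 0 1)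
  convert this using 1
  · ext q e
    cases e <;> rfl
  · rfl
  · rfl

lemma mp_gam_unit : MeasurePreserving (fun x : Unit → ℝ => x ()) (gam Unit) (gaussianReal 0 1) :=
  mp_eval ()

lemma gauss_neg_half : (1:ENNReal) ≤ 2 * gam Unit {x | x () ≤ 0} := by
  have h1 : gam Unit {x | x () ≤ 0} = gaussianReal 0 1 (Set.Iic 0) :=
    mp_gam_unit.measure_preimage measurableSet_Iic.nullMeasurableSet
  have h2 : gaussianReal 0 1 (Set.Ici 0) = gaussianReal 0 1 (Set.Iic 0) := by
    have := gaussianReal_map_neg (μ := 0) (v := 1)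
    rw [neg_zero] at this
    conv_lhs => rw [← this]
    rw [Measure.map_apply measurable_neg measurableSet_Ici]
    congr 1; ext x; simp
  have h3 : (1 : ENNReal) ≤ gaussianReal 0 1 (Set.Iic 0) + gaussianReal 0 1 (Set.Ici 0) := by
    rw [← measure_univ (μ := gaussianReal 0 1), ← Set.Iic_union_Ici (a := (0:ℝ))]
    exact measure_union_le _ _
  rw [h1, two_mul]; rwa [h2] at h3

lemma gordon_mat {n p : ℕ} (hn : 0 < n) (U : ℕ → ℕ → Fin n → ℝ) (V : ℕ → ℕ → Fin p → ℝ)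
    (hUV : ∀ i j l, U i j = U i l ∨ V i j = V i l) {e1 e2 : ℝ} (he1 : e1 ^ 2 = 1) (he2 : e2 ^ 2 = 1)
    (c : ℕ → ℕ → ℝ) :
    gaussMatrix n p {A | ∃ i, ∀ j, Real.sqrt n * ∑ a, ∑ b, U i j a * A a b * V i j b < c i j} ≤
      2 * ((gam (Fin n)).prod (gam (Fin p)))
        {q | ∃ i, ∀ j, e1 * nrm (V i j) * (q.1 ⬝ᵥ U i j) + e2 * nrm (U i j) * (q.2 ⬝ᵥ V i j) < c i j} := by
  let M : ℕ → ℕ → (Fin n × Fin p) ⊕ (Unit ⊕ (Fin n ⊕ Fin p)) → ℝ := fun i j =>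
    Sum.elim (fun q => U i j q.1 * V i j q.2) (Sum.elim (fun _ => nrm (U i j) * nrm (V i j)) 0)
  let N : ℕ → ℕ → (Fin n × Fin p) ⊕ (Unit ⊕ (Fin n ⊕ Fin p)) → ℝ := fun i j =>
    Sum.elim 0 (Sum.elim 0 (Sum.elim (fun a => e1 * nrm (V i j) * U i j a) (fun b => e2 * nrm (U i j) * V i j b)))
  have hM : ∀ i j k l, M i j ⬝ᵥ M k l = (U i j ⬝ᵥ U k l) * (V i j ⬝ᵥ V k l) +
      nrm (U i j) * nrm (V i j) * (nrm (U k l) * nrm (V k l)) := by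
    intro i j k l
    simp only [M, dotProduct, Fintype.sum_sum_type, Sum.elim_inl, Sum.elim_inr, Pi.zero_apply,
      Fintype.sum_prod_type, Finset.sum_mul_sum]
    simp only [mul_zero, Finset.sum_const_zero, add_zero, Finset.univ_unique, Finset.sum_singleton]
    congr 1
    exact Finset.sum_congr rfl fun a _ => Finset.sum_congr rfl fun b _ => by ring
  have hN : ∀ i j k l, N i j ⬝ᵥ N k l = nrm (V i j) * nrm (V k l) * (U i j ⬝ᵥ U k l) +
      nrm (U i j) * nrm (U k l) * (V i j ⬝ᵥ V k l) := by
    intro i j k l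
    simp only [N, dotProduct, Fintype.sum_sum_type, Sum.elim_inl, Sum.elim_inr, Pi.zero_apply, Finset.mul_sum]
    simp only [mul_zero, Finset.sum_const_zero, zero_add]
    congr 1
    · exact Finset.sum_congr rfl fun a _ => by linear_combination nrm (V i j) * nrm (V k l) * U i j a * U k l a * he1
    · exact Finset.sum_congr rfl fun a _ => by linear_combination nrm (U i j) * nrm (U k l) * V i j a * V k l a * he2
  have hMN : ∀ i j k l, M i j ⬝ᵥ N k l = 0 := by
    intro i j k l
    simp [M, N, dotProduct, Fintype.sum_sum_type]
  have G := gordon_nat M N hMN (by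
      intro i j l
      rw [hM, hN]
      rcases hUV i j l with h | h
      · rw [h, ← nrm_sq (U i l)]; ring
      · rw [h, ← nrm_sq (V i l)]; ring) (by
      intro i j k l
      rw [hM, hN]
      have h1 := dot_le (U i j) (U k l)
      have h2 := dot_le (V i j) (V k l)
      nlinarith [mul_nonneg (sub_nonneg.2 h1) (sub_nonneg.2 h2)]) c
  have meas : ∀ L : ℕ → ℕ → (Fin n × Fin p) ⊕ (Unit ⊕ (Fin n ⊕ Fin p)) → ℝ,
      MeasurableSet {x | ∃ i, ∀ j, L i j ⬝ᵥ x < c i j} := fun L => by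
    simp only [Set.ofPred_exists, Set.ofPred_forall]
    exact MeasurableSet.iUnion fun i => MeasurableSet.iInter fun j => meas_ev L c i j
  -- the product representation
  have mp1 := mp_sum (E₁ := Fin n × Fin p) (E₂ := Unit ⊕ (Fin n ⊕ Fin p))
  have mp2 := mp_sum (E₁ := Unit) (E₂ := Fin n ⊕ Fin p)
  have mp3 := mp_sum (E₁ := Fin n) (E₂ := Fin p)
  let SA : Set (Fin n × Fin p → ℝ) := {x | ∃ i, ∀ j, ∑ a, ∑ b, U i j a * x (a, b) * V i j b < c i j}
  have hSA : MeasurableSet SA := by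
    simp only [SA, Set.ofPred_exists, Set.ofPred_forall]
    exact MeasurableSet.iUnion fun i => MeasurableSet.iInter fun j =>
      measurableSet_lt (by fun_prop) measurable_const
  let T : Set (Unit ⊕ (Fin n ⊕ Fin p) → ℝ) := {x | x (Sum.inl ()) ≤ 0}
  have hT : MeasurableSet T := measurableSet_le (by fun_prop) measurable_const
  let SB : Set (Fin n ⊕ Fin p → ℝ) := {x | ∃ i, ∀ j, e1 * nrm (V i j) * ((fun a => x (Sum.inl a)) ⬝ᵥ U i j) +
      e2 * nrm (U i j) * ((fun a => x (Sum.inr a)) ⬝ᵥ V i j) < c i j}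
  have hSB : MeasurableSet SB := by
    simp only [SB, Set.ofPred_exists, Set.ofPred_forall, dotProduct]
    exact MeasurableSet.iUnion fun i => MeasurableSet.iInter fun j =>
      measurableSet_lt (by fun_prop) measurable_const
  have hTm : gam _ T = gam Unit {x | x () ≤ 0} := by
    rw [← mp2.measure_preimage hT.nullMeasurableSet]
    have : (fun q : (Unit → ℝ) × (Fin n ⊕ Fin p → ℝ) => (Sum.elim q.1 q.2 : Unit ⊕ (Fin n ⊕ Fin p) → ℝ)) ⁻¹' T
      = {x : Unit → ℝ | x () ≤ 0} ×ˢ Set.univ := by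
      ext q; simp [T]
    rw [this, Measure.prod_prod]; simp
  have h1 : gam _ SA * gam _ T ≤ gam _ {x | ∃ i, ∀ j, M i j ⬝ᵥ x < c i j} := by
    rw [← mp1.measure_preimage (meas M).nullMeasurableSet, ← Measure.prod_prod]
    refine measure_mono ?_
    rintro ⟨x, y⟩ ⟨⟨i, h⟩, h2⟩
    refine ⟨i, fun j => lt_of_le_of_lt ?_ (h j)⟩
    have hy : y (Sum.inl ()) ≤ 0 := h2
    simp only [M, dotProduct, Fintype.sum_sum_type, Sum.elim_inl, Sum.elim_inr, Pi.zero_apply,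
      Fintype.sum_prod_type, Finset.univ_unique, Finset.sum_singleton, zero_mul, Finset.sum_const_zero, add_zero]
    have : nrm (U i j) * nrm (V i j) * y (Sum.inl default) ≤ 0 :=
      mul_nonpos_of_nonneg_of_nonpos (mul_nonneg (nrm_nonneg _) (nrm_nonneg _)) hy
    refine le_trans (add_le_of_nonpos_right this) (le_of_eq ?_)
    exact Finset.sum_congr rfl fun a _ => Finset.sum_congr rfl fun b _ => by ring
  have h2 : gam _ {x | ∃ i, ∀ j, N i j ⬝ᵥ x < c i j} = gam _ SB := by
    rw [← mp1.measure_preimage (meas N).nullMeasurableSet]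
    have e : (fun q : (Fin n × Fin p → ℝ) × (Unit ⊕ (Fin n ⊕ Fin p) → ℝ) => (Sum.elim q.1 q.2 : _ → ℝ)) ⁻¹'
        {x | ∃ i, ∀ j, N i j ⬝ᵥ x < c i j} = Set.univ ×ˢ {y | (fun a => y (Sum.inr a)) ∈ SB} := by
      ext ⟨x, y⟩
      simp only [Set.mem_preimage, Set.mem_ofPred_eq, Set.mem_prod, Set.mem_univ, true_and, SB]
      refine exists_congr fun i => forall_congr' fun j => ?_
      have : N i j ⬝ᵥ (Sum.elim x y : _ → ℝ) = e1 * nrm (V i j) * ((fun a => y (Sum.inr (Sum.inl a))) ⬝ᵥ U i j) +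
          e2 * nrm (U i j) * ((fun a => y (Sum.inr (Sum.inr a))) ⬝ᵥ V i j) := by
        simp only [N, dotProduct, Fintype.sum_sum_type, Sum.elim_inl, Sum.elim_inr, Pi.zero_apply, Finset.mul_sum]
        simp only [zero_mul, Finset.sum_const_zero, zero_add]
        congr 1 <;> exact Finset.sum_congr rfl fun a _ => by ring
      rw [this]
    rw [e, Measure.prod_prod, measure_univ, one_mul]
    have hm : MeasurableSet {y : Unit ⊕ (Fin n ⊕ Fin p) → ℝ | (fun a => y (Sum.inr a)) ∈ SB} :=
      (show Measurable (fun (y : Unit ⊕ (Fin n ⊕ Fin p) → ℝ) a => y (Sum.inr a)) by fun_prop) hSB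
    rw [← mp2.measure_preimage hm.nullMeasurableSet]
    have : (fun q : (Unit → ℝ) × (Fin n ⊕ Fin p → ℝ) => (Sum.elim q.1 q.2 : Unit ⊕ (Fin n ⊕ Fin p) → ℝ)) ⁻¹'
      {y | (fun a => y (Sum.inr a)) ∈ SB} = Set.univ ×ˢ SB := by
      ext q; simp
    rw [this, Measure.prod_prod, measure_univ, one_mul]
  have h3 : gam _ SB = ((gam (Fin n)).prod (gam (Fin p)))
        {q | ∃ i, ∀ j, e1 * nrm (V i j) * (q.1 ⬝ᵥ U i j) + e2 * nrm (U i j) * (q.2 ⬝ᵥ V i j) < c i j} := by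
    rw [← mp3.measure_preimage hSB.nullMeasurableSet]
    rfl
  have h4 : gaussMatrix n p {A | ∃ i, ∀ j, Real.sqrt n * ∑ a, ∑ b, U i j a * A a b * V i j b < c i j}
      = gam _ SA := by
    rw [← (mpG hn).measure_preimage hSA.nullMeasurableSet]
    congr 1
    ext A
    simp only [Set.mem_preimage, Set.mem_ofPred_eq, SA]
    refine exists_congr fun i => forall_congr' fun j => ?_
    rw [Finset.mul_sum]
    simp_rw [Finset.mul_sum]
    have : ∀ a b, Real.sqrt n * (U i j a * A a b * V i j b) = U i j a * (Real.sqrt n * A a b) * V i j b :=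
      fun a b => by ring
    simp_rw [this]
  rw [h4, ← h3, ← h2]
  calc gam _ SA = gam _ SA * 1 := (mul_one _).symm
    _ ≤ gam _ SA * (2 * gam _ T) := by rw [hTm]; exact mul_le_mul_right gauss_neg_half _
    _ = 2 * (gam _ SA * gam _ T) := by ring
    _ ≤ _ := mul_le_mul_right (h1.trans G) _

set_option linter.unusedSectionVars false

/-- matrix times vector -/
noncomputable def mv {n p : ℕ} (A : Fin n → Fin p → ℝ) (v : Fin p → ℝ) : Fin n → ℝ :=
  fun a => ∑ b, A a b * v b

/-- primary objective -/
noncomputable def POb {n p : ℕ} (w : Fin n → ℝ) (Q : (Fin p → ℝ) → ℝ) (A : Fin n → Fin p → ℝ)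
    (v : Fin p → ℝ) : ℝ := (1 / 2) * nrm (mv A v - w) ^ 2 + Q v

/-- auxiliary slack -/
noncomputable def AOF {n p : ℕ} (w : Fin n → ℝ) (q : (Fin n → ℝ) × (Fin p → ℝ)) (v : Fin p → ℝ) : ℝ :=
  nrm ((nrm v / Real.sqrt n) • q.1 - w) - (q.2 ⬝ᵥ v) / Real.sqrt n

/-- auxiliary objective -/
noncomputable def AOb {n p : ℕ} (w : Fin n → ℝ) (Q : (Fin p → ℝ) → ℝ) (q : (Fin n → ℝ) × (Fin p → ℝ))
    (v : Fin p → ℝ) : ℝ := (1 / 2) * (max 0 (AOF w q v)) ^ 2 + Q v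

section
variable {n p : ℕ}

lemma mv_bilin (A : Fin n → Fin p → ℝ) (u : Fin n → ℝ) (v : Fin p → ℝ) :
    ∑ a, ∑ b, u a * A a b * v b = u ⬝ᵥ mv A v := by
  simp only [dotProduct, mv, Finset.mul_sum]
  exact Finset.sum_congr rfl fun a _ => Finset.sum_congr rfl fun b _ => by ring

lemma mv_add (A : Fin n → Fin p → ℝ) (v v' : Fin p → ℝ) : mv A (v + v') = mv A v + mv A v' := by
  ext a; simp [mv, mul_add, Finset.sum_add_distrib]

lemma mv_smul (A : Fin n → Fin p → ℝ) (t : ℝ) (v : Fin p → ℝ) : mv A (t • v) = t • mv A v := by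
  ext a; simp only [mv, Pi.smul_apply, smul_eq_mul, Finset.mul_sum]
  exact Finset.sum_congr rfl fun b _ => by ring

lemma continuous_mv (A : Fin n → Fin p → ℝ) : Continuous (mv A) := by
  unfold mv; fun_prop

lemma continuous_dot {ι : Type*} [Fintype ι] (u : ι → ℝ) : Continuous fun v : ι → ℝ => u ⬝ᵥ v := by
  unfold dotProduct; fun_prop

lemma continuous_POb (w : Fin n → ℝ) {Q : (Fin p → ℝ) → ℝ} (hQ : Continuous Q) (A : Fin n → Fin p → ℝ) :
    Continuous (POb w Q A) := by
  unfold POb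
  exact (continuous_const.mul ((continuous_nrm.comp ((continuous_mv A).sub continuous_const)).pow 2)).add hQ

lemma continuous_AOF (w : Fin n → ℝ) (q : (Fin n → ℝ) × (Fin p → ℝ)) : Continuous (AOF w q) := by
  unfold AOF
  exact (continuous_nrm.comp (((continuous_nrm.div_const _).smul continuous_const).sub continuous_const)).sub
    ((continuous_dot _).div_const _)

lemma continuous_AOb (w : Fin n → ℝ) {Q : (Fin p → ℝ) → ℝ} (hQ : Continuous Q)
    (q : (Fin n → ℝ) × (Fin p → ℝ)) : Continuous (AOb w Q q) := by
  unfold AOb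
  exact (continuous_const.mul ((continuous_const.max (continuous_AOF w q)).pow 2)).add hQ

lemma exists_dir (hn : 0 < n) (z : Fin n → ℝ) {t : ℝ} (ht : 0 ≤ t) :
    ∃ u : Fin n → ℝ, nrm u = t ∧ u ⬝ᵥ z = t * nrm z := by
  by_cases hz : nrm z = 0
  · refine ⟨Pi.single ⟨0, hn⟩ t, ?_, ?_⟩
    · rw [nrm_eq_sqrt]; simp [Real.sqrt_mul_self ht]
    · rw [nrm_eq_zero hz]; simp [nrm_zero]
  · refine ⟨(t / nrm z) • z, ?_, ?_⟩
    · rw [nrm_smul, abs_of_nonneg (div_nonneg ht (nrm_nonneg _))]; field_simp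
    · rw [smul_dotProduct, ← nrm_sq, smul_eq_mul]; field_simp

lemma AOb_le_of_all (hn : 0 < n) (w : Fin n → ℝ) {Q : (Fin p → ℝ) → ℝ} {c : ℝ} {q : (Fin n → ℝ) × (Fin p → ℝ)}
    {x : Fin p → ℝ} (hall : ∀ y : Fin n → ℝ, nrm x * (q.1 ⬝ᵥ y) - nrm y * (q.2 ⬝ᵥ x)
        ≤ Real.sqrt n * (c + (1/2) * nrm y ^ 2 + y ⬝ᵥ w - Q x)) : AOb w Q q x ≤ c := by
  have hs : 0 < Real.sqrt n := Real.sqrt_pos.2 (by exact_mod_cast hn)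
  set z := (nrm x / Real.sqrt n) • q.1 - w with hz
  set F := AOF w q x with hF
  have hFz : F = nrm z - (q.2 ⬝ᵥ x) / Real.sqrt n := rfl
  obtain ⟨y, hy1, hy2⟩ := exists_dir hn z (le_max_left 0 F)
  have h1 := hall y
  rw [hz, dotProduct_sub, dotProduct_smul, smul_eq_mul, dotProduct_comm y q.1] at hy2
  have h2 : (nrm x * (q.1 ⬝ᵥ y) - nrm y * (q.2 ⬝ᵥ x)) / Real.sqrt n ≤
      c + (1/2) * nrm y ^ 2 + y ⬝ᵥ w - Q x := by
    rw [div_le_iff₀ hs]; linarith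
  have h3 : (nrm x * (q.1 ⬝ᵥ y) - nrm y * (q.2 ⬝ᵥ x)) / Real.sqrt n =
    nrm x / Real.sqrt n * (q.1 ⬝ᵥ y) - nrm y * ((q.2 ⬝ᵥ x) / Real.sqrt n) := by ring
  rw [h3, hy1] at h2
  have h4 : max 0 F * F = max 0 F ^ 2 := by
    rcases le_total 0 F with h | h
    · rw [max_eq_right h]; ring
    · rw [max_eq_left h]; ring
  unfold AOb
  rw [← hF]
  have h5 : max 0 F * nrm z - max 0 F * ((q.2 ⬝ᵥ x) / Real.sqrt n) = max 0 F ^ 2 := by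
    rw [← h4, hFz]; ring
  nlinarith

lemma le_AOb_of_one (hn : 0 < n) (w : Fin n → ℝ) {Q : (Fin p → ℝ) → ℝ} {c : ℝ} {q : (Fin n → ℝ) × (Fin p → ℝ)}
    {x : Fin p → ℝ} {y : Fin n → ℝ} (h1 : 1 * nrm x * (q.1 ⬝ᵥ -y) + 1 * nrm (-y) * (q.2 ⬝ᵥ x) <
        Real.sqrt n * (- c - (1/2) * nrm y ^ 2 - y ⬝ᵥ w + Q x)) : c ≤ AOb w Q q x := by
  have hs : 0 < Real.sqrt n := Real.sqrt_pos.2 (by exact_mod_cast hn)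
  simp only [nrm_neg, dotProduct_neg] at h1
  set z := (nrm x / Real.sqrt n) • q.1 - w with hz
  set F := AOF w q x with hF
  have hFz : F = nrm z - (q.2 ⬝ᵥ x) / Real.sqrt n := rfl
  have h2 := dot_le y z
  rw [hz, dotProduct_sub, dotProduct_smul, smul_eq_mul, dotProduct_comm y q.1, ← hz] at h2
  have h3 : (-(nrm x * (q.1 ⬝ᵥ y)) + nrm y * (q.2 ⬝ᵥ x)) / Real.sqrt n <
      - c - (1/2) * nrm y ^ 2 - y ⬝ᵥ w + Q x := by
    rw [div_lt_iff₀ hs]; linarith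
  have h4 : (-(nrm x * (q.1 ⬝ᵥ y)) + nrm y * (q.2 ⬝ᵥ x)) / Real.sqrt n =
    -(nrm x / Real.sqrt n * (q.1 ⬝ᵥ y)) + nrm y * ((q.2 ⬝ᵥ x) / Real.sqrt n) := by ring
  rw [h4] at h3
  simp only [AOb]
  rw [← hF]
  have h5 : nrm y * F ≤ nrm y * max 0 F := mul_le_mul_of_nonneg_left (le_max_right _ _) (nrm_nonneg _)
  rw [hFz] at h5
  rw [← hFz] at h5
  have h6 : nrm y * F = nrm y * nrm z - nrm y * ((q.2 ⬝ᵥ x) / Real.sqrt n) := by rw [hFz]; ring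
  nlinarith [sq_nonneg (nrm y - max 0 F)]

lemma G1 (hn : 0 < n) (w : Fin n → ℝ) {Q : (Fin p → ℝ) → ℝ} (hQ : Continuous Q) (S : Set (Fin p → ℝ)) (c : ℝ) :
    gaussMatrix n p {A | ∃ v ∈ S, POb w Q A v < c} ≤
      2 * ((gam (Fin n)).prod (gam (Fin p))) {q | ∃ v ∈ S, AOb w Q q v ≤ c} := by
  rcases S.eq_empty_or_nonempty with rfl | hne
  · simp
  have : Nonempty S := hne.to_subtype
  have hs : 0 < Real.sqrt n := Real.sqrt_pos.2 (by exact_mod_cast hn)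
  let v : ℕ → S := TopologicalSpace.denseSeq S
  let u : ℕ → Fin n → ℝ := TopologicalSpace.denseSeq _
  have hv : DenseRange v := TopologicalSpace.denseRange_denseSeq S
  have hu : DenseRange u := TopologicalSpace.denseRange_denseSeq _
  have G := gordon_mat hn (fun _ j => u j) (fun i _ => (v i : Fin p → ℝ)) (fun i j l => Or.inr rfl)
    (e1 := 1) (e2 := -1) (by norm_num) (by norm_num)
    (fun i j => Real.sqrt n * (c + (1/2) * nrm (u j) ^ 2 + u j ⬝ᵥ w - Q (v i) + (1/2) * 0))
  refine le_trans (measure_mono ?_) (G.trans (mul_le_mul_right (measure_mono ?_) _))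
  · rintro A ⟨x, hx, hlt⟩
    have : ∃ i, POb w Q A (v i) < c := by
      have ho : IsOpen {y : S | POb w Q A y < c} :=
        isOpen_lt ((continuous_POb w hQ A).comp continuous_subtype_val) continuous_const
      obtain ⟨i, hi⟩ := hv.exists_mem_open ho ⟨⟨x, hx⟩, hlt⟩
      exact ⟨i, hi⟩
    obtain ⟨i, hi⟩ := this
    refine ⟨i, fun j => mul_lt_mul_of_pos_left ?_ hs⟩
    rw [mv_bilin]
    unfold POb at hi
    have h1 := dot_le (u j) (mv A (v i) - w)
    rw [dotProduct_sub] at h1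
    nlinarith [sq_nonneg (nrm (u j) - nrm (mv A (v i) - w))]
  · rintro q ⟨i, hi⟩
    refine ⟨v i, (v i).2, ?_⟩
    -- all u
    have hall : ∀ y : Fin n → ℝ, nrm (v i : Fin p → ℝ) * (q.1 ⬝ᵥ y) - nrm y * (q.2 ⬝ᵥ (v i : Fin p → ℝ))
        ≤ Real.sqrt n * (c + (1/2) * nrm y ^ 2 + y ⬝ᵥ w - Q (v i)) := by
      have hcl : IsClosed {y : Fin n → ℝ | nrm (v i : Fin p → ℝ) * (q.1 ⬝ᵥ y) - nrm y * (q.2 ⬝ᵥ (v i : Fin p → ℝ))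
        ≤ Real.sqrt n * (c + (1/2) * nrm y ^ 2 + y ⬝ᵥ w - Q (v i))} := by
        refine isClosed_le ((continuous_const.mul (continuous_dot _)).sub
          (continuous_nrm.mul continuous_const)) (continuous_const.mul (((continuous_const.add
            (continuous_const.mul (continuous_nrm.pow 2))).add ?_).sub continuous_const))
        simp_rw [dotProduct_comm _ w]; exact continuous_dot w
      intro y
      refine hcl.closure_subset_iff.2 ?_ (hu y)
      rintro _ ⟨j, rfl⟩
      have := (hi j).le
      simp only [Set.mem_ofPred_eq]
      linarith
    exact AOb_le_of_all hn w hall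

lemma G2 (hn : 0 < n) (w : Fin n → ℝ) {Q : (Fin p → ℝ) → ℝ} (hQ : Continuous Q)
    (hconv : ∀ x y : Fin p → ℝ, ∀ t : ℝ, 0 ≤ t → t ≤ 1 → Q (x + t • (y - x)) ≤ Q x + t * (Q y - Q x))
    {K : ℝ} (hK : 0 ≤ K) (c : ℝ) :
    gaussMatrix n p {A | ∀ v, nrm v ≤ K → c < POb w Q A v} ≤
      2 * ((gam (Fin n)).prod (gam (Fin p))) {q | ∀ v, nrm v ≤ K → c ≤ AOb w Q q v} := by
  let S : Set (Fin p → ℝ) := {v | nrm v ≤ K}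
  have hSc : IsCompact S := isCompact_nrm_ball K
  have hne : S.Nonempty := ⟨0, by simpa [S, nrm_zero] using hK⟩
  have : Nonempty S := hne.to_subtype
  have hs : 0 < Real.sqrt n := Real.sqrt_pos.2 (by exact_mod_cast hn)
  let v : ℕ → S := TopologicalSpace.denseSeq S
  let u : ℕ → Fin n → ℝ := TopologicalSpace.denseSeq _
  have hv : DenseRange v := TopologicalSpace.denseRange_denseSeq S
  have hu : DenseRange u := TopologicalSpace.denseRange_denseSeq _
  have G := gordon_mat hn (fun i _ => - u i) (fun _ j => (v j : Fin p → ℝ)) (fun i j l => Or.inl rfl)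
    (e1 := 1) (e2 := 1) (by norm_num) (by norm_num)
    (fun i j => Real.sqrt n * (- c - (1/2) * nrm (u i) ^ 2 - u i ⬝ᵥ w + Q (v j)))
  refine le_trans (measure_mono ?_) (G.trans (mul_le_mul_right (measure_mono ?_) _))
  · intro A hA
    obtain ⟨x, hx, hmin⟩ := hSc.exists_isMinOn hne (continuous_POb w hQ A).continuousOn
    have hcx : c < POb w Q A x := hA x hx
    set r := mv A x - w with hr
    have hsad : ∀ y ∈ S, POb w Q A x ≤ r ⬝ᵥ (mv A y - w) - (1/2) * nrm r ^ 2 + Q y := by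
      intro y hy
      have key : Q x - Q y ≤ r ⬝ᵥ (mv A y - mv A x) := by
        refine le_of_quad (c := (1/2) * nrm (mv A y - mv A x) ^ 2) 1 one_pos fun t ht ht1 => ?_
        have hz : x + t • (y - x) ∈ S := by
          have e : x + t • (y - x) = (1 - t) • x + t • y := by ext i; simp; ring
          rw [e]
          refine (nrm_add_le _ _).trans ?_
          rw [nrm_smul, nrm_smul, abs_of_nonneg ht.le, abs_of_nonneg (by linarith)]
          have h1 : nrm x ≤ K := hx
          have h2 : nrm y ≤ K := hy
          nlinarith
        have h1 : POb w Q A x ≤ POb w Q A (x + t • (y - x)) := hmin hz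
        have h2 := hconv x y t ht.le ht1
        unfold POb at h1
        have e : mv A (x + t • (y - x)) - w = r + t • (mv A y - mv A x) := by
          have : mv A (y - x) = mv A y - mv A x := by
            rw [sub_eq_add_neg, mv_add, ← neg_one_smul ℝ x, mv_smul]; simp [sub_eq_add_neg]
          rw [mv_add, mv_smul, this, hr]; abel
        rw [e, ← hr, nrm_sq (r + _)] at h1
        simp only [add_dotProduct, dotProduct_add, smul_dotProduct, dotProduct_smul, smul_eq_mul,
          dotProduct_comm (mv A y - mv A x) r] at h1
        rw [← nrm_sq, ← nrm_sq] at h1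
        nlinarith
      have e : mv A y - w = r + (mv A y - mv A x) := by rw [hr]; abel
      rw [e, dotProduct_add, ← nrm_sq]
      unfold POb
      rw [← hr]
      linarith
    -- perturbation
    obtain ⟨B, hB⟩ := (hSc.image ((continuous_nrm.comp ((continuous_mv A).sub
      (continuous_const (y := w)))))).bddAbove
    have hB' : ∀ y ∈ S, nrm (mv A y - w) ≤ B := fun y hy => hB ⟨y, hy, rfl⟩
    have hB0 : 0 ≤ B := (nrm_nonneg _).trans (hB' x hx)
    have hopen : IsOpen {z : Fin n → ℝ | nrm (z - r) * B + (1/2) * nrm z ^ 2 < POb w Q A x - c + (1/2) * nrm r ^ 2} :=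
      isOpen_lt (((continuous_nrm.comp (continuous_id.sub continuous_const)).mul continuous_const).add
        (continuous_const.mul (continuous_nrm.pow 2))) continuous_const
    obtain ⟨i, hi⟩ := hu.exists_mem_open hopen ⟨r, by simp [nrm_zero]; linarith⟩
    have hi : nrm (u i - r) * B + (1/2) * nrm (u i) ^ 2 < POb w Q A x - c + (1/2) * nrm r ^ 2 := hi
    refine ⟨i, fun j => mul_lt_mul_of_pos_left ?_ hs⟩
    rw [mv_bilin]
    have h1 := hsad _ (v j).2
    have h2 := (abs_le.1 (dot_abs_le (u i - r) (mv A (v j) - w))).1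
    have h3 := mul_le_mul_of_nonneg_left (hB' _ (v j).2) (nrm_nonneg (u i - r))
    have e : u i ⬝ᵥ mv A (v j) = (u i - r) ⬝ᵥ (mv A (v j) - w) + r ⬝ᵥ (mv A (v j) - w) + u i ⬝ᵥ w := by
      simp only [sub_dotProduct, dotProduct_sub]; ring
    rw [neg_dotProduct, e]
    linarith
  · rintro q ⟨i, hi⟩ y hy
    have hcl : IsClosed {y : S | c ≤ AOb w Q q y} :=
      isClosed_le continuous_const ((continuous_AOb w hQ q).comp continuous_subtype_val)
    suffices hsub : Set.range v ⊆ {y : S | c ≤ AOb w Q q y} by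
      have h9 := hcl.closure_subset_iff.2 hsub
      have h10 := hv ⟨y, hy⟩
      have h11 := h9 h10
      exact h11
    intro yy hyy
    obtain ⟨j, hj⟩ := hyy
    subst hj
    have h1 : 1 * nrm (v j : Fin p → ℝ) * (q.1 ⬝ᵥ -u i) + 1 * nrm (-u i) * (q.2 ⬝ᵥ (v j : Fin p → ℝ)) <
        Real.sqrt n * (- c - (1/2) * nrm (u i) ^ 2 - u i ⬝ᵥ w + Q (v j)) := by
      have := hi j
      linarith
    exact le_AOb_of_one hn w h1
end

set_option linter.unusedSectionVars false

/-- uniform law on the unit interval -/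
noncomputable def nuU : Measure ℝ := volume.restrict (Set.Ioo 0 1)

instance nuU_prob : IsProbabilityMeasure nuU := ⟨by simp [nuU]⟩

/-- step function of a vector -/
noncomputable def St {p : ℕ} (x : Fin p → ℝ) (s : ℝ) : ℝ :=
  if h : ⌊s * p⌋₊ < p then x ⟨⌊s * p⌋₊, h⟩ else 0

section
variable {p : ℕ}

lemma nuU_int (G : ℝ → ℝ) : ∫ s, G s ∂nuU = ∫ s in (0:ℝ)..1, G s := by
  rw [intervalIntegral.integral_of_le zero_le_one, integral_Ioc_eq_integral_Ioo, nuU]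

lemma nuU_integrable (G : ℝ → ℝ) : Integrable G nuU ↔ IntervalIntegrable G volume 0 1 := by
  rw [intervalIntegrable_iff_integrableOn_Ioo_of_le zero_le_one]; rfl

lemma ae_nuU {P : ℝ → Prop} (h : ∀ s, 0 < s → s < 1 → P s) : ∀ᵐ s ∂nuU, P s := by
  unfold nuU
  rw [ae_restrict_iff' measurableSet_Ioo]
  exact ae_of_all _ fun s hs => h s hs.1 hs.2

lemma avg_int (hp : 0 < p) {G : ℝ → ℝ} (hG : Integrable G nuU) :
    ∫ s, G s ∂nuU = (∑ i : Fin p, ∫ s, G ((i + s) / p) ∂nuU) / p := by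
  have hp' : (0:ℝ) < p := by exact_mod_cast hp
  rw [nuU_int]
  rw [nuU_integrable] at hG
  have h := intervalIntegral.sum_integral_adjacent_intervals (f := G) (μ := volume)
    (a := fun k => (k : ℝ) / p) (n := p) (by
      intro k hk
      refine hG.mono_set ?_
      rw [Set.uIcc_of_le zero_le_one, Set.uIcc_of_le (by gcongr; simp)]
      apply Set.Icc_subset_Icc
      · positivity
      · rw [div_le_one hp']; exact_mod_cast hk)
  simp only [Nat.cast_zero, zero_div, div_self hp'.ne'] at h
  rw [← h, Finset.sum_range, Finset.sum_div]
  refine Finset.sum_congr rfl fun i _ => ?_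
  rw [nuU_int, eq_div_iff hp'.ne']
  have := intervalIntegral.integral_comp_div_add (a := 0) (b := 1) G hp'.ne' ((i:ℝ)/p)
  have e : ∀ s : ℝ, s / p + (i:ℝ)/p = ((i:ℝ) + s) / p := fun s => by ring
  simp only [e] at this
  rw [this, smul_eq_mul, mul_comm]
  congr 2
  · ring
  · push_cast; ring

lemma St_block (hp : 0 < p) (x : Fin p → ℝ) (i : Fin p) {s : ℝ} (hs : 0 < s) (hs1 : s < 1) :
    St x ((i + s) / p) = x i := by
  have hp' : (0:ℝ) < p := by exact_mod_cast hp
  have e : ⌊((i:ℝ) + s) / p * p⌋₊ = i := by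
    rw [div_mul_cancel₀ _ hp'.ne', Nat.floor_eq_iff (by positivity)]
    constructor <;> linarith
  unfold St
  simp [e]

lemma St_eq (hp : 0 < p) (_x : Fin p → ℝ) {s : ℝ} (hs : 0 < s) (hs1 : s < 1) :
    ∃ i : Fin p, ∀ x : Fin p → ℝ, St x s = x i := by
  have hp' : (0:ℝ) < p := by exact_mod_cast hp
  have h : ⌊s * p⌋₊ < p := by
    rw [Nat.floor_lt (by positivity)]; nlinarith
  exact ⟨⟨_, h⟩, fun x => by simp [St, h]⟩

lemma measurable_St (x : Fin p → ℝ) : Measurable (St x) := by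
  have : St x = (fun k : ℕ => if h : k < p then x ⟨k, h⟩ else 0) ∘ (fun s : ℝ => ⌊s * p⌋₊) := rfl
  rw [this]
  exact (measurable_of_countable _).comp (Nat.measurable_floor.comp (measurable_id.mul_const _))

lemma St_bound (x : Fin p → ℝ) (s : ℝ) : |St x s| ≤ ∑ i, |x i| := by
  unfold St
  split_ifs with h
  · exact Finset.single_le_sum (f := fun i => |x i|) (fun i _ => abs_nonneg _) (Finset.mem_univ _)
  · simp; exact Finset.sum_nonneg fun i _ => abs_nonneg _

lemma St_memLp (x : Fin p → ℝ) (q : ENNReal) : MemLp (St x) q nuU :=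
  MemLp.of_bound (measurable_St x).aestronglyMeasurable _ (ae_of_all _ (St_bound x))

lemma St_integrable (x : Fin p → ℝ) : Integrable (St x) nuU := (St_memLp x 1).integrable le_rfl

lemma St_mul_integrable {p' : ℕ} (x : Fin p → ℝ) (y : Fin p' → ℝ) :
    Integrable (fun s => St x s * St y s) nuU :=
  (St_memLp x 2).integrable_mul (St_memLp y 2)

lemma St_mul_int (hp : 0 < p) {p' : ℕ} (x : Fin p → ℝ) (y : Fin p' → ℝ) :
    ∫ s, St x s * St y s ∂nuU = (∑ i : Fin p, x i * ∫ s, St y ((i + s) / p) ∂nuU) / p := by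
  rw [avg_int hp (St_mul_integrable x y)]
  congr 1
  refine Finset.sum_congr rfl fun i _ => ?_
  rw [← integral_const_mul]
  refine integral_congr_ae (ae_nuU fun s h0 h1 => ?_)
  simp only [St_block hp x i h0 h1]

lemma St_int (hp : 0 < p) (x : Fin p → ℝ) (φ : ℝ → ℝ) :
    ∫ s, φ (St x s) ∂nuU = (∑ i, φ (x i)) / p := by
  have e : ∫ s, φ (St x s) ∂nuU = ∫ s, St (fun i => φ (x i)) s ∂nuU := by
    refine integral_congr_ae (ae_nuU fun s h0 h1 => ?_)
    obtain ⟨i, hi⟩ := St_eq hp x h0 h1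
    simp [hi]
  rw [e, avg_int hp (St_integrable _)]
  congr 1
  refine Finset.sum_congr rfl fun i _ => ?_
  rw [integral_congr_ae (g := fun _ => φ (x i)) (ae_nuU fun s h0 h1 => by
    simp only [St_block hp _ i h0 h1])]
  simp

lemma St_int2 (hp : 0 < p) (x y : Fin p → ℝ) (φ : ℝ → ℝ → ℝ) :
    ∫ s, φ (St x s) (St y s) ∂nuU = (∑ i, φ (x i) (y i)) / p := by
  have h := St_int hp (fun i => φ (x i) (y i)) id
  simp only [id] at h
  rw [← h]
  refine integral_congr_ae (ae_nuU fun s h0 h1 => ?_)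
  obtain ⟨i, hi⟩ := St_eq hp x h0 h1
  simp [hi]

lemma St_mono {x : Fin p → ℝ} (hx : Monotone x) {s t : ℝ} (hs : 0 < s) (hst : s ≤ t) (ht : t < 1)
    (hp : 0 < p) : St x s ≤ St x t := by
  have hp' : (0:ℝ) < p := by exact_mod_cast hp
  have h : ⌊t * p⌋₊ < p := by
    rw [Nat.floor_lt (by nlinarith)]; nlinarith
  have h2 : ⌊s * p⌋₊ ≤ ⌊t * p⌋₊ := Nat.floor_le_floor (by gcongr)
  simp only [St, h, h2.trans_lt h, dif_pos]
  exact hx (by simpa using h2)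

lemma St_nonneg {x : Fin p → ℝ} (hx : ∀ i, 0 ≤ x i) (s : ℝ) : 0 ≤ St x s := by
  unfold St; split_ifs <;> simp [hx]

/-- variational inequality across dimensions -/
lemma St_vi (hp : 0 < p) {p' : ℕ} (hp' : 0 < p') {lam y : Fin p → ℝ} (h0 : ∀ i, 0 ≤ lam i)
    (hl : Monotone lam) (hy : Monotone y) (hy0 : ∀ i, 0 ≤ y i) {z : Fin p' → ℝ} (hz : Monotone z)
    (hz0 : ∀ i, 0 ≤ z i) :
    ∫ s, (St y s - St lam s - St (slopeProx lam y) s) * (St z s - St (slopeProx lam y) s) ∂nuU ≤ 0 := by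
  have hpp : (0:ℝ) < p := by exact_mod_cast hp
  set X := slopeProx lam y with hX
  let a : Fin p → ℝ := fun i => ∫ s, St z ((i + s) / p) ∂nuU
  have hr : ∀ (i : Fin p) (s : ℝ), 0 < s → s < 1 → 0 < ((i:ℝ) + s) / p ∧ ((i:ℝ) + s) / p < 1 := by
    intro i s h h1
    refine ⟨by positivity, ?_⟩
    rw [div_lt_one hpp]
    have : ((i:ℕ):ℝ) + 1 ≤ p := by exact_mod_cast i.2
    linarith
  have hintg : ∀ i : Fin p, Integrable (fun s => St z (((i:ℕ) + s) / p)) nuU := fun i =>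
    (MemLp.of_bound (p := 1) ((measurable_St z).comp (by fun_prop)).aestronglyMeasurable _
      (ae_of_all _ fun s => St_bound z _)).integrable le_rfl
  have ha0 : ∀ i, 0 ≤ a i := fun i => integral_nonneg fun s => St_nonneg hz0 _
  have ha : Monotone a := by
    intro i j hij
    refine integral_mono_ae (hintg i) (hintg j) (ae_nuU fun s h h1 => ?_)
    refine St_mono hz (hr i s h h1).1 ?_ (hr j s h h1).2 hp'
    have : ((i:ℕ):ℝ) ≤ (j:ℕ) := by exact_mod_cast hij
    gcongr
  have hXm : Monotone X := fun i j hij => sub_nonneg.1 (slopeProx_mono h0 hl (hy hij)).1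
  have hX0 : ∀ i, 0 ≤ X i := fun i => (slopeProx_pos h0 hl hy0 i).1
  have h := slopeProx_vi h0 hl y a
  rw [sortedL1_of_mono hl ha0 ha, sortedL1_of_mono hl hX0 hXm, ← hX] at h
  have e1 : ∫ s, (St y s - St lam s - St X s) * (St z s - St X s) ∂nuU =
      ∫ s, (St (y - lam - X) s * St z s - St (y - lam - X) s * St X s) ∂nuU := by
    refine integral_congr_ae (ae_nuU fun s h0 h1 => ?_)
    obtain ⟨i, hi⟩ := St_eq hp y h0 h1
    simp only [hi, Pi.sub_apply]; ring
  rw [e1, integral_sub (St_mul_integrable _ _) (St_mul_integrable _ _), St_mul_int hp,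
    St_int2 hp _ _ (fun a b => a * b), ← sub_div]
  apply div_nonpos_of_nonpos_of_nonneg _ hpp.le
  rw [← Finset.sum_sub_distrib]
  have : (y - X) ⬝ᵥ (a - X) - (∑ i, lam i * a i - ∑ i, lam i * X i) =
    ∑ x : Fin p, ((y - lam - X) x * a x - (y - lam - X) x * X x) := by
    simp only [dotProduct, ← Finset.sum_sub_distrib, Pi.sub_apply]
    exact Finset.sum_congr rfl fun i _ => by ring
  simp only [a] at this h ⊢
  linarith
end

set_option linter.unusedSectionVars false

/-- ramp function: one below `a`, zero above `b` -/
noncomputable def ramp (a b : ℝ) : BoundedContinuousFunction ℝ ℝ :=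
  BoundedContinuousFunction.ofNormedAddCommGroup (fun t => max 0 (min 1 ((b - t) / (b - a))))
    (by fun_prop) 1 (fun t => by
      rw [Real.norm_eq_abs, abs_of_nonneg (le_max_left _ _)]
      exact max_le zero_le_one (min_le_left _ _))

lemma ramp_apply (a b t : ℝ) : ramp a b t = max 0 (min 1 ((b - t) / (b - a))) := rfl
lemma ramp_nonneg (a b t : ℝ) : 0 ≤ ramp a b t := le_max_left _ _
lemma ramp_le (a b t : ℝ) : ramp a b t ≤ 1 := max_le zero_le_one (min_le_left _ _)
lemma ramp_one {a b t : ℝ} (hab : a < b) (h : t ≤ a) : ramp a b t = 1 := by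
  rw [ramp_apply, min_eq_left, max_eq_right zero_le_one]
  rw [one_le_div (by linarith)]; linarith
lemma ramp_zero {a b t : ℝ} (hab : a < b) (h : b ≤ t) : ramp a b t = 0 := by
  rw [ramp_apply, max_eq_left]
  exact (min_le_right _ _).trans (div_nonpos_of_nonpos_of_nonneg (by linarith) (by linarith))

lemma ramp_int_le (μ : Measure ℝ) [IsProbabilityMeasure μ] {a b : ℝ} (hab : a < b) :
    ∫ t, ramp a b t ∂μ ≤ cdf μ b := by
  rw [cdf_eq_real, ← integral_indicator_one measurableSet_Iic]
  refine integral_mono ((ramp a b).integrable μ) ((integrable_const 1).indicator measurableSet_Iic) fun t => ?_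
  by_cases h : t ≤ b
  · simp only [Set.indicator, Set.mem_Iic, h, if_true, Pi.one_apply]; exact ramp_le _ _ _
  · simp only [Set.indicator, Set.mem_Iic, h, if_false]; exact (ramp_zero hab (not_le.1 h).le).le

lemma le_ramp_int (μ : Measure ℝ) [IsProbabilityMeasure μ] {a b : ℝ} (hab : a < b) :
    cdf μ a ≤ ∫ t, ramp a b t ∂μ := by
  rw [cdf_eq_real, ← integral_indicator_one measurableSet_Iic]
  refine integral_mono ((integrable_const 1).indicator measurableSet_Iic) ((ramp a b).integrable μ) fun t => ?_
  by_cases h : t ≤ a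
  · simp only [Set.indicator, Set.mem_Iic, h, if_true, Pi.one_apply]; exact (ramp_one hab h).ge
  · simp only [Set.indicator, Set.mem_Iic, h, if_false]; exact ramp_nonneg _ _ _

lemma quant_tendsto (μ : Measure ℝ) [IsProbabilityMeasure μ] :
    ∃ Q : ℝ → ℝ, ∀ x : (p : ℕ) → Fin p → ℝ, (∀ p, Monotone (x p)) → EmpConverges x μ →
      ∀ᵐ s ∂nuU, Tendsto (fun p => St (x p) s) atTop (𝓝 (Q s)) := by
  let Q : ℝ → ℝ := fun s => sSup {t | cdf μ t < s}
  have hne : ∀ s, 0 < s → {t | cdf μ t < s}.Nonempty := by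
    intro s hs
    exact ((tendsto_cdf_atBot μ).eventually (gt_mem_nhds hs)).exists
  have hbd : ∀ s, s < 1 → BddAbove {t | cdf μ t < s} := by
    intro s hs
    obtain ⟨T, hT⟩ := ((tendsto_cdf_atTop μ).eventually (lt_mem_nhds hs)).exists
    refine ⟨T, fun t ht => ?_⟩
    by_contra h
    have := monotone_cdf μ (not_le.1 h).le
    have ht : cdf μ t < s := ht
    linarith
  have hQm : MonotoneOn Q (Set.Ioo 0 1) := by
    intro s hs t ht hst
    exact csSup_le_csSup (hbd t ht.2) (hne s hs.1) fun r hr => lt_of_lt_of_le hr hst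
  have hc := hQm.countable_not_continuousWithinAt
  refine ⟨Q, fun x hx hconv => ?_⟩
  have hae : ∀ᵐ s ∂nuU, s ∉ {x ∈ Set.Ioo (0:ℝ) 1 | ¬ContinuousWithinAt Q (Set.Ioo 0 1) x} := by
    unfold nuU
    exact ae_restrict_of_ae (hc.ae_notMem volume)
  filter_upwards [hae, ae_nuU (P := fun s => 0 < s ∧ s < 1) fun s h h1 => ⟨h, h1⟩] with s hs ⟨hs0, hs1⟩
  have hcont : ContinuousAt Q s := by
    by_contra h
    refine hs ⟨⟨hs0, hs1⟩, fun h' => h (h'.continuousAt (Ioo_mem_nhds hs0 hs1))⟩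
  have hfl : ∀ p : ℕ, 0 < p → ⌊s * p⌋₊ < p := by
    intro p hp
    have hp' : (0:ℝ) < p := by exact_mod_cast hp
    rw [Nat.floor_lt (by positivity)]; nlinarith
  refine tendsto_order.2 ⟨fun a ha => ?_, fun b hb => ?_⟩
  · obtain ⟨b, hab, hbQ⟩ := exists_between ha
    obtain ⟨t, ht, hbt⟩ := exists_lt_of_lt_csSup (hne s hs0) hbQ
    have hF : ∫ t, ramp a b t ∂μ < s :=
      (ramp_int_le μ hab).trans_lt ((monotone_cdf μ hbt.le).trans_lt ht)
    filter_upwards [(hconv (ramp a b)).eventually (gt_mem_nhds hF), eventually_gt_atTop 0] with p hp hp0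
    have hp' : (0:ℝ) < p := by exact_mod_cast hp0
    by_contra hle
    push Not at hle
    simp only [St, hfl p hp0, dif_pos] at hle
    rw [div_lt_iff₀ hp'] at hp
    have h1 : (⌊s * p⌋₊ : ℝ) + 1 ≤ ∑ i, ramp a b (x p i) := by
      have : ∑ i ∈ Finset.Iic (⟨⌊s * p⌋₊, hfl p hp0⟩ : Fin p), (1:ℝ) ≤ ∑ i, ramp a b (x p i) := by
        refine le_trans (Finset.sum_le_sum fun i hi => ?_)
          (Finset.sum_le_sum_of_subset_of_nonneg (Finset.subset_univ _) fun i _ _ => ramp_nonneg a b (x p i))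
        rw [Finset.mem_Iic] at hi
        exact (ramp_one hab ((hx p hi).trans hle)).ge
      simpa using this
    have := Nat.lt_floor_add_one (s * p)
    linarith
  · obtain ⟨a, haQ, hab⟩ := exists_between hb
    obtain ⟨s', hs's, hs'1, hQs'⟩ : ∃ s', s < s' ∧ s' < 1 ∧ Q s' < a := by
      have h1 : ∀ᶠ r in 𝓝 s, Q r < a := hcont.eventually (gt_mem_nhds haQ)
      have h2 : ∀ᶠ r in 𝓝[>] s, Q r < a := h1.filter_mono nhdsWithin_le_nhds
      have h3 : ∀ᶠ r in 𝓝[>] s, r ∈ Set.Ioo s 1 := Ioo_mem_nhdsGT hs1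
      obtain ⟨r, h4, h5⟩ := (h2.and h3).exists
      exact ⟨r, h5.1, h5.2, h4⟩
    have hFa : s' ≤ cdf μ a := by
      by_contra h
      push Not at h
      have : a ≤ Q s' := le_csSup (hbd s' hs'1) h
      linarith
    have hF : s < ∫ t, ramp a b t ∂μ := hs's.trans_le (hFa.trans (le_ramp_int μ hab))
    filter_upwards [(hconv (ramp a b)).eventually (lt_mem_nhds hF), eventually_gt_atTop 0] with p hp hp0
    have hp' : (0:ℝ) < p := by exact_mod_cast hp0
    by_contra hle
    push Not at hle
    simp only [St, hfl p hp0, dif_pos] at hle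
    rw [lt_div_iff₀ hp'] at hp
    have h1 : ∑ i, ramp a b (x p i) ≤ (⌊s * p⌋₊ : ℝ) := by
      have : ∑ i, ramp a b (x p i) ≤ ∑ i ∈ Finset.Iio (⟨⌊s * p⌋₊, hfl p hp0⟩ : Fin p), (1:ℝ) := by
        rw [← Finset.sum_subset (Finset.subset_univ (Finset.Iio (⟨⌊s * p⌋₊, hfl p hp0⟩ : Fin p)))]
        · exact Finset.sum_le_sum fun i _ => ramp_le _ _ _
        · intro i _ hi
          rw [Finset.mem_Iio, not_lt] at hi
          exact ramp_zero hab (hle.trans (hx p hi))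
      simpa using this
    have := Nat.floor_le (a := s * p) (by positivity)
    linarith

/-- `L²` quantile representation for nonnegative sorted converging sequences. -/
lemma quant_L2 (μ : Measure ℝ) [IsProbabilityMeasure μ] :
    ∃ Q : ℝ → ℝ, ∀ x : (p : ℕ) → Fin p → ℝ, (∀ p, Monotone (x p)) → (∀ p i, 0 ≤ x p i) →
      EmpConverges x μ → Integrable (fun t => t ^ 2) μ →
      Tendsto (fun p => (∑ i, (x p i) ^ 2) / (p : ℝ)) atTop (𝓝 (∫ t, t ^ 2 ∂μ)) →
      MemLp Q 2 nuU ∧ (∀ᵐ s ∂nuU, Tendsto (fun p => St (x p) s) atTop (𝓝 (Q s))) ∧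
      Tendsto (fun p => ∫ s, (St (x p) s - Q s) ^ 2 ∂nuU) atTop (𝓝 0) := by
  obtain ⟨Q, hQ⟩ := quant_tendsto μ
  refine ⟨Q, fun x hx hx0 hconv hintg h2 => ?_⟩
  have hae := hQ x hx hconv
  have hQm : AEMeasurable Q nuU :=
    aemeasurable_of_tendsto_metrizable_ae atTop (fun p => (measurable_St (x p)).aemeasurable) hae
  have hmap : nuU.map Q = μ := by
    have : IsProbabilityMeasure (nuU.map Q) := Measure.isProbabilityMeasure_map hQm
    apply ext_of_forall_integral_eq_of_IsFiniteMeasure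
    intro f
    rw [integral_map hQm f.continuous.measurable.aestronglyMeasurable]
    have h1 : Tendsto (fun p => ∫ s, f (St (x p) s) ∂nuU) atTop (𝓝 (∫ s, f (Q s) ∂nuU)) := by
      refine tendsto_integral_of_dominated_convergence (fun _ => ‖f‖)
        (fun p => (f.continuous.measurable.comp (measurable_St _)).aestronglyMeasurable)
        (integrable_const _) (fun p => ae_of_all _ fun s => f.norm_coe_le_norm _) ?_
      filter_upwards [hae] with s hs
      exact (f.continuous.tendsto _).comp hs
    refine tendsto_nhds_unique h1 ((hconv f).congr' ?_)
    filter_upwards [eventually_gt_atTop 0] with p hp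
    exact (St_int hp _ _).symm
  have hQ0 : ∀ᵐ s ∂nuU, 0 ≤ Q s := by
    filter_upwards [hae] with s hs
    exact ge_of_tendsto' hs fun p => St_nonneg (hx0 p) s
  have hQ2 : Integrable (fun s => Q s ^ 2) nuU := by
    have := hintg
    rw [← hmap] at this
    exact (integrable_map_measure (by fun_prop) hQm).1 this
  have hQL : MemLp Q 2 nuU := (memLp_two_iff_integrable_sq hQm.aestronglyMeasurable).2 hQ2
  have eQ2 : ∫ t, t ^ 2 ∂μ = ∫ s, Q s ^ 2 ∂nuU := by
    rw [← hmap, integral_map hQm (by fun_prop)]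
  refine ⟨hQL, hae, ?_⟩
  have hmin : Tendsto (fun p => ∫ s, min (St (x p) s) (Q s) * Q s ∂nuU) atTop (𝓝 (∫ s, Q s ^ 2 ∂nuU)) := by
    refine tendsto_integral_of_dominated_convergence (fun s => Q s ^ 2)
        (fun p => (((measurable_St _).aemeasurable.min hQm).mul hQm).aestronglyMeasurable) hQ2
        (fun p => ?_) ?_
    · filter_upwards [hQ0] with s hs
      have := St_nonneg (hx0 p) s
      rw [Real.norm_eq_abs, abs_of_nonneg (mul_nonneg (le_min this hs) hs), sq]
      gcongr
      exact min_le_right _ _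
    · filter_upwards [hae] with s hs
      have := (hs.min (tendsto_const_nhds (x := Q s))).mul (tendsto_const_nhds (x := Q s))
      simpa [sq] using this
  have hs2 : Tendsto (fun p => ∫ s, St (x p) s ^ 2 ∂nuU) atTop (𝓝 (∫ s, Q s ^ 2 ∂nuU)) := by
    rw [← eQ2]
    refine h2.congr' ?_
    filter_upwards [eventually_gt_atTop 0] with p hp
    exact (St_int hp _ (fun t => t ^ 2)).symm
  have hup : Tendsto (fun p => ∫ s, St (x p) s ^ 2 ∂nuU + ∫ s, Q s ^ 2 ∂nuU -
      2 * ∫ s, min (St (x p) s) (Q s) * Q s ∂nuU) atTop (𝓝 0) := by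
    have := (hs2.add_const (∫ s, Q s ^ 2 ∂nuU)).sub (hmin.const_mul 2)
    convert this using 2; ring
  refine squeeze_zero (fun p => integral_nonneg fun s => sq_nonneg _) (fun p => ?_) hup
  have hL := St_memLp (x p) 2
  have i1 : Integrable (fun s => St (x p) s ^ 2) nuU := hL.integrable_sq
  have i2 : Integrable (fun s => St (x p) s * Q s) nuU := hL.integrable_mul hQL
  have i3 : Integrable (fun s => min (St (x p) s) (Q s) * Q s) nuU := by
    refine hQ2.mono' (((measurable_St _).aemeasurable.min hQm).mul hQm).aestronglyMeasurable ?_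
    filter_upwards [hQ0] with s hs
    have := St_nonneg (hx0 p) s
    rw [Real.norm_eq_abs, abs_of_nonneg (mul_nonneg (le_min this hs) hs), sq]
    gcongr
    exact min_le_right _ _
  have e : ∫ s, (St (x p) s - Q s) ^ 2 ∂nuU = ∫ s, St (x p) s ^ 2 ∂nuU + ∫ s, Q s ^ 2 ∂nuU -
      2 * ∫ s, St (x p) s * Q s ∂nuU := by
    rw [← integral_const_mul, ← integral_add i1 hQ2, ← integral_sub (by exact i1.add hQ2) (i2.const_mul 2)]
    refine integral_congr_ae (ae_of_all _ fun s => ?_)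
    ring
  rw [e]
  have : ∫ s, min (St (x p) s) (Q s) * Q s ∂nuU ≤ ∫ s, St (x p) s * Q s ∂nuU := by
    refine integral_mono_ae i3 i2 ?_
    filter_upwards [hQ0] with s hs
    exact mul_le_mul_of_nonneg_right (min_le_left _ _) hs
  linarith

set_option linter.unusedSectionVars false

lemma tri2 {f g h : ℝ → ℝ} (hf : MemLp f 2 nuU) (hg : MemLp g 2 nuU) (hh : MemLp h 2 nuU) :
    ∫ s, (f s - h s) ^ 2 ∂nuU ≤ 2 * ∫ s, (f s - g s) ^ 2 ∂nuU + 2 * ∫ s, (g s - h s) ^ 2 ∂nuU := by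
  have i1 : Integrable (fun s => (f s - g s) ^ 2) nuU := (hf.sub hg).integrable_sq
  have i2 : Integrable (fun s => (g s - h s) ^ 2) nuU := (hg.sub hh).integrable_sq
  have i3 : Integrable (fun s => (f s - h s) ^ 2) nuU := (hf.sub hh).integrable_sq
  rw [← integral_const_mul, ← integral_const_mul, ← integral_add (i1.const_mul 2) (i2.const_mul 2)]
  refine integral_mono i3 ((i1.const_mul 2).add (i2.const_mul 2)) fun s => ?_
  simp only
  nlinarith [sq_nonneg (f s - g s - (g s - h s))]

lemma norm_toLp_sq {f : ℝ → ℝ} (hf : MemLp f 2 nuU) : ‖hf.toLp f‖ ^ 2 = ∫ s, f s ^ 2 ∂nuU := by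
  rw [← real_inner_self_eq_norm_sq, L2.inner_def]
  refine integral_congr_ae ?_
  filter_upwards [hf.coeFn_toLp] with s hs
  rw [hs]; simp [sq]

lemma lip_ext {ι : Type*} (a b : ι → ℝ) (h : ∀ i j, |b i - b j| ≤ |a i - a j|) :
    ∃ g : ℝ → ℝ, (∀ x y, |g x - g y| ≤ |x - y|) ∧ ∀ i, g (a i) = b i := by
  have hf : Function.FactorsThrough b a := by
    intro i j hij
    have := h i j
    rw [hij, sub_self, abs_zero] at this
    exact sub_eq_zero.1 (abs_eq_zero.1 (le_antisymm this (abs_nonneg _)))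
  have he : ∀ i, Function.extend a b 0 (a i) = b i := fun i => hf.extend_apply 0 i
  have hl : LipschitzOnWith 1 (Function.extend a b 0) (Set.range a) := by
    apply LipschitzOnWith.of_dist_le_mul
    rintro _ ⟨i, rfl⟩ _ ⟨j, rfl⟩
    rw [he, he, Real.dist_eq, Real.dist_eq, NNReal.coe_one, one_mul]
    exact h i j
  obtain ⟨g, hg, hgf⟩ := hl.extend_real
  refine ⟨g, fun x y => ?_, fun i => ?_⟩
  · have := hg.dist_le_mul x y
    rwa [Real.dist_eq, Real.dist_eq, NNReal.coe_one, one_mul] at this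
  · rw [← hgf ⟨i, rfl⟩, he]

/-- odd extension with slopes in `[0,1]` -/
lemma eta_ext {ι : Type*} (Q r : ι → ℝ) (hp : ∀ i j, (r i - r j) ^ 2 ≤ (r i - r j) * (Q i - Q j))
    (h0 : ∀ i, 0 ≤ r i) (h1 : ∀ i, r i ≤ Q i) :
    ∃ η : ℝ → ℝ, (∀ t, η (-t) = - η t) ∧
      (∀ t₁ t₂ : ℝ, t₂ ≤ t₁ → 0 ≤ η t₁ - η t₂ ∧ η t₁ - η t₂ ≤ t₁ - t₂) ∧ ∀ i, η (Q i) = r i := by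
  obtain ⟨g, hg, hgf⟩ := lip_ext (ι := ι × Bool) (fun k => if k.2 then Q k.1 else - Q k.1)
    (fun k => if k.2 then 2 * r k.1 - Q k.1 else -(2 * r k.1 - Q k.1)) (by
      rintro ⟨i, e⟩ ⟨j, e'⟩
      rw [← sq_le_sq]
      have hij := hp i j
      have a1 := h0 i
      have a2 := h0 j
      have a3 := h1 i
      have a4 := h1 j
      have a5 : (r i + r j) ^ 2 ≤ (r i + r j) * (Q i + Q j) := by
        rw [sq]; gcongr
      cases e <;> cases e' <;> simp <;> nlinarith)
  refine ⟨fun t => (t + (g t - g (-t)) / 2) / 2, fun t => ?_, fun t₁ t₂ h => ?_, fun i => ?_⟩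
  · simp only [neg_neg]; ring
  · have e1 := abs_le.1 (hg t₁ t₂)
    have e2 := abs_le.1 (hg (-t₁) (-t₂))
    rw [abs_of_nonneg (by linarith)] at e1
    have : |-t₁ - -t₂| = t₁ - t₂ := by
      rw [abs_of_nonpos (by linarith)]; ring
    rw [this] at e2
    obtain ⟨e11, e12⟩ := e1
    obtain ⟨e21, e22⟩ := e2
    constructor <;> linarith
  · have h1 := hgf (i, true)
    have h2 := hgf (i, false)
    simp at h1 h2
    simp only [h1, h2]; ring

lemma prox_cross {p p' : ℕ} (hp : 0 < p) (hp' : 0 < p') {lam y : Fin p → ℝ} {lam' y' : Fin p' → ℝ}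
    (h0 : ∀ i, 0 ≤ lam i) (hl : Monotone lam) (hy : Monotone y) (hy0 : ∀ i, 0 ≤ y i)
    (h0' : ∀ i, 0 ≤ lam' i) (hl' : Monotone lam') (hy' : Monotone y') (hy0' : ∀ i, 0 ≤ y' i) :
    ∫ s, (St (slopeProx lam y) s - St (slopeProx lam' y') s) ^ 2 ∂nuU ≤
      2 * ∫ s, (St y s - St y' s) ^ 2 ∂nuU + 2 * ∫ s, (St lam s - St lam' s) ^ 2 ∂nuU := by
  set X := slopeProx lam y with hX
  set X' := slopeProx lam' y' with hX'
  have hXm : Monotone X := fun i j hij => sub_nonneg.1 (slopeProx_mono h0 hl (hy hij)).1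
  have hX0 : ∀ i, 0 ≤ X i := fun i => (slopeProx_pos h0 hl hy0 i).1
  have hXm' : Monotone X' := fun i j hij => sub_nonneg.1 (slopeProx_mono h0' hl' (hy' hij)).1
  have hX0' : ∀ i, 0 ≤ X' i := fun i => (slopeProx_pos h0' hl' hy0' i).1
  have v1 := St_vi hp hp' h0 hl hy hy0 hXm' hX0'
  have v2 := St_vi hp' hp h0' hl' hy' hy0' hXm hX0
  rw [← hX] at v1
  rw [← hX'] at v2
  have m : ∀ {k : ℕ} (x : Fin k → ℝ), MemLp (St x) 2 nuU := fun x => St_memLp x 2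
  have i1 : Integrable (fun s => (St y s - St lam s - St X s) * (St X' s - St X s)) nuU :=
    (((m y).sub (m lam)).sub (m X)).integrable_mul ((m X').sub (m X))
  have i2 : Integrable (fun s => (St y' s - St lam' s - St X' s) * (St X s - St X' s)) nuU :=
    (((m y').sub (m lam')).sub (m X')).integrable_mul ((m X).sub (m X'))
  have i3 : Integrable (fun s => (St X s - St X' s) ^ 2) nuU := ((m X).sub (m X')).integrable_sq
  have i4 : Integrable (fun s => (St y s - St y' s) ^ 2) nuU := ((m y).sub (m y')).integrable_sq
  have i5 : Integrable (fun s => (St lam s - St lam' s) ^ 2) nuU := ((m lam).sub (m lam')).integrable_sq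
  have key : ∫ s, (St X s - St X' s) ^ 2 ∂nuU ≤
      ∫ s, (2 * ((St y s - St lam s - St X s) * (St X' s - St X s)) +
        2 * ((St y' s - St lam' s - St X' s) * (St X s - St X' s)) +
        2 * (St y s - St y' s) ^ 2 + 2 * (St lam s - St lam' s) ^ 2) ∂nuU := by
    refine integral_mono i3 (((((i1.const_mul 2).add (i2.const_mul 2))).add (i4.const_mul 2)).add (i5.const_mul 2)) fun s => ?_
    simp only
    nlinarith [sq_nonneg ((St y s - St y' s) + (St lam s - St lam' s)),
      sq_nonneg ((St y s - St y' s) - (St lam s - St lam' s) - (St X s - St X' s))]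
  rw [integral_add (by exact ((i1.const_mul 2).add (i2.const_mul 2)).add (i4.const_mul 2)) (i5.const_mul 2),
    integral_add (by exact (i1.const_mul 2).add (i2.const_mul 2)) (i4.const_mul 2),
    integral_add (i1.const_mul 2) (i2.const_mul 2)] at key
  simp only [integral_const_mul] at key
  linarith

lemma prox_sortedAbs {p : ℕ} {lam : Fin p → ℝ} (h0 : ∀ i, 0 ≤ lam i) (hl : Monotone lam) (u : Fin p → ℝ)
    {η : ℝ → ℝ} (hη : ∀ t, η (-t) = - η t) :
    ∑ i, (slopeProx lam u i - η (u i)) ^ 2 =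
      ∑ i, (slopeProx lam (sortedAbs u) i - η (sortedAbs u i)) ^ 2 := by
  let π := Tuple.sort (fun j => |u j|)
  let s : Fin p → ℝ := fun i => if 0 ≤ u (π i) then 1 else -1
  have e : sortedAbs u = fun i => s i * u (π i) := by
    ext i
    simp only [sortedAbs, s, π]
    split_ifs with h
    · rw [abs_of_nonneg h, one_mul]
    · rw [abs_of_neg (not_le.1 h)]; ring
  rw [e, slopeProx_equiv h0 hl u π s (by intro i; simp only [s]; split_ifs <;> norm_num),
    ← Equiv.sum_comp π]
  refine Finset.sum_congr rfl fun i _ => ?_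
  simp only [s]
  split_ifs with h
  · simp
  · have : (-1 : ℝ) * u (π i) = - u (π i) := by ring
    rw [this, hη]; ring

lemma sum_sortedAbs {p : ℕ} (u : Fin p → ℝ) (f : ℝ → ℝ) : ∑ i, f (sortedAbs u i) = ∑ i, f |u i| :=
  Equiv.sum_comp (Tuple.sort (fun j => |u j|)) (fun i => f |u i|)

theorem thmB {lam : (p : ℕ) → Fin p → ℝ} {μlam μ : Measure ℝ} [IsProbabilityMeasure μlam]
    [IsProbabilityMeasure μ] (h0 : ∀ p i, 0 ≤ lam p i) (hl : ∀ p, Monotone (lam p))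
    (hlc : EmpConverges lam μlam) (hl2i : Integrable (fun t => t ^ 2) μlam)
    (hl2 : Tendsto (fun p => (∑ i, (lam p i) ^ 2) / (p : ℝ)) atTop (𝓝 (∫ t, t ^ 2 ∂μlam)))
    (hμ2 : Integrable (fun t => t ^ 2) μ) :
    ∃ η : ℝ → ℝ, (∀ t, η (-t) = - η t) ∧
      (∀ t₁ t₂ : ℝ, t₂ ≤ t₁ → 0 ≤ η t₁ - η t₂ ∧ η t₁ - η t₂ ≤ t₁ - t₂) ∧
      ∀ u : (p : ℕ) → Fin p → ℝ, EmpConverges u μ →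
        Tendsto (fun p => (∑ i, (u p i) ^ 2) / (p : ℝ)) atTop (𝓝 (∫ t, t ^ 2 ∂μ)) →
        Tendsto (fun p => (∑ i, (slopeProx (lam p) (u p) i - η (u p i)) ^ 2) / (p : ℝ)) atTop (𝓝 0) := by
  by_cases hex : ∃ u : (p : ℕ) → Fin p → ℝ, EmpConverges u μ ∧
        Tendsto (fun p => (∑ i, (u p i) ^ 2) / (p : ℝ)) atTop (𝓝 (∫ t, t ^ 2 ∂μ))
  swap
  · refine ⟨fun _ => 0, by simp, fun t₁ t₂ h => by simp [h], fun u hu hu2 => absurd ⟨u, hu, hu2⟩ hex⟩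
  obtain ⟨u0, hu0, hu02⟩ := hex
  have : IsProbabilityMeasure (μ.map (fun t => |t|)) := Measure.isProbabilityMeasure_map (by fun_prop)
  obtain ⟨Q, hQ⟩ := quant_L2 (μ.map (fun t => |t|))
  obtain ⟨QL, hQL⟩ := quant_L2 μlam
  obtain ⟨mQL, -, tQL⟩ := hQL lam hl h0 hlc hl2i hl2
  have hQ' : ∀ u : (p : ℕ) → Fin p → ℝ, EmpConverges u μ →
        Tendsto (fun p => (∑ i, (u p i) ^ 2) / (p : ℝ)) atTop (𝓝 (∫ t, t ^ 2 ∂μ)) →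
        MemLp Q 2 nuU ∧ (∀ᵐ s ∂nuU, Tendsto (fun p => St (sortedAbs (u p)) s) atTop (𝓝 (Q s))) ∧
      Tendsto (fun p => ∫ s, (St (sortedAbs (u p)) s - Q s) ^ 2 ∂nuU) atTop (𝓝 0) := by
    intro u hu hu2
    refine hQ (fun p => sortedAbs (u p)) (fun p => sortedAbs_mono _) (fun p i => abs_nonneg _) ?_ ?_ ?_
    · intro f
      rw [integral_map (by fun_prop) f.continuous.measurable.aestronglyMeasurable]
      have := hu (f.compContinuous ⟨fun t => |t|, continuous_abs⟩)
      simp only [BoundedContinuousFunction.compContinuous_apply, ContinuousMap.coe_mk] at this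
      simpa only [sum_sortedAbs _ f] using this
    · rw [integrable_map_measure (by fun_prop) (by fun_prop)]
      simpa [Function.comp_def] using hμ2
    · rw [integral_map (by fun_prop) (by fun_prop)]
      simp only [sum_sortedAbs _ (fun t => t ^ 2), sq_abs]
      exact hu2
  obtain ⟨mQ, aeQ, tQ⟩ := hQ' u0 hu0 hu02
  set y : (p : ℕ) → Fin p → ℝ := fun p => sortedAbs (u0 p) with hy
  set X : (p : ℕ) → Fin p → ℝ := fun p => slopeProx (lam p) (y p) with hX
  have ym : ∀ (u : (p : ℕ) → Fin p → ℝ) p, Monotone (sortedAbs (u p)) := fun u p => sortedAbs_mono _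
  have y0 : ∀ (u : (p : ℕ) → Fin p → ℝ) p i, 0 ≤ sortedAbs (u p) i := fun u p i => abs_nonneg _
  have m : ∀ {k : ℕ} (x : Fin k → ℝ), MemLp (St x) 2 nuU := fun x => St_memLp x 2
  -- Cauchy
  let XL : ℕ → Lp ℝ 2 nuU := fun p => (m (X p)).toLp
  have hcau : CauchySeq XL := by
    rw [Metric.cauchySeq_iff]
    intro ε hε
    have hpos : 0 < ε ^ 2 / 32 := by positivity
    have e1 := tQ.eventually (gt_mem_nhds hpos)
    have e2 := tQL.eventually (gt_mem_nhds hpos)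
    obtain ⟨N, hN⟩ := eventually_atTop.1 ((e1.and e2).and (eventually_gt_atTop 0))
    refine ⟨N, fun p hp q hq => ?_⟩
    obtain ⟨⟨a1, a2⟩, a3⟩ := hN p hp
    obtain ⟨⟨b1, b2⟩, b3⟩ := hN q hq
    have hc := prox_cross a3 b3 (h0 p) (hl p) (ym u0 p) (y0 u0 p) (h0 q) (hl q) (ym u0 q) (y0 u0 q)
    have t1 := tri2 (m (y p)) mQ (m (y q))
    have t2 := tri2 (m (lam p)) mQL (m (lam q))
    have s1 : ∫ s, (Q s - St (y q) s) ^ 2 ∂nuU = ∫ s, (St (y q) s - Q s) ^ 2 ∂nuU := by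
      congr 1; ext s; ring
    have s2 : ∫ s, (QL s - St (lam q) s) ^ 2 ∂nuU = ∫ s, (St (lam q) s - QL s) ^ 2 ∂nuU := by
      congr 1; ext s; ring
    rw [s1] at t1
    rw [s2] at t2
    rw [dist_eq_norm]
    have e : XL p - XL q = ((m (X p)).sub (m (X q))).toLp := by rw [MemLp.toLp_sub]
    refine lt_of_pow_lt_pow_left₀ 2 hε.le ?_
    rw [e, norm_toLp_sq]
    simp only [Pi.sub_apply]
    change ∫ s, (St (X p) s - St (X q) s) ^ 2 ∂nuU < _
    change ∫ s, (St (X p) s - St (X q) s) ^ 2 ∂nuU ≤ 2 * ∫ s, (St (y p) s - St (y q) s) ^ 2 ∂nuU + _ at hc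
    linarith
  obtain ⟨r, hr⟩ := cauchySeq_tendsto_of_complete hcau
  have mr : MemLp r 2 nuU := Lp.memLp r
  have tr : Tendsto (fun p => ∫ s, (St (X p) s - r s) ^ 2 ∂nuU) atTop (𝓝 0) := by
    have h1 : Tendsto (fun p => ‖XL p - r‖ ^ 2) atTop (𝓝 0) := by
      have := (tendsto_iff_norm_sub_tendsto_zero.1 hr).pow 2
      simpa using this
    refine h1.congr fun p => ?_
    have e : XL p - r = ((m (X p)).sub mr).toLp := by
      rw [MemLp.toLp_sub (m (X p)) mr, Lp.toLp_coeFn r mr]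
    rw [e, norm_toLp_sq]; rfl
  obtain ⟨ns, hns, hae⟩ := (tendstoInMeasure_of_tendsto_Lp hr).exists_seq_tendsto_ae
  have hae' : ∀ᵐ s ∂nuU, Tendsto (fun k => St (X (ns k)) s) atTop (𝓝 (r s)) := by
    have : ∀ᵐ s ∂nuU, ∀ p, XL p s = St (X p) s := ae_all_iff.2 fun p => (m (X p)).coeFn_toLp
    filter_upwards [hae, this] with s hs h
    simpa only [h] using hs
  let S : Set ℝ := {s | 0 < s ∧ s < 1 ∧ Tendsto (fun k => St (X (ns k)) s) atTop (𝓝 (r s)) ∧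
    Tendsto (fun k => St (y (ns k)) s) atTop (𝓝 (Q s))}
  have hS : ∀ᵐ s ∂nuU, s ∈ S := by
    filter_upwards [hae', aeQ, ae_nuU (P := fun s => 0 < s ∧ s < 1) fun s h h1 => ⟨h, h1⟩] with s h1 h2 h3
    exact ⟨h3.1, h3.2, h1, h2.comp hns.tendsto_atTop⟩
  have hev : ∀ᶠ k in atTop, 0 < ns k := hns.tendsto_atTop.eventually (eventually_gt_atTop 0)
  obtain ⟨η, η1, η2, η3⟩ := eta_ext (ι := S) (fun s => Q s) (fun s => r s)
    (by
      rintro ⟨s, hs0, hs1, hs2, hs3⟩ ⟨t, ht0, ht1, ht2, ht3⟩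
      refine le_of_tendsto_of_tendsto ((hs2.sub ht2).pow 2) ((hs2.sub ht2).mul (hs3.sub ht3)) ?_
      filter_upwards [hev] with k hk
      obtain ⟨i, hi⟩ := St_eq hk (X (ns k)) hs0 hs1
      obtain ⟨j, hj⟩ := St_eq hk (X (ns k)) ht0 ht1
      simp only [hi, hj]
      exact slopeProx_pair (h0 _) (hl _) _ _ _)
    (by
      rintro ⟨s, hs0, hs1, hs2, hs3⟩
      refine ge_of_tendsto hs2 ?_
      filter_upwards [hev] with k hk
      obtain ⟨i, hi⟩ := St_eq hk (X (ns k)) hs0 hs1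
      simp only [hi]
      exact (slopeProx_pos (h0 _) (hl _) (y0 u0 _) i).1)
    (by
      rintro ⟨s, hs0, hs1, hs2, hs3⟩
      refine le_of_tendsto_of_tendsto hs2 hs3 ?_
      filter_upwards [hev] with k hk
      obtain ⟨i, hi⟩ := St_eq hk (X (ns k)) hs0 hs1
      simp only [hi]
      exact (slopeProx_pos (h0 _) (hl _) (y0 u0 _) i).2)
  refine ⟨η, η1, η2, fun u hu hu2 => ?_⟩
  have ηl : ∀ a b, |η a - η b| ≤ |a - b| := by
    intro a b
    rcases le_total b a with h | h
    · obtain ⟨h1, h2⟩ := η2 a b h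
      rwa [abs_of_nonneg h1, abs_of_nonneg (by linarith)]
    · obtain ⟨h1, h2⟩ := η2 b a h
      rw [abs_sub_comm (η a), abs_sub_comm a, abs_of_nonneg h1, abs_of_nonneg (by linarith)]
      exact h2
  obtain ⟨-, -, tU⟩ := hQ' u hu hu2
  have hup : Tendsto (fun p => 2 * (2 * (2 * (2 * ∫ s, (St (sortedAbs (u p)) s - Q s) ^ 2 ∂nuU +
      2 * ∫ s, (St (y p) s - Q s) ^ 2 ∂nuU)) + 2 * ∫ s, (St (X p) s - r s) ^ 2 ∂nuU) +
      2 * ∫ s, (St (sortedAbs (u p)) s - Q s) ^ 2 ∂nuU) atTop (𝓝 0) := by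
    have := ((((((tU.const_mul 2).add (tQ.const_mul 2)).const_mul 2).const_mul 2).add (tr.const_mul 2)).const_mul 2).add
      (tU.const_mul 2)
    convert this using 2; norm_num
  refine squeeze_zero' (Eventually.of_forall fun p => by positivity) ?_ hup
  filter_upwards [eventually_gt_atTop 0] with p hp
  rw [prox_sortedAbs (h0 p) (hl p) (u p) η1,
    ← St_int2 hp (slopeProx (lam p) (sortedAbs (u p))) (sortedAbs (u p)) (fun a b => (a - η b) ^ 2)]
  have hηc : Continuous η := by
    have : LipschitzWith 1 η := LipschitzWith.of_dist_le_mul fun a b => by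
      rw [Real.dist_eq, Real.dist_eq, NNReal.coe_one, one_mul]; exact ηl a b
    exact this.continuous
  have η0 : η 0 = 0 := by have := η1 0; simp at this; linarith
  have mη : ∀ f : ℝ → ℝ, MemLp f 2 nuU → MemLp (fun s => η (f s)) 2 nuU := by
    intro f hf
    refine hf.of_le (hηc.comp_aestronglyMeasurable hf.1) (ae_of_all _ fun s => ?_)
    have := ηl (f s) 0
    rw [η0, sub_zero, sub_zero] at this
    exact this
  have t1 := tri2 (m (slopeProx (lam p) (sortedAbs (u p)))) mr (mη _ (m (sortedAbs (u p))))
  have t2 := tri2 (m (slopeProx (lam p) (sortedAbs (u p)))) (m (X p)) mr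
  have t3 := prox_cross hp hp (h0 p) (hl p) (ym u p) (y0 u p) (h0 p) (hl p) (ym u0 p) (y0 u0 p)
  have t4 := tri2 (m (sortedAbs (u p))) mQ (m (y p))
  have s1 : ∫ s, (Q s - St (y p) s) ^ 2 ∂nuU = ∫ s, (St (y p) s - Q s) ^ 2 ∂nuU := by
    congr 1; ext s; ring
  rw [s1] at t4
  have t5 : ∫ s, (r s - η (St (sortedAbs (u p)) s)) ^ 2 ∂nuU ≤ ∫ s, (St (sortedAbs (u p)) s - Q s) ^ 2 ∂nuU := by
    refine integral_mono_ae (mr.sub (mη _ (m (sortedAbs (u p))))).integrable_sq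
      ((m (sortedAbs (u p))).sub mQ).integrable_sq ?_
    filter_upwards [hS] with s hs
    have := η3 ⟨s, hs⟩
    simp only at this
    rw [← this, sq_le_sq, abs_sub_comm (St _ _)]
    exact ηl _ _
  simp only [sub_self, ne_eq, OfNat.ofNat_ne_zero, not_false_eq_true, zero_pow, integral_zero, mul_zero, add_zero] at t3
  change ∫ s, (St (slopeProx (lam p) (sortedAbs (u p))) s - St (X p) s) ^ 2 ∂nuU ≤
    2 * ∫ s, (St (sortedAbs (u p)) s - St (y p) s) ^ 2 ∂nuU at t3
  linarith

set_option linter.unusedSectionVars false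

lemma diag_seq (a : ℕ → ℕ → ENNReal) (h : ∀ m, Tendsto (a m) atTop (𝓝 0)) :
    ∃ m : ℕ → ℕ, Tendsto m atTop atTop ∧ Tendsto (fun p => a (m p) p) atTop (𝓝 0) := by
  have hN : ∀ m : ℕ, ∃ N, ∀ p, N ≤ p → a m p ≤ ((m : ENNReal) + 1)⁻¹ := by
    intro m
    have hpos : (0 : ENNReal) < ((m : ENNReal) + 1)⁻¹ := by
      rw [ENNReal.inv_pos]; exact ENNReal.add_ne_top.2 ⟨ENNReal.natCast_ne_top m, ENNReal.one_ne_top⟩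
    obtain ⟨N, hN⟩ := eventually_atTop.1 ((h m).eventually (ge_mem_nhds hpos))
    exact ⟨N, hN⟩
  choose N hN using hN
  let m : ℕ → ℕ := fun p => Nat.findGreatest (fun k => N k ≤ p) p
  have hm : Tendsto m atTop atTop := by
    rw [tendsto_atTop_atTop]
    intro M
    refine ⟨max M (N M), fun p hp => ?_⟩
    exact Nat.le_findGreatest ((le_max_left _ _).trans hp) ((le_max_right _ _).trans hp)
  refine ⟨m, hm, ?_⟩
  have hlim : Tendsto (fun p => ((m p : ENNReal) + 1)⁻¹) atTop (𝓝 0) := by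
    have h1 : Tendsto (fun k : ℕ => ((k : ENNReal) + 1)⁻¹) atTop (𝓝 0) := by
      have := (tendsto_add_atTop_iff_nat 1).2 ENNReal.tendsto_inv_nat_nhds_zero
      simpa using this
    exact h1.comp hm
  refine tendsto_of_tendsto_of_tendsto_of_le_of_le' tendsto_const_nhds hlim
    (Eventually.of_forall fun _ => zero_le) ?_
  filter_upwards [eventually_ge_atTop (N 0)] with p hp
  exact hN _ _ (Nat.findGreatest_spec (P := fun k => N k ≤ p) (Nat.zero_le p) hp)

lemma transfer {Ω : ℕ → Type*} [∀ p, MeasurableSpace (Ω p)] (P : (p : ℕ) → Measure (Ω p))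
    [∀ p, IsProbabilityMeasure (P p)] {ι : Type*} [Countable ι] [Nonempty ι] (T : ι → (p : ℕ) → Ω p → ℝ)
    (hT : ∀ k, ∀ ε : ℝ, 0 < ε → Tendsto (fun p => P p {ω | ε ≤ |T k p ω|}) atTop (𝓝 0)) :
    (∃ ω : (p : ℕ) → Ω p, ∀ k, Tendsto (fun p => T k p (ω p)) atTop (𝓝 0)) ∧
    ∀ Bad : (p : ℕ) → Set (Ω p),
      (∀ ω : (p : ℕ) → Ω p, (∀ k, Tendsto (fun p => T k p (ω p)) atTop (𝓝 0)) → ∀ᶠ p in atTop, ω p ∉ Bad p) →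
      Tendsto (fun p => P p (Bad p)) atTop (𝓝 0) := by
  obtain ⟨e, he⟩ := exists_surjective_nat ι
  obtain ⟨m, hm, hm0⟩ := diag_seq (fun m p => ∑ k ∈ Finset.range m, P p {ω | 1 / ((m:ℝ) + 1) ≤ |T (e k) p ω|})
    (fun m => by
      have := tendsto_finsetSum (Finset.range m) (fun k _ => hT (e k) (1 / ((m:ℝ) + 1)) (by positivity))
      simpa using this)
  let G : (p : ℕ) → Set (Ω p) := fun p => {ω | ∀ k < m p, |T (e k) p ω| < 1 / ((m p : ℝ) + 1)}
  have hGc : ∀ p, P p (G p)ᶜ ≤ ∑ k ∈ Finset.range (m p), P p {ω | 1 / ((m p:ℝ) + 1) ≤ |T (e k) p ω|} := by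
    intro p
    refine le_trans (measure_mono ?_) (measure_biUnion_finset_le _ _)
    intro ω hω
    simp only [G, Set.mem_compl_iff, Set.mem_ofPred_eq] at hω
    push Not at hω
    obtain ⟨k, hk, hk2⟩ := hω
    simp only [Set.mem_iUnion]
    exact ⟨k, Finset.mem_range.2 hk, hk2⟩
  have hGc0 : Tendsto (fun p => P p (G p)ᶜ) atTop (𝓝 0) :=
    tendsto_of_tendsto_of_tendsto_of_le_of_le tendsto_const_nhds hm0 (fun _ => zero_le) hGc
  have hGne : ∀ᶠ p in atTop, (G p).Nonempty := by
    filter_upwards [hGc0.eventually (gt_mem_nhds zero_lt_one)] with p hp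
    by_contra hne
    rw [Set.not_nonempty_iff_eq_empty] at hne
    rw [hne, Set.compl_empty, measure_univ] at hp
    exact lt_irrefl _ hp
  have hgood : ∀ ω : (p : ℕ) → Ω p, (∀ᶠ p in atTop, ω p ∈ G p) →
      ∀ k, Tendsto (fun p => T k p (ω p)) atTop (𝓝 0) := by
    intro ω hω k
    obtain ⟨j, rfl⟩ := he k
    have hlim : Tendsto (fun p => 1 / ((m p : ℝ) + 1)) atTop (𝓝 0) :=
      tendsto_one_div_add_atTop_nhds_zero_nat.comp hm
    refine squeeze_zero_norm' ?_ hlim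
    filter_upwards [hω, hm.eventually (eventually_gt_atTop j)] with p hp hj
    exact (hp j hj).le
  have hne : ∀ p, Nonempty (Ω p) := fun p => by
    by_contra h
    rw [not_nonempty_iff] at h
    have h1 : P p Set.univ = 1 := measure_univ
    rw [Set.univ_eq_empty_iff.2 h, measure_empty] at h1
    exact zero_ne_one h1
  classical
  constructor
  · let ω : (p : ℕ) → Ω p := fun p => if h : (G p).Nonempty then h.some else (hne p).some
    refine ⟨ω, hgood ω ?_⟩
    filter_upwards [hGne] with p hp
    simp only [ω, hp, dif_pos]
    exact hp.some_mem
  · intro Bad hBad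
    have hev : ∀ᶠ p in atTop, Bad p ⊆ (G p)ᶜ := by
      let ω : (p : ℕ) → Ω p := fun p => if h : (Bad p ∩ G p).Nonempty then h.some else
        if h : (G p).Nonempty then h.some else (hne p).some
      have h1 := hBad ω (hgood ω (by
        filter_upwards [hGne] with p hp
        by_cases h : (Bad p ∩ G p).Nonempty
        · simp only [ω, h, dif_pos]; exact h.some_mem.2
        · simp only [ω, h, hp, dif_pos, dif_neg, not_false_eq_true]; exact hp.some_mem))
      filter_upwards [h1] with p hp x hx hxG
      have h : (Bad p ∩ G p).Nonempty := ⟨x, hx, hxG⟩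
      simp only [ω, h, dif_pos] at hp
      exact hp h.some_mem.1
    refine tendsto_of_tendsto_of_tendsto_of_le_of_le' tendsto_const_nhds hGc0
      (Eventually.of_forall fun _ => zero_le) ?_
    filter_upwards [hev] with p hp
    exact measure_mono hp

set_option linter.unusedSectionVars false

lemma lln_le {E : Type*} [Fintype E] (F : E → ℝ → ℝ) (hF : ∀ i, MemLp (F i) 2 (gaussianReal 0 1))
    {ε : ℝ} (hε : 0 < ε) :
    gam E {x | ε ≤ |∑ i, F i (x i) - ∑ i, ∫ t, F i t ∂gaussianReal 0 1|} ≤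
      ENNReal.ofReal ((∑ i, ∫ t, F i t ^ 2 ∂gaussianReal 0 1) / ε ^ 2) := by
  have hm : ∀ i, MemLp (fun x : E → ℝ => F i (x i)) 2 (gam E) := fun i =>
    (hF i).comp_measurePreserving (measurePreserving_eval (fun _ : E => gaussianReal 0 1) i)
  have hS : MemLp (∑ i, fun x : E → ℝ => F i (x i)) 2 (gam E) := memLp_finsetSum' _ fun i _ => hm i
  have h1 := meas_ge_le_variance_div_sq hS hε
  have h2 : Var[∑ i, fun x : E → ℝ => F i (x i); gam E] = ∑ i, Var[F i; gaussianReal 0 1] :=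
    variance_sum_pi hF
  have h3 : (gam E)[∑ i, fun x : E → ℝ => F i (x i)] = ∑ i, ∫ t, F i t ∂gaussianReal 0 1 := by
    simp only [Finset.sum_apply]
    rw [integral_finsetSum _ fun i _ => (hm i).integrable (by norm_num)]
    refine Finset.sum_congr rfl fun i _ => ?_
    have := (measurePreserving_eval (fun _ : E => gaussianReal 0 1) i)
    rw [← this.map_eq, integral_map this.measurable.aemeasurable]
    · rfl
    · rw [this.map_eq]; exact (hF i).aestronglyMeasurable
  rw [h3, h2] at h1
  simp only [Finset.sum_apply] at h1
  refine h1.trans (ENNReal.ofReal_le_ofReal ?_)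
  gcongr with i
  exact variance_le_expectation_sq (hF i).aestronglyMeasurable

lemma lln_tendsto (m : ℕ → ℕ) (hm : Tendsto m atTop atTop)
    (F : (p : ℕ) → Fin (m p) → ℝ → ℝ) (hF : ∀ p i, MemLp (F p i) 2 (gaussianReal 0 1))
    {C c : ℝ} (hC : ∀ᶠ p in atTop, ∑ i, ∫ t, F p i t ^ 2 ∂gaussianReal 0 1 ≤ C * m p)
    (hc : Tendsto (fun p => (∑ i, ∫ t, F p i t ∂gaussianReal 0 1) / (m p : ℝ)) atTop (𝓝 c))
    {ε : ℝ} (hε : 0 < ε) :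
    Tendsto (fun p => gam (Fin (m p)) {x | ε ≤ |(∑ i, F p i (x i)) / (m p : ℝ) - c|}) atTop (𝓝 0) := by
  have hlim : Tendsto (fun p => ENNReal.ofReal (C / (ε / 2) ^ 2 * ((m p : ℝ))⁻¹)) atTop (𝓝 0) := by
    have h1 : Tendsto (fun p => C / (ε / 2) ^ 2 * ((m p : ℝ))⁻¹) atTop (𝓝 (C / (ε / 2) ^ 2 * 0)) :=
      (tendsto_inv_atTop_zero.comp (tendsto_natCast_atTop_atTop.comp hm)).const_mul _
    rw [mul_zero] at h1
    have := ENNReal.tendsto_ofReal h1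
    rwa [ENNReal.ofReal_zero] at this
  refine tendsto_of_tendsto_of_tendsto_of_le_of_le' tendsto_const_nhds hlim
    (Eventually.of_forall fun _ => zero_le) ?_
  have hce : ∀ᶠ p in atTop, |(∑ i, ∫ t, F p i t ∂gaussianReal 0 1) / (m p : ℝ) - c| < ε / 2 := by
    have := Metric.tendsto_nhds.1 hc (ε / 2) (by positivity)
    simpa [Real.dist_eq] using this
  filter_upwards [hC, hce, hm.eventually (eventually_gt_atTop 0)] with p h1 h2 h3
  have h3' : (0 : ℝ) < m p := by exact_mod_cast h3
  refine le_trans (measure_mono ?_) (le_trans (lln_le (F p) (hF p) (ε := ε / 2 * m p) (by positivity)) ?_)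
  · intro x hx
    simp only [Set.mem_ofPred_eq] at hx ⊢
    have h4 : |(∑ i, F p i (x i)) / (m p : ℝ) - (∑ i, ∫ t, F p i t ∂gaussianReal 0 1) / (m p : ℝ)| ≥ ε / 2 := by
      have := abs_sub_le ((∑ i, F p i (x i)) / (m p : ℝ)) ((∑ i, ∫ t, F p i t ∂gaussianReal 0 1) / (m p : ℝ)) c
      linarith
    rw [← sub_div, abs_div, abs_of_pos h3', ge_iff_le, le_div_iff₀ h3'] at h4
    exact h4
  · apply ENNReal.ofReal_le_ofReal
    rw [mul_pow, div_mul_eq_mul_div, div_le_iff₀ (by positivity)]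
    calc _ ≤ C * m p := h1
      _ = _ := by field_simp

lemma mom2 : ∫ t, t ^ 2 ∂gaussianReal 0 1 = 1 := by
  have h := variance_id_gaussianReal (μ := 0) (v := 1)
  rw [variance_of_integral_eq_zero aemeasurable_id (by simp)] at h
  simpa using h

lemma memLp_id_gauss (q : ENNReal) (hq : q ≠ ⊤) : MemLp (fun t : ℝ => t) q (gaussianReal 0 1) := by
  lift q to NNReal using hq
  exact memLp_id_gaussianReal q

lemma integrable_pow_gauss (k : ℕ) : Integrable (fun t : ℝ => t ^ k) (gaussianReal 0 1) := by
  rcases Nat.eq_zero_or_pos k with rfl | hk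
  · simp
  have h := (memLp_id_gauss (k : ENNReal) (by simp)).integrable_norm_pow (by omega)
  refine h.mono (by fun_prop) (Eventually.of_forall fun t => ?_)
  simp

lemma memLp_sq_gauss : MemLp (fun t : ℝ => t ^ 2) 2 (gaussianReal 0 1) := by
  rw [memLp_two_iff_integrable_sq (by fun_prop)]
  have := integrable_pow_gauss 4
  refine this.congr (Eventually.of_forall fun t => ?_)
  simp only; ring

set_option linter.unusedSectionVars false

noncomputable def cpt (q : ℝ × ℝ) : ℂ := ⟨q.1, q.2⟩

lemma continuous_cpt : Continuous cpt := Complex.equivRealProdCLM.symm.continuous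

noncomputable def empC (x y : (p : ℕ) → Fin p → ℝ) (p : ℕ) : Measure ℂ :=
  ((p + 1 : ℕ) : ENNReal)⁻¹ • ∑ i, Measure.dirac (cpt (x (p + 1) i, y (p + 1) i))

instance empC_prob (x y : (p : ℕ) → Fin p → ℝ) (p : ℕ) : IsProbabilityMeasure (empC x y p) := by
  constructor
  simp only [empC, Measure.smul_apply, Measure.finsetSum_apply, measure_univ, Finset.sum_const, Finset.card_univ,
    Fintype.card_fin, smul_eq_mul, nsmul_eq_mul, mul_one]
  exact ENNReal.inv_mul_cancel (by simp) (ENNReal.natCast_ne_top _)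

lemma empC_int {G : Type*} [NormedAddCommGroup G] [NormedSpace ℝ G] [CompleteSpace G]
    (x y : (p : ℕ) → Fin p → ℝ) (p : ℕ) {f : ℂ → G} (hf : Continuous f) :
    ∫ z, f z ∂(empC x y p) = ((p + 1 : ℕ) : ℝ)⁻¹ • ∑ i, f (cpt (x (p + 1) i, y (p + 1) i)) := by
  rw [empC, integral_smul_measure, integral_finsetSum_measure]
  · simp [ENNReal.toReal_inv]
    congr 1
  · intro i _
    exact integrable_dirac (by simp [enorm_lt_top])

lemma cexp_inner (z t : ℂ) : Complex.exp ((inner ℝ z t : ℝ) * Complex.I) =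
    (Real.cos (t.re * z.re + t.im * z.im) : ℂ) + (Real.sin (t.re * z.re + t.im * z.im) : ℂ) * Complex.I := by
  rw [Complex.exp_mul_I, Complex.inner]
  simp [Complex.mul_re]

lemma levy2 (x y : (p : ℕ) → Fin p → ℝ) (ν : Measure (ℝ × ℝ)) [IsProbabilityMeasure ν]
    (hc : ∀ a b : ℝ, Tendsto (fun p => (∑ i, Real.cos (a * x p i + b * y p i)) / (p : ℝ)) atTop
      (𝓝 (∫ q, Real.cos (a * q.1 + b * q.2) ∂ν)))
    (hs : ∀ a b : ℝ, Tendsto (fun p => (∑ i, Real.sin (a * x p i + b * y p i)) / (p : ℝ)) atTop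
      (𝓝 (∫ q, Real.sin (a * q.1 + b * q.2) ∂ν))) (f : BoundedContinuousFunction (ℝ × ℝ) ℝ) :
    Tendsto (fun p => (∑ i, f (x p i, y p i)) / (p : ℝ)) atTop (𝓝 (∫ q, f q ∂ν)) := by
  have hmc : Measurable cpt := continuous_cpt.measurable
  let μs : ℕ → ProbabilityMeasure ℂ := fun p => ⟨empC x y p, inferInstance⟩
  have : IsProbabilityMeasure (ν.map cpt) := Measure.isProbabilityMeasure_map hmc.aemeasurable
  let μ0 : ProbabilityMeasure ℂ := ⟨ν.map cpt, inferInstance⟩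
  have key : Tendsto μs atTop (𝓝 μ0) := by
    apply ProbabilityMeasure.tendsto_of_tendsto_charFun
    intro t
    simp only [charFun_apply, cexp_inner]
    have h1 : ∀ p, ∫ z, ((Real.cos (t.re * z.re + t.im * z.im) : ℂ) + (Real.sin (t.re * z.re + t.im * z.im) : ℂ) * Complex.I)
        ∂((μs p : ProbabilityMeasure ℂ) : Measure ℂ) =
        (((∑ i, Real.cos (t.re * x (p+1) i + t.im * y (p+1) i)) / ((p + 1 : ℕ) : ℝ) : ℝ) : ℂ) +
        (((∑ i, Real.sin (t.re * x (p+1) i + t.im * y (p+1) i)) / ((p + 1 : ℕ) : ℝ) : ℝ) : ℂ) * Complex.I := by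
      intro p
      refine (empC_int x y p (by fun_prop)).trans ?_
      simp only [cpt, Complex.real_smul, Finset.sum_add_distrib, ← Finset.sum_mul]
      push_cast
      ring
    have h2 : ∫ z, ((Real.cos (t.re * z.re + t.im * z.im) : ℂ) + (Real.sin (t.re * z.re + t.im * z.im) : ℂ) * Complex.I)
        ∂(μ0 : Measure ℂ) = ((∫ q, Real.cos (t.re * q.1 + t.im * q.2) ∂ν : ℝ) : ℂ) +
          ((∫ q, Real.sin (t.re * q.1 + t.im * q.2) ∂ν : ℝ) : ℂ) * Complex.I := by
      have e : (μ0 : Measure ℂ) = ν.map cpt := rfl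
      rw [e, integral_map hmc.aemeasurable (Continuous.aestronglyMeasurable (by fun_prop))]
      simp only [cpt]
      have hb : ∀ g : ℝ × ℝ → ℝ, Continuous g → (∀ q, |g q| ≤ 1) → Integrable (fun q => (g q : ℂ)) ν := by
        intro g hg h1
        refine Integrable.of_bound (C := 1) (by fun_prop) (Eventually.of_forall fun q => ?_)
        simpa using h1 q
      rw [integral_add (hb _ (by fun_prop) fun q => Real.abs_cos_le_one _)
        ((hb _ (by fun_prop) fun q => Real.abs_sin_le_one _).mul_const _), integral_mul_const]
      congr 1
      · exact integral_ofReal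
      · congr 1
        exact integral_ofReal
    rw [h2]
    simp_rw [h1]
    have hc' := (tendsto_add_atTop_iff_nat 1).2 (hc t.re t.im)
    have hs' := (tendsto_add_atTop_iff_nat 1).2 (hs t.re t.im)
    exact ((Complex.continuous_ofReal.tendsto _).comp hc').add
      (((Complex.continuous_ofReal.tendsto _).comp hs').mul_const _)
  have k2 := (ProbabilityMeasure.tendsto_iff_forall_integral_tendsto.1 key)
    (f.compContinuous ⟨Complex.equivRealProdCLM, Complex.equivRealProdCLM.continuous⟩)
  rw [← tendsto_add_atTop_iff_nat 1]
  have e0 : (μ0 : Measure ℂ) = ν.map cpt := rfl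
  rw [e0, integral_map hmc.aemeasurable (Continuous.aestronglyMeasurable (by fun_prop))] at k2
  refine Tendsto.congr' (Eventually.of_forall fun p => ?_) k2
  refine (empC_int x y p (BoundedContinuousFunction.continuous _)).trans ?_
  simp only [smul_eq_mul]
  rw [inv_mul_eq_div]
  rfl

lemma dense_ext (f : ℕ → ℝ → ℝ → ℝ) (g : ℝ → ℝ → ℝ) {M : ℝ} (hM : 0 ≤ M)
    (hf : ∀ᶠ p in atTop, ∀ a b a' b', |f p a b - f p a' b'| ≤ M * (|a - a'| + |b - b'|))
    (hg : ∀ a b a' b', |g a b - g a' b'| ≤ M * (|a - a'| + |b - b'|))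
    (h : ∀ a b : ℚ, Tendsto (fun p => f p a b) atTop (𝓝 (g a b))) (a b : ℝ) :
    Tendsto (fun p => f p a b) atTop (𝓝 (g a b)) := by
  rw [Metric.tendsto_nhds]
  intro ε hε
  have hd : 0 < ε / (6 * (M + 1)) := by positivity
  obtain ⟨a', ha'⟩ := exists_rat_btwn (show a < a + ε / (6 * (M + 1)) by linarith)
  obtain ⟨b', hb'⟩ := exists_rat_btwn (show b < b + ε / (6 * (M + 1)) by linarith)
  have h1 : M * (|a - a'| + |b - b'|) ≤ ε / 3 := by
    rw [abs_sub_comm a, abs_sub_comm b, abs_of_pos (by linarith), abs_of_pos (by linarith)]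
    calc M * ((a' - a) + (b' - b)) ≤ (M + 1) * (2 * (ε / (6 * (M + 1)))) := by
          apply mul_le_mul <;> linarith
      _ = ε / 3 := by field_simp; norm_num
  filter_upwards [hf, Metric.tendsto_nhds.1 (h a' b') (ε / 3) (by positivity)] with p h2 h3
  rw [Real.dist_eq] at h3 ⊢
  have h4 := h2 a b a' b'
  have h5 := hg a b a' b'
  rw [abs_lt] at *
  rw [abs_le] at *
  constructor <;> linarith

lemma avg_of_bdd (x y : (p : ℕ) → Fin p → ℝ) (ν : Measure (ℝ × ℝ)) [IsProbabilityMeasure ν]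
    (h : ∀ f : BoundedContinuousFunction (ℝ × ℝ) ℝ,
      Tendsto (fun p => (∑ i, f (x p i, y p i)) / (p : ℝ)) atTop (𝓝 (∫ q, f q ∂ν)))
    {g : ℝ × ℝ → ℝ} (hg : Continuous g) (hg0 : ∀ q, 0 ≤ g q) (hgi : Integrable g ν) {ε : ℝ} (hε : 0 < ε) :
    ∀ᶠ p : ℕ in atTop, (∫ q, g q ∂ν) - ε ≤ (∑ i, g (x p i, y p i)) / (p : ℝ) := by
  have h1 : Tendsto (fun M : ℕ => ∫ q, min (g q) M ∂ν) atTop (𝓝 (∫ q, g q ∂ν)) := by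
    refine tendsto_integral_of_dominated_convergence g (fun M => by fun_prop) hgi
      (fun M => Eventually.of_forall fun q => ?_) (Eventually.of_forall fun q => ?_)
    · rw [Real.norm_eq_abs, abs_of_nonneg (le_min (hg0 q) (Nat.cast_nonneg M))]
      exact min_le_left _ _
    · refine tendsto_const_nhds.congr' ?_
      obtain ⟨N, hN⟩ := exists_nat_ge (g q)
      filter_upwards [eventually_ge_atTop N] with M hM
      rw [min_eq_left]
      exact hN.trans (by exact_mod_cast hM)
  obtain ⟨M, hM⟩ := (h1.eventually (lt_mem_nhds (show (∫ q, g q ∂ν) - ε / 2 < ∫ q, g q ∂ν by linarith))).exists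
  let f : BoundedContinuousFunction (ℝ × ℝ) ℝ := BoundedContinuousFunction.ofNormedAddCommGroup
    (fun q => min (g q) M) (by fun_prop) M (fun q => by
      rw [Real.norm_eq_abs, abs_of_nonneg (le_min (hg0 q) (Nat.cast_nonneg M))]
      exact min_le_right _ _)
  have hf : ∀ q, f q = min (g q) M := fun q => rfl
  have h2 := h f
  simp only [hf] at h2
  filter_upwards [h2.eventually (lt_mem_nhds (show (∫ q, g q ∂ν) - ε < ∫ q, min (g q) M ∂ν by linarith))] with p hp
  refine hp.le.trans ?_
  gcongr with i
  exact min_le_left _ _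

lemma avg_quad (x y : (p : ℕ) → Fin p → ℝ) (ν : Measure (ℝ × ℝ)) [IsProbabilityMeasure ν]
    (h : ∀ f : BoundedContinuousFunction (ℝ × ℝ) ℝ,
      Tendsto (fun p => (∑ i, f (x p i, y p i)) / (p : ℝ)) atTop (𝓝 (∫ q, f q ∂ν)))
    (hi : Integrable (fun q : ℝ × ℝ => 1 + q.1 ^ 2 + q.2 ^ 2) ν)
    (hlim : Tendsto (fun p => (∑ i, (1 + x p i ^ 2 + y p i ^ 2)) / (p : ℝ)) atTop
      (𝓝 (∫ q, (1 + q.1 ^ 2 + q.2 ^ 2) ∂ν)))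
    {f : ℝ × ℝ → ℝ} (hf : Continuous f) {C : ℝ} (hC : ∀ q, |f q| ≤ C * (1 + q.1 ^ 2 + q.2 ^ 2)) :
    Tendsto (fun p => (∑ i, f (x p i, y p i)) / (p : ℝ)) atTop (𝓝 (∫ q, f q ∂ν)) := by
  have hfi : Integrable f ν := (hi.const_mul C).mono' hf.aestronglyMeasurable (Eventually.of_forall hC)
  have half : ∀ f : ℝ × ℝ → ℝ, Continuous f → Integrable f ν → (∀ q, |f q| ≤ C * (1 + q.1 ^ 2 + q.2 ^ 2)) →
      ∀ ε > 0, ∀ᶠ p : ℕ in atTop, (∫ q, f q ∂ν) - ε ≤ (∑ i, f (x p i, y p i)) / (p : ℝ) := by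
    intro f hf hfi hC ε hε
    have h1 := avg_of_bdd x y ν h (g := fun q => f q + C * (1 + q.1 ^ 2 + q.2 ^ 2)) (by fun_prop)
      (fun q => by have := (abs_le.1 (hC q)).1; linarith) (hfi.add (hi.const_mul C)) (half_pos hε)
    have h2 := (hlim.const_mul C).eventually (gt_mem_nhds (lt_add_of_pos_right _ (half_pos hε)))
    filter_upwards [h1, h2] with p h1 h2
    rw [integral_add hfi (hi.const_mul C), integral_const_mul] at h1
    simp only [Finset.sum_add_distrib (f := fun i => f (x p i, y p i)), ← Finset.mul_sum, add_div, mul_div_assoc] at h1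
    linarith
  rw [Metric.tendsto_nhds]
  intro ε hε
  filter_upwards [half f hf hfi hC (ε / 2) (by positivity),
    half (fun q => - f q) hf.neg hfi.neg (fun q => by rw [abs_neg]; exact hC q) (ε / 2) (by positivity)] with p h1 h2
  rw [integral_neg] at h2
  simp only [Finset.sum_neg_distrib, neg_div] at h2
  rw [Real.dist_eq, abs_lt]
  constructor <;> linarith

set_option linter.unusedSectionVars false

def GoodH (β : (p : ℕ) → Fin p → ℝ) (μβ : Measure ℝ) (h : (p : ℕ) → Fin p → ℝ) : Prop :=
  ∀ f : ℝ × ℝ → ℝ, Continuous f → (∃ C, ∀ q, |f q| ≤ C * (1 + q.1 ^ 2 + q.2 ^ 2)) →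
    Tendsto (fun p => (∑ i, f (β p i, h p i)) / (p : ℝ)) atTop (𝓝 (∫ q, f q ∂(μβ.prod (gaussianReal 0 1))))

def GoodG {n : ℕ → ℕ} (w g : (p : ℕ) → Fin (n p) → ℝ) : Prop :=
  Tendsto (fun p => (∑ i, g p i ^ 2) / (n p : ℝ)) atTop (𝓝 1) ∧
  Tendsto (fun p => (∑ i, w p i * g p i) / (n p : ℝ)) atTop (𝓝 0)

noncomputable def phiB (s : Bool) : ℝ → ℝ := if s then Real.cos else Real.sin

lemma phiB_cont (s : Bool) : Continuous (phiB s) := by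
  cases s
  · exact Real.continuous_sin
  · exact Real.continuous_cos

lemma phiB_le (s : Bool) (x : ℝ) : |phiB s x| ≤ 1 := by
  cases s
  · exact Real.abs_sin_le_one x
  · exact Real.abs_cos_le_one x

lemma phiB_lip (s : Bool) (x y : ℝ) : |phiB s x - phiB s y| ≤ |x - y| := by
  cases s
  · exact Real.abs_sin_sub_sin_le x y
  · exact Real.abs_cos_sub_cos_le x y

lemma quad_integrable {μβ : Measure ℝ} [IsProbabilityMeasure μβ] (hβ2int : Integrable (fun t => t ^ 2) μβ) :
    Integrable (fun q : ℝ × ℝ => 1 + q.1 ^ 2 + q.2 ^ 2) (μβ.prod (gaussianReal 0 1)) := by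
  refine ((integrable_const 1).add ?_).add ?_
  · exact hβ2int.comp_fst (gaussianReal 0 1)
  · exact (integrable_pow_gauss 2).comp_snd μβ

lemma goodH_of {β h : (p : ℕ) → Fin p → ℝ} {μβ : Measure ℝ} [IsProbabilityMeasure μβ]
    (hβ2int : Integrable (fun t => t ^ 2) μβ)
    (hβ2 : Tendsto (fun p => (∑ i, (β p i) ^ 2) / (p : ℝ)) atTop (𝓝 (∫ t, t ^ 2 ∂μβ)))
    (hh : Tendsto (fun p => (∑ i, (h p i) ^ 2) / (p : ℝ)) atTop (𝓝 1))
    (hφ : ∀ (s : Bool) (a b : ℚ), Tendsto (fun p => (∑ i, phiB s (a * β p i + b * h p i)) / (p : ℝ)) atTop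
      (𝓝 (∫ q, phiB s (a * q.1 + b * q.2) ∂(μβ.prod (gaussianReal 0 1))))) : GoodH β μβ h := by
  set ν := μβ.prod (gaussianReal 0 1) with hν
  have hqi := quad_integrable hβ2int
  rw [← hν] at hqi
  set I := ∫ t, t ^ 2 ∂μβ
  have hI : 0 ≤ I := integral_nonneg fun t => sq_nonneg t
  set N := ∫ q : ℝ × ℝ, (1 + q.1 ^ 2 + q.2 ^ 2) ∂ν with hN
  have hN0 : 0 ≤ N := integral_nonneg fun q => by positivity
  have hNeq : N = 1 + I + 1 := by
    rw [hN, integral_add, integral_add, hν]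
    · rw [integral_fun_fst (μ := μβ) (ν := gaussianReal 0 1) (fun t => t ^ 2), integral_fun_snd (μ := μβ) (ν := gaussianReal 0 1) (fun t => t ^ 2), mom2]
      simp [I]
    · exact integrable_const _
    · exact hβ2int.comp_fst (gaussianReal 0 1)
    · exact (integrable_const _).add (hβ2int.comp_fst (gaussianReal 0 1))
    · exact (integrable_pow_gauss 2).comp_snd μβ
  have hlim : Tendsto (fun p => (∑ i, (1 + β p i ^ 2 + h p i ^ 2)) / (p : ℝ)) atTop (𝓝 N) := by
    rw [hNeq]
    have h1 := ((tendsto_const_nhds (x := (1:ℝ))).add hβ2).add hh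
    refine h1.congr' ?_
    filter_upwards [eventually_gt_atTop 0] with p hp
    have : (p : ℝ) ≠ 0 := by positivity
    simp only [Finset.sum_add_distrib, Finset.sum_const, Finset.card_univ, Fintype.card_fin, nsmul_eq_mul, mul_one, add_div]
    rw [div_self this]
  have hall : ∀ (s : Bool) (a b : ℝ), Tendsto (fun p => (∑ i, phiB s (a * β p i + b * h p i)) / (p : ℝ)) atTop
      (𝓝 (∫ q, phiB s (a * q.1 + b * q.2) ∂ν)) := by
    intro s
    have hpt : ∀ (a b a' b' x y : ℝ), |phiB s (a * x + b * y) - phiB s (a' * x + b' * y)| ≤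
        (|a - a'| + |b - b'|) * (1 + x ^ 2 + y ^ 2) := by
      intro a b a' b' x y
      refine (phiB_lip s _ _).trans ?_
      have e : a * x + b * y - (a' * x + b' * y) = (a - a') * x + (b - b') * y := by ring
      rw [e]
      refine (abs_add_le _ _).trans ?_
      rw [abs_mul, abs_mul]
      have hx : |x| ≤ 1 + x ^ 2 + y ^ 2 := by
        nlinarith [sq_abs x, sq_nonneg (|x| - 1), sq_nonneg y]
      have hy : |y| ≤ 1 + x ^ 2 + y ^ 2 := by
        nlinarith [sq_abs y, sq_nonneg (|y| - 1), sq_nonneg x]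
      nlinarith [abs_nonneg (a - a'), abs_nonneg (b - b')]
    refine dense_ext (fun p a b => (∑ i, phiB s (a * β p i + b * h p i)) / (p : ℝ))
      (fun a b => ∫ q, phiB s (a * q.1 + b * q.2) ∂ν) (M := N + 1) (by linarith) ?_ ?_ (hφ s)
    · filter_upwards [hlim.eventually (gt_mem_nhds (show N < N + 1 by linarith))] with p hp a b a' b'
      rw [← sub_div, ← Finset.sum_sub_distrib, abs_div, abs_of_nonneg (Nat.cast_nonneg p : (0:ℝ) ≤ p)]
      calc |∑ i, (phiB s (a * β p i + b * h p i) - phiB s (a' * β p i + b' * h p i))| / p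
          ≤ (∑ i, (|a - a'| + |b - b'|) * (1 + β p i ^ 2 + h p i ^ 2)) / p := by
            gcongr
            exact (Finset.abs_sum_le_sum_abs _ _).trans (Finset.sum_le_sum fun i _ => hpt _ _ _ _ _ _)
        _ = ((∑ i, (1 + β p i ^ 2 + h p i ^ 2)) / p) * (|a - a'| + |b - b'|) := by
            rw [← Finset.mul_sum]; ring
        _ ≤ (N + 1) * (|a - a'| + |b - b'|) := by gcongr
    · intro a b a' b'
      have hpi : ∀ a b : ℝ, Integrable (fun q : ℝ × ℝ => phiB s (a * q.1 + b * q.2)) ν := by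
        intro a b
        have := phiB_cont s
        exact Integrable.of_bound (C := 1) (by fun_prop) (Eventually.of_forall fun q => phiB_le s _)
      rw [← integral_sub (hpi a b) (hpi a' b')]
      refine (abs_integral_le_integral_abs).trans ?_
      calc _ ≤ ∫ q : ℝ × ℝ, (|a - a'| + |b - b'|) * (1 + q.1 ^ 2 + q.2 ^ 2) ∂ν := by
            apply integral_mono ((hpi a b).sub (hpi a' b')).abs (hqi.const_mul _)
            intro q
            exact hpt _ _ _ _ _ _
        _ = N * (|a - a'| + |b - b'|) := by rw [integral_const_mul]; ring
        _ ≤ _ := by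
            have := abs_nonneg (a - a'); have := abs_nonneg (b - b'); nlinarith
  intro f hf ⟨C, hC⟩
  refine avg_quad β h ν (levy2 β h ν (hall true) (hall false)) hqi hlim hf hC

set_option linter.unusedSectionVars false

lemma n_atTop {δ : ℝ} (hδ : 0 < δ) {n : ℕ → ℕ} (hn : Tendsto (fun p => (n p : ℝ) / (p : ℝ)) atTop (𝓝 δ)) :
    Tendsto n atTop atTop := by
  rw [← tendsto_natCast_atTop_iff (R := ℝ)]
  have h1 := hn.pos_mul_atTop hδ tendsto_natCast_atTop_atTop
  refine h1.congr' ?_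
  filter_upwards [eventually_gt_atTop 0] with p hp
  have : (p : ℝ) ≠ 0 := by positivity
  field_simp

noncomputable def bigT {n : ℕ → ℕ} (β : (p : ℕ) → Fin p → ℝ) (w : (p : ℕ) → Fin (n p) → ℝ) (μβ : Measure ℝ) :
    (Fin 3 ⊕ (Bool × ℚ × ℚ)) → (p : ℕ) → (Fin (n p) → ℝ) × (Fin p → ℝ) → ℝ
  | Sum.inl 0, p, q => (∑ i, (q.2 i) ^ 2) / (p : ℝ) - 1
  | Sum.inl 1, p, q => (∑ i, (q.1 i) ^ 2) / (n p : ℝ) - 1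
  | Sum.inl 2, p, q => (∑ i, w p i * q.1 i) / (n p : ℝ) - 0
  | Sum.inr (s, a, b), p, q => (∑ i, phiB s (a * β p i + b * q.2 i)) / (p : ℝ) -
      ∫ q, phiB s (a * q.1 + b * q.2) ∂(μβ.prod (gaussianReal 0 1))

lemma prod_snd {n p : ℕ} (S : Set (Fin p → ℝ)) :
    ((gam (Fin n)).prod (gam (Fin p))) {q | q.2 ∈ S} = gam (Fin p) S := by
  have : {q : (Fin n → ℝ) × (Fin p → ℝ) | q.2 ∈ S} = Set.univ ×ˢ S := by ext; simp
  rw [this, Measure.prod_prod, measure_univ, one_mul]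

lemma prod_fst {n p : ℕ} (S : Set (Fin n → ℝ)) :
    ((gam (Fin n)).prod (gam (Fin p))) {q | q.1 ∈ S} = gam (Fin n) S := by
  have : {q : (Fin n → ℝ) × (Fin p → ℝ) | q.1 ∈ S} = S ×ˢ Set.univ := by ext; simp
  rw [this, Measure.prod_prod, measure_univ, mul_one]

theorem thmGood {δ σw : ℝ} (hδ : 0 < δ) {n : ℕ → ℕ}
    (hn : Tendsto (fun p => (n p : ℝ) / (p : ℝ)) atTop (𝓝 δ))
    {β : (p : ℕ) → Fin p → ℝ} {w : (p : ℕ) → Fin (n p) → ℝ} {μβ : Measure ℝ} [IsProbabilityMeasure μβ]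
    (hβconv : EmpConverges β μβ)
    (hβ2int : Integrable (fun t => t ^ 2) μβ)
    (hβ2 : Tendsto (fun p => (∑ i, (β p i) ^ 2) / (p : ℝ)) atTop (𝓝 (∫ t, t ^ 2 ∂μβ)))
    (hw2 : Tendsto (fun p => (∑ i, (w p i) ^ 2) / (n p : ℝ)) atTop (𝓝 (σw ^ 2))) :
    (∃ (g : (p : ℕ) → Fin (n p) → ℝ) (h : (p : ℕ) → Fin p → ℝ), GoodG w g ∧ GoodH β μβ h) ∧
    ∀ Bad : (p : ℕ) → Set ((Fin (n p) → ℝ) × (Fin p → ℝ)),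
      (∀ (g : (p : ℕ) → Fin (n p) → ℝ) (h : (p : ℕ) → Fin p → ℝ), GoodG w g → GoodH β μβ h →
        ∀ᶠ p in atTop, (g p, h p) ∉ Bad p) →
      Tendsto (fun p => ((gam (Fin (n p))).prod (gam (Fin p))) (Bad p)) atTop (𝓝 0) := by
  have hnt := n_atTop hδ hn
  have hT : ∀ k, ∀ ε : ℝ, 0 < ε → Tendsto (fun p => ((gam (Fin (n p))).prod (gam (Fin p)))
      {ω | ε ≤ |bigT β w μβ k p ω|}) atTop (𝓝 0) := by
    rintro (k | ⟨s, a, b⟩) ε hε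
    · fin_cases k
      · have h1 := lln_tendsto (fun p => p) tendsto_id (fun p _ t => t ^ 2) (fun _ _ => memLp_sq_gauss)
          (C := ∫ t, (t ^ 2) ^ 2 ∂gaussianReal 0 1) (c := 1)
          (Eventually.of_forall fun p => by simp [mul_comm])
          (by
            refine tendsto_const_nhds.congr' ?_
            filter_upwards [eventually_gt_atTop 0] with p hp
            have : (p : ℝ) ≠ 0 := by positivity
            simp [mom2, this]) hε
        refine h1.congr fun p => ?_
        rw [← prod_snd (n := n p)]; rfl
      · have h1 := lln_tendsto n hnt (fun p _ t => t ^ 2) (fun _ _ => memLp_sq_gauss)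
          (C := ∫ t, (t ^ 2) ^ 2 ∂gaussianReal 0 1) (c := 1)
          (Eventually.of_forall fun p => by simp [mul_comm])
          (by
            refine tendsto_const_nhds.congr' ?_
            filter_upwards [hnt.eventually (eventually_gt_atTop 0)] with p hp
            have : (n p : ℝ) ≠ 0 := by positivity
            simp [mom2, this]) hε
        refine h1.congr fun p => ?_
        rw [← prod_fst (p := p)]; rfl
      · have h1 := lln_tendsto n hnt (fun p i t => w p i * t) (fun _ _ => (memLp_id_gauss 2 (by simp)).const_mul _)
          (C := σw ^ 2 + 1) (c := 0)
          (by
            filter_upwards [hw2.eventually (gt_mem_nhds (lt_add_one _)), hnt.eventually (eventually_gt_atTop 0)] with p hp hp2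
            have : (0 : ℝ) < n p := by positivity
            rw [div_lt_iff₀ this] at hp
            show ∑ i, ∫ t, (w p i * t) ^ 2 ∂gaussianReal 0 1 ≤ (σw ^ 2 + 1) * n p
            simp only [mul_pow, integral_const_mul, mom2, mul_one]
            exact hp.le)
          (by
            refine (tendsto_const_nhds (x := (0:ℝ))).congr fun p => ?_
            have h0 : ∫ t, t ∂gaussianReal 0 1 = 0 := by simp
            show (0:ℝ) = (∑ i, ∫ t, w p i * t ∂gaussianReal 0 1) / (n p : ℝ)
            have h3 : ∀ i, ∫ t, w p i * t ∂gaussianReal 0 1 = 0 := fun i => by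
              rw [integral_const_mul (w p i) (fun t => t), h0, mul_zero]
            rw [Finset.sum_eq_zero fun i _ => h3 i, zero_div]) hε
        refine h1.congr fun p => ?_
        rw [← prod_fst (p := p)]; rfl
    · have hcs := phiB_cont s
      have hintg : ∀ x : ℝ, Integrable (fun z => phiB s (a * x + b * z)) (gaussianReal 0 1) := fun x =>
        Integrable.of_bound (C := 1) (by fun_prop) (Eventually.of_forall fun q => phiB_le s _)
      let f : BoundedContinuousFunction ℝ ℝ := BoundedContinuousFunction.ofNormedAddCommGroup
        (fun x => ∫ z, phiB s (a * x + b * z) ∂gaussianReal 0 1)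
        (by
          refine continuous_of_dominated (bound := fun _ => 1) (fun x => (hintg x).aestronglyMeasurable)
            (fun x => Eventually.of_forall fun z => phiB_le s _) (integrable_const _)
            (Eventually.of_forall fun z => by fun_prop)) 1
        (fun x => by
          refine (norm_integral_le_of_norm_le_const (C := 1) (Eventually.of_forall fun z => phiB_le s _)).trans ?_
          simp)
      have hf := hβconv f
      have e : ∫ q, phiB s (a * q.1 + b * q.2) ∂(μβ.prod (gaussianReal 0 1)) = ∫ t, f t ∂μβ := by
        rw [integral_prod]
        · rfl
        · exact Integrable.of_bound (C := 1) (by fun_prop) (Eventually.of_forall fun q => phiB_le s _)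
      have h1 := lln_tendsto (fun p => p) tendsto_id (fun p i z => phiB s (a * β p i + b * z))
          (fun p i => MemLp.of_bound (hintg _).aestronglyMeasurable 1 (Eventually.of_forall fun q => phiB_le s _))
          (C := 1) (c := ∫ t, f t ∂μβ)
          (Eventually.of_forall fun p => by
            have : ∀ i : Fin p, ∫ z, phiB s (a * β p i + b * z) ^ 2 ∂gaussianReal 0 1 ≤ 1 := by
              intro i
              have h2 := norm_integral_le_of_norm_le_const (μ := gaussianReal 0 1) (f := fun z => phiB s (a * β p i + b * z) ^ 2)
                (C := 1) (Eventually.of_forall fun z => by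
                  rw [Real.norm_eq_abs, abs_pow]; exact pow_le_one₀ (abs_nonneg _) (phiB_le s _))
              rw [probReal_univ, mul_one] at h2
              exact (le_abs_self _).trans h2
            calc _ ≤ ∑ i : Fin p, (1 : ℝ) := Finset.sum_le_sum fun i _ => this i
              _ = _ := by simp)
          hf hε
      refine h1.congr fun p => ?_
      rw [← prod_snd (n := n p)]
      show _ = ((gam (Fin (n p))).prod (gam (Fin p))) {ω | ε ≤ |(∑ i, phiB s (a * β p i + b * ω.2 i)) / (p : ℝ) -
      ∫ q, phiB s (a * q.1 + b * q.2) ∂(μβ.prod (gaussianReal 0 1))|}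
      rw [e]; rfl
  have hgood : ∀ ω : (p : ℕ) → (Fin (n p) → ℝ) × (Fin p → ℝ),
      (∀ k, Tendsto (fun p => bigT β w μβ k p (ω p)) atTop (𝓝 0)) ↔
      (GoodG w (fun p => (ω p).1) ∧ GoodH β μβ (fun p => (ω p).2)) := by
    intro ω
    constructor
    · intro hk
      have h0 := hk (Sum.inl 0)
      have h1 := hk (Sum.inl 1)
      have h2 := hk (Sum.inl 2)
      simp only [bigT] at h0 h1 h2
      refine ⟨⟨tendsto_sub_nhds_zero_iff.1 h1, tendsto_sub_nhds_zero_iff.1 h2⟩,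
        goodH_of hβ2int hβ2 (tendsto_sub_nhds_zero_iff.1 h0) fun s a b => ?_⟩
      have h3 := hk (Sum.inr (s, a, b))
      simp only [bigT] at h3
      exact tendsto_sub_nhds_zero_iff.1 h3
    · rintro ⟨⟨g1, g2⟩, hh⟩ (k | ⟨s, a, b⟩)
      · fin_cases k
        · have := hh (fun q => q.2 ^ 2) (by fun_prop) ⟨1, fun q => by
            rw [abs_of_nonneg (sq_nonneg _)]; nlinarith [sq_nonneg q.1]⟩
          rw [integral_fun_snd (μ := μβ) (ν := gaussianReal 0 1) (fun t => t ^ 2), mom2] at this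
          simp only [probReal_univ, one_smul] at this
          exact tendsto_sub_nhds_zero_iff.2 this
        · exact tendsto_sub_nhds_zero_iff.2 g1
        · exact tendsto_sub_nhds_zero_iff.2 g2
      · have hcs := phiB_cont s
        have := hh (fun q => phiB s (a * q.1 + b * q.2)) (by fun_prop) ⟨1, fun q =>
          (phiB_le s _).trans (by nlinarith [sq_nonneg q.1, sq_nonneg q.2])⟩
        exact tendsto_sub_nhds_zero_iff.2 this
  obtain ⟨⟨ω, hω⟩, t2⟩ := transfer (fun p => (gam (Fin (n p))).prod (gam (Fin p))) (bigT β w μβ) hT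
  refine ⟨⟨_, _, (hgood ω).1 hω⟩, fun Bad hBad => t2 Bad fun ω hω => ?_⟩
  obtain ⟨a, b⟩ := (hgood ω).1 hω
  exact hBad _ _ a b

set_option linter.unusedSectionVars false

section fp
variable {p : ℕ} {lam β h : Fin p → ℝ} {σw N : ℝ}

noncomputable def Sx (σw N : ℝ) (β x : Fin p → ℝ) : ℝ := Real.sqrt (σw ^ 2 + nrm (x - β) ^ 2 / N)
noncomputable def Fl (σw N : ℝ) (β h x : Fin p → ℝ) : ℝ := Sx σw N β x - (h ⬝ᵥ (x - β)) / N
noncomputable def ell (σw N : ℝ) (lam β h x : Fin p → ℝ) : ℝ :=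
  (1 / 2) * (max 0 (Fl σw N β h x)) ^ 2 + sortedL1 lam x / N

lemma Sx_sq (hN : 0 < N) (x : Fin p → ℝ) : Sx σw N β x ^ 2 = σw ^ 2 + nrm (x - β) ^ 2 / N :=
  Real.sq_sqrt (by positivity)

lemma Sx_ge (hσ : 0 < σw) (hN : 0 < N) (x : Fin p → ℝ) : σw ≤ Sx σw N β x :=
  Real.le_sqrt_of_sq_le (by have : 0 ≤ nrm (x - β) ^ 2 / N := by positivity
                            linarith)

lemma Sx_ge' (hN : 0 < N) (x : Fin p → ℝ) : nrm (x - β) / Real.sqrt N ≤ Sx σw N β x :=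
  Real.le_sqrt_of_sq_le (by rw [div_pow, Real.sq_sqrt hN.le]; nlinarith [sq_nonneg σw])

lemma sqrt_lip (a b c : ℝ) : Real.sqrt (a ^ 2 + b ^ 2) ≤ Real.sqrt (a ^ 2 + c ^ 2) + |b - c| := by
  rw [Real.sqrt_le_iff]
  refine ⟨by positivity, ?_⟩
  have h1 : |c| ≤ Real.sqrt (a ^ 2 + c ^ 2) := Real.abs_le_sqrt (by nlinarith [sq_nonneg a])
  have h2 : Real.sqrt (a ^ 2 + c ^ 2) ^ 2 = a ^ 2 + c ^ 2 := Real.sq_sqrt (by positivity)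
  have h3 : (b - c) * c ≤ |b - c| * |c| := by rw [← abs_mul]; exact le_abs_self _
  nlinarith [sq_abs (b - c), abs_nonneg (b - c), mul_le_mul_of_nonneg_left h1 (abs_nonneg (b - c))]

lemma Sx_lip (hN : 0 < N) (x y : Fin p → ℝ) : Sx σw N β x ≤ Sx σw N β y + nrm (x - y) / Real.sqrt N := by
  have h1 : ∀ z : Fin p → ℝ, nrm (z - β) ^ 2 / N = (nrm (z - β) / Real.sqrt N) ^ 2 := fun z => by
    rw [div_pow, Real.sq_sqrt hN.le]
  have h2 := sqrt_lip σw (nrm (x - β) / Real.sqrt N) (nrm (y - β) / Real.sqrt N)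
  rw [← h1, ← h1] at h2
  refine h2.trans ?_
  unfold Sx
  rw [← sub_div, abs_div, abs_of_nonneg (Real.sqrt_nonneg N)]
  gcongr
  have := abs_nrm_sub_le (x - β) (y - β)
  simpa using this

lemma continuous_Fl : Continuous (Fl σw N β h : (Fin p → ℝ) → ℝ) := by
  unfold Fl Sx dotProduct
  have := continuous_nrm (ι := Fin p)
  fun_prop

lemma continuous_ell (h0 : ∀ i, 0 ≤ lam i) (hl : Monotone lam) : Continuous (ell σw N lam β h) := by
  unfold ell
  have := continuous_Fl (σw := σw) (N := N) (β := β) (h := h)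
  have := continuous_sortedL1 h0 hl
  fun_prop

lemma nrm_le_l1 (x : Fin p → ℝ) : nrm x ≤ ∑ i, |x i| := by
  refine nrm_le_of_sq_le (Finset.sum_nonneg fun i _ => abs_nonneg _) ?_
  rw [← nrm_sq, nrm_sq']
  have := Finset.sum_sq_le_sq_sum_of_nonneg (s := Finset.univ) (f := fun i => |x i|) (fun i _ => abs_nonneg _)
  simpa using this

lemma ell_min (hN : 0 < N) (h0 : ∀ i, 0 ≤ lam i) (hl : Monotone lam) (hpos : 0 < ∑ i, lam i) :
    ∃ x, ∀ z, ell σw N lam β h x ≤ ell σw N lam β h z := by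
  set R := p * (N * ell σw N lam β h 0) / ∑ i, lam i with hR
  have hl0 : 0 ≤ ell σw N lam β h 0 := by
    unfold ell
    have := sortedL1_nonneg h0 (0 : Fin p → ℝ)
    positivity
  obtain ⟨x, hx, hmin⟩ := (isCompact_nrm_ball (ι := Fin p) R).exists_isMinOn ⟨0, by
    simp only [Set.mem_ofPred_eq, nrm_zero]; positivity⟩ (continuous_ell (σw := σw) (N := N) (β := β) (h := h) h0 hl).continuousOn
  refine ⟨x, fun z => ?_⟩
  by_cases hz : nrm z ≤ R
  · exact hmin hz
  · have h1 : ell σw N lam β h x ≤ ell σw N lam β h 0 := hmin (by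
      simp only [Set.mem_ofPred_eq, nrm_zero]; positivity)
    refine h1.trans ?_
    by_contra hc
    push Not at hc
    apply hz
    rw [hR, le_div_iff₀ hpos]
    have h2 := sortedL1_ge_mean hl z
    have h3 : sortedL1 lam z / N ≤ ell σw N lam β h z := by
      unfold ell
      nlinarith [sq_nonneg (max 0 (Fl σw N β h z))]
    rw [div_le_iff₀ hN] at h3
    have h4 := nrm_le_l1 z
    have h5 : sortedL1 lam z ≤ N * ell σw N lam β h 0 := by nlinarith
    have h6 : (p : ℝ) * sortedL1 lam z ≤ p * (N * ell σw N lam β h 0) := by gcongr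
    nlinarith

lemma max_sq_le {a b : ℝ} (h : a ≤ b) : (max 0 a) ^ 2 ≤ b ^ 2 := by
  rcases le_total a 0 with h1 | h1
  · rw [max_eq_left h1]; nlinarith [sq_nonneg b]
  · rw [max_eq_right h1]; nlinarith

lemma ell_shrink (hN : 0 < N) (hl : Monotone lam) {x : Fin p → ℝ}
    (hmin : ∀ z, ell σw N lam β h x ≤ ell σw N lam β h z) :
    sortedL1 lam x / N ≤ max 0 (Fl σw N β h x) * (nrm x / Real.sqrt N + nrm h * nrm x / N) := by
  set D := nrm x / Real.sqrt N + nrm h * nrm x / N with hD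
  have hD0 : 0 ≤ D := by have := nrm_nonneg x; have := nrm_nonneg h; positivity
  refine le_of_quad (c := D ^ 2 / 2) 1 one_pos fun t ht ht1 => ?_
  have h1 := hmin ((1 - t) • x)
  unfold ell at h1
  rw [sortedL1_smul hl, abs_of_nonneg (by linarith)] at h1
  have h2 : Fl σw N β h ((1 - t) • x) ≤ max 0 (Fl σw N β h x) + t * D := by
    have e : (1 - t) • x - x = -(t • x) := by module
    have h3 := Sx_lip (σw := σw) (β := β) hN ((1 - t) • x) x
    rw [e, nrm_neg, nrm_smul, abs_of_pos ht] at h3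
    have h4 : h ⬝ᵥ ((1 - t) • x - β) = h ⬝ᵥ (x - β) - t * (h ⬝ᵥ x) := by
      have : (1 - t) • x - β = (x - β) - t • x := by module
      rw [this, dotProduct_sub, dotProduct_smul, smul_eq_mul]
    have h5 := dot_le h x
    have h6 : (t * (h ⬝ᵥ x)) / N ≤ t * (nrm h * nrm x / N) := by
      rw [mul_div_assoc]; gcongr
    have h7 := le_max_right 0 (Fl σw N β h x)
    have h8 : Fl σw N β h ((1 - t) • x) ≤ Fl σw N β h x + t * D := by
      unfold Fl
      rw [h4, sub_div, hD]
      rw [mul_div_assoc] at h3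
      linarith
    linarith
  have h3 := max_sq_le h2
  have h4 : (1 - t) * sortedL1 lam x / N = sortedL1 lam x / N - t * (sortedL1 lam x / N) := by ring
  rw [h4] at h1
  nlinarith

lemma ell_prox (hσ : 0 < σw) (hN : 0 < N) (h0 : ∀ i, 0 ≤ lam i) (hl : Monotone lam) {x : Fin p → ℝ}
    (hmin : ∀ z, ell σw N lam β h x ≤ ell σw N lam β h z) (hF : 0 < Fl σw N β h x) :
    slopeProx (fun i => Sx σw N β x / Fl σw N β h x * lam i) (β + Sx σw N β x • h) = x := by
  have hS : 0 < Sx σw N β x := hσ.trans_le (Sx_ge hσ hN x)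
  set S := Sx σw N β x with hSdef
  set F := Fl σw N β h x with hFdef
  have hτ : 0 < S / F := div_pos hS hF
  apply slopeProx_unique (fun i => mul_nonneg hτ.le (h0 i)) (hl.const_mul hτ.le)
  intro z
  rw [sortedL1_lam_smul, sortedL1_lam_smul]
  set d := z - x with hd
  set G := ((x - β) ⬝ᵥ d) / (N * S) - (h ⬝ᵥ d) / N with hG
  set c := nrm d ^ 2 / (2 * N * S) with hc
  have key : -(F * G) ≤ (sortedL1 lam z - sortedL1 lam x) / N := by
    refine le_of_quad (c := F * c + (1/2) * (|G| + |c|) ^ 2) 1 one_pos fun t ht ht1 => ?_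
    have h1 := hmin (x + t • d)
    have h2 := sortedL1_convex h0 hl x z ht.le ht1
    rw [← hd] at h2
    have h2' : sortedL1 lam (x + t • d) / N ≤ sortedL1 lam x / N + t * ((sortedL1 lam z - sortedL1 lam x) / N) := by
      rw [← mul_div_assoc, ← add_div]; gcongr
    have e1 : x + t • d - β = (x - β) + t • d := by module
    have e2 : nrm (x + t • d - β) ^ 2 = nrm (x - β) ^ 2 + 2 * t * ((x - β) ⬝ᵥ d) + t ^ 2 * nrm d ^ 2 := by
      rw [e1, nrm_sq, nrm_sq, nrm_sq]
      simp only [dotProduct_add, add_dotProduct, dotProduct_smul, smul_dotProduct, smul_eq_mul]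
      rw [dotProduct_comm d (x - β)]
      ring
    have h3 : Sx σw N β (x + t • d) ≤ S + t * (((x - β) ⬝ᵥ d) / (N * S)) + t ^ 2 * c := by
      have h4 := Sx_sq (σw := σw) (β := β) hN (x + t • d)
      have h5 := Sx_sq (σw := σw) (β := β) hN x
      rw [e2] at h4
      rw [← hSdef] at h5
      have h6 : Sx σw N β (x + t • d) ^ 2 = S ^ 2 + 2 * S * (t * (((x - β) ⬝ᵥ d) / (N * S)) + t ^ 2 * c) := by
        rw [h4, h5, hc]; field_simp; ring
      nlinarith [sq_nonneg (Sx σw N β (x + t • d) - S)]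
    have h4 : Fl σw N β h (x + t • d) ≤ F + (t * G + t ^ 2 * c) := by
      rw [hFdef]
      unfold Fl
      rw [e1, dotProduct_add, dotProduct_smul, smul_eq_mul, add_div, ← hSdef, hG]
      have : t * (h ⬝ᵥ d) / N = t * ((h ⬝ᵥ d) / N) := by ring
      rw [this]
      linarith
    have h5 := max_sq_le h4
    unfold ell at h1
    rw [← hFdef, max_eq_right hF.le] at h1
    have h6 : (t * G + t ^ 2 * c) ^ 2 ≤ t ^ 2 * (|G| + |c|) ^ 2 := by
      have : t * G + t ^ 2 * c = t * (G + t * c) := by ring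
      rw [this, mul_pow]
      gcongr ?_ * ?_
      apply sq_le_sq'
      · have := neg_abs_le G
        have : -|c| ≤ t * c := by nlinarith [neg_abs_le c, abs_nonneg c]
        linarith
      · have := le_abs_self G
        have : t * c ≤ |c| := by nlinarith [le_abs_self c, abs_nonneg c]
        linarith
    nlinarith
  have e3 : (β + S • h - x) ⬝ᵥ d = - (N * S) * G := by
    have : β + S • h - x = S • h - (x - β) := by module
    rw [this, sub_dotProduct, smul_dotProduct, smul_eq_mul, hG]
    field_simp
    ring
  rw [e3]
  have h7 : S / F * sortedL1 lam z - S / F * sortedL1 lam x = (N * S / F) * ((sortedL1 lam z - sortedL1 lam x) / N) := by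
    field_simp
  rw [h7]
  calc -(N * S) * G = (N * S / F) * (-(F * G)) := by field_simp
    _ ≤ _ := by gcongr

lemma ell_bound (hσ : 0 < σw) (hN : 0 < N) {Cb Ch Cl l0 M M' ε' E R : ℝ}
    (hl : Monotone lam) (h0 : ∀ i, 0 ≤ lam i) {x : Fin p → ℝ}
    (hmin : ∀ z, ell σw N lam β h x ≤ ell σw N lam β h z)
    (hCb0 : 0 ≤ Cb) (hCh0 : 0 ≤ Ch) (hCl0 : 0 ≤ Cl) (hM : 0 ≤ M) (hM' : 0 ≤ M')
    (hb : nrm β ≤ Cb * Real.sqrt N) (hh : nrm h ≤ Ch * Real.sqrt N) (hlm : nrm lam ≤ Cl * Real.sqrt N)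
    (hl0 : 0 < l0) (hJ : ∀ x, l0 * ∑ i, |x i| ≤ sortedL1 lam x)
    (htail : ∀ x, |h ⬝ᵥ x| ≤ M * ∑ i, |x i| + 1 / 2 * Real.sqrt N * nrm x)
    (htail' : ∀ x, |h ⬝ᵥ x| ≤ M' * ∑ i, |x i| + ε' * Real.sqrt N * nrm x)
    (hE : E = 1 / 2 * σw ^ 2 + Cl * Cb) (hR : R = 2 * (E + 1 / 2 + M * (E / l0) + Ch * Cb + Cb))
    (hε0 : 0 ≤ ε') (hε' : ε' * R ≤ σw / 4) (hhb : |h ⬝ᵥ β| / N ≤ σw / 4) :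
    nrm x ≤ R * Real.sqrt N ∧
      σw / 2 / (1 + M' * (R + Ch * R) / l0) ≤ Fl σw N β h x ∧ Fl σw N β h x ≤ E + 1 / 2 := by
  set r := Real.sqrt N with hr
  have hr0 : 0 < r := Real.sqrt_pos.2 hN
  have hrN : r * r = N := Real.mul_self_sqrt hN.le
  have hE0 : 0 ≤ E := by rw [hE]; positivity
  have hellb : ell σw N lam β h β ≤ E := by
    unfold ell Fl Sx
    rw [sub_self, nrm_zero, dotProduct_zero]
    have h1 : sortedL1 lam β / N ≤ Cl * Cb := by
      rw [div_le_iff₀ hN]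
      calc sortedL1 lam β ≤ nrm lam * nrm β := sortedL1_le β
        _ ≤ (Cl * r) * (Cb * r) := by have := nrm_nonneg β; gcongr
        _ = _ := by rw [← hrN]; ring
    have h2 : Real.sqrt (σw ^ 2 + 0 ^ 2 / N) = σw := by
      rw [zero_pow two_ne_zero, zero_div, add_zero, Real.sqrt_sq hσ.le]
    rw [h2, zero_div, sub_zero, max_eq_right hσ.le, hE]
    linarith
  have hx := (hmin β).trans hellb
  unfold ell at hx
  set F := Fl σw N β h x with hFdef
  have hJ0 : 0 ≤ sortedL1 lam x / N := div_nonneg (sortedL1_nonneg h0 x) hN.le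
  have hFE : F ≤ E + 1 / 2 := by
    have := le_max_right 0 F
    nlinarith [sq_nonneg (max 0 F - 1)]
  have hJE : sortedL1 lam x / N ≤ E := by nlinarith [sq_nonneg (max 0 F)]
  have hl1 : (∑ i, |x i|) / N ≤ (sortedL1 lam x / N) / l0 := by
    rw [le_div_iff₀ hl0, div_mul_eq_mul_div]
    gcongr
    have := hJ x; linarith
  have hl1E : (∑ i, |x i|) / N ≤ E / l0 := hl1.trans (by gcongr)
  have hxn : nrm x / r ≤ R := by
    have h1 := Sx_ge' (σw := σw) (β := β) hN x
    have h2 : Sx σw N β x = F + (h ⬝ᵥ (x - β)) / N := by rw [hFdef]; unfold Fl; ring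
    have h3 : (h ⬝ᵥ (x - β)) / N ≤ M * (E / l0) + 1 / 2 * (nrm x / r) + Ch * Cb := by
      rw [dotProduct_sub]
      have h4 : h ⬝ᵥ x ≤ M * ∑ i, |x i| + 1 / 2 * r * nrm x := (le_abs_self _).trans (htail x)
      have h5 : -(h ⬝ᵥ β) ≤ (Ch * r) * (Cb * r) := by
        refine (neg_le_abs _).trans ((dot_abs_le h β).trans ?_)
        have := nrm_nonneg β; gcongr
      calc (h ⬝ᵥ x - h ⬝ᵥ β) / N ≤ (M * ∑ i, |x i| + 1 / 2 * r * nrm x + (Ch * r) * (Cb * r)) / N := by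
            gcongr; linarith
        _ = M * ((∑ i, |x i|) / N) + 1 / 2 * (nrm x / r) + Ch * Cb := by rw [← hrN]; field_simp
        _ ≤ _ := by gcongr
    have h6 : nrm x / r ≤ nrm (x - β) / r + Cb := by
      rw [div_add' _ _ _ hr0.ne']
      gcongr
      have := nrm_add_le (x - β) β
      rw [sub_add_cancel] at this
      linarith
    rw [hR]
    linarith
  have hR0 : 0 ≤ R := le_trans (div_nonneg (nrm_nonneg x) hr0.le) hxn
  refine ⟨by rwa [div_le_iff₀ hr0] at hxn, ?_, hFE⟩
  have hsh := ell_shrink hN hl hmin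
  rw [← hFdef, ← hr] at hsh
  have hD : nrm x / r + nrm h * nrm x / N ≤ R + Ch * R := by
    have : nrm h * nrm x / N = (nrm h / r) * (nrm x / r) := by rw [← hrN]; field_simp
    rw [this]
    have h1 : nrm h / r ≤ Ch := by rwa [div_le_iff₀ hr0]
    have := div_nonneg (nrm_nonneg x) hr0.le
    gcongr
  have hm0 : 0 ≤ max 0 F := le_max_left _ _
  have hJ2 : sortedL1 lam x / N ≤ max 0 F * (R + Ch * R) := hsh.trans (by gcongr)
  have hlow : σw / 2 - M' * (R + Ch * R) / l0 * max 0 F ≤ F := by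
    have h1 := Sx_ge (β := β) hσ hN x
    have h2 : F = Sx σw N β x - (h ⬝ᵥ x) / N + (h ⬝ᵥ β) / N := by
      rw [hFdef]; unfold Fl; rw [dotProduct_sub]; ring
    have h3 : -(σw / 4) ≤ (h ⬝ᵥ β) / N := by
      have := neg_abs_le (h ⬝ᵥ β)
      have h4 : -(|h ⬝ᵥ β| / N) ≤ (h ⬝ᵥ β) / N := by rw [← neg_div]; gcongr
      linarith
    have h4 : (h ⬝ᵥ x) / N ≤ M' * (R + Ch * R) / l0 * max 0 F + σw / 4 := by
      calc (h ⬝ᵥ x) / N ≤ (M' * ∑ i, |x i| + ε' * r * nrm x) / N := by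
            gcongr; exact (le_abs_self _).trans (htail' x)
        _ = M' * ((∑ i, |x i|) / N) + ε' * (nrm x / r) := by rw [← hrN]; field_simp
        _ ≤ M' * ((max 0 F * (R + Ch * R)) / l0) + ε' * R := by
            have hl2 : (∑ i, |x i|) / N ≤ (max 0 F * (R + Ch * R)) / l0 := hl1.trans (by gcongr)
            exact add_le_add (mul_le_mul_of_nonneg_left hl2 hM') (mul_le_mul_of_nonneg_left hxn hε0)
        _ ≤ _ := by
            have : M' * ((max 0 F * (R + Ch * R)) / l0) = M' * (R + Ch * R) / l0 * max 0 F := by ring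
            linarith
    linarith
  have hκ : 0 ≤ M' * (R + Ch * R) / l0 := by positivity
  rw [div_le_iff₀ (by positivity)]
  rcases le_total F 0 with hF | hF
  · rw [max_eq_left hF] at hlow; linarith
  · rw [max_eq_right hF] at hlow; linarith

end fp

set_option linter.unusedSectionVars false

section
variable {β h : (p : ℕ) → Fin p → ℝ} {μβ : Measure ℝ} [IsProbabilityMeasure μβ]

lemma good_sq (hh : GoodH β μβ h) : Tendsto (fun p => (∑ i, (h p i) ^ 2) / (p : ℝ)) atTop (𝓝 1) := by
  have := hh (fun q => q.2 ^ 2) (by fun_prop) ⟨1, fun q => by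
    rw [abs_of_nonneg (sq_nonneg _)]; nlinarith [sq_nonneg q.1]⟩
  rw [integral_fun_snd (μ := μβ) (ν := gaussianReal 0 1) (fun t => t ^ 2), mom2] at this
  simpa only [probReal_univ, one_smul] using this

lemma int_cross : ∫ q : ℝ × ℝ, q.2 * q.1 ∂(μβ.prod (gaussianReal 0 1)) = 0 := by
  have h0 : ∫ t, t ∂gaussianReal 0 1 = 0 := by simp
  have := integral_prod_mul (μ := μβ) (ν := gaussianReal 0 1) (fun t : ℝ => t) (fun t : ℝ => t)
  rw [h0, mul_zero] at this
  refine Eq.trans ?_ this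
  exact integral_congr_ae (Eventually.of_forall fun q : ℝ × ℝ => mul_comm q.2 q.1)

lemma good_cross (hh : GoodH β μβ h) : Tendsto (fun p => (∑ i, h p i * β p i) / (p : ℝ)) atTop (𝓝 0) := by
  have := hh (fun q => q.2 * q.1) (by fun_prop) ⟨1, fun q => by
    rw [abs_le]; constructor <;> nlinarith [sq_nonneg (q.1 - q.2), sq_nonneg (q.1 + q.2)]⟩
  rwa [int_cross] at this

lemma tail_zero : Tendsto (fun M : ℕ => ∫ z, (max 0 (|z| - M)) ^ 2 ∂gaussianReal 0 1) atTop (𝓝 0) := by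
  suffices key : Tendsto (fun M : ℕ => ∫ z, (max 0 (|z| - M)) ^ 2 ∂gaussianReal 0 1) atTop
      (𝓝 (∫ z : ℝ, (0:ℝ) ∂gaussianReal 0 1)) by simpa using key
  refine tendsto_integral_of_dominated_convergence (fun z => z ^ 2) (fun M => by fun_prop)
    (integrable_pow_gauss 2) (fun M => Eventually.of_forall fun z => ?_) (Eventually.of_forall fun z => ?_)
  · rw [Real.norm_eq_abs, abs_of_nonneg (sq_nonneg _), ← sq_abs z]
    have h1 : max 0 (|z| - M) ≤ |z| := max_le (abs_nonneg z) (by have := Nat.cast_nonneg (α := ℝ) M; linarith)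
    have h2 : 0 ≤ max 0 (|z| - (M:ℝ)) := le_max_left _ _
    gcongr
  · refine tendsto_const_nhds.congr' ?_
    obtain ⟨N, hN⟩ := exists_nat_ge |z|
    filter_upwards [eventually_ge_atTop N] with M hM
    have : (N : ℝ) ≤ M := by exact_mod_cast hM
    rw [max_eq_left (by linarith)]; norm_num

lemma good_tail (hh : GoodH β μβ h) {ε : ℝ} (hε : 0 < ε) :
    ∃ M : ℝ, 0 ≤ M ∧ ∀ᶠ p : ℕ in atTop, ∀ x : Fin p → ℝ,
      |h p ⬝ᵥ x| ≤ M * ∑ i, |x i| + ε * Real.sqrt p * nrm x := by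
  obtain ⟨M, hM⟩ := (tail_zero.eventually (gt_mem_nhds (show (0:ℝ) < ε ^ 2 by positivity))).exists
  refine ⟨M, Nat.cast_nonneg M, ?_⟩
  have h1 := hh (fun q => (max 0 (|q.2| - M)) ^ 2) (by fun_prop) ⟨1, fun q => by
    rw [abs_of_nonneg (sq_nonneg _)]
    have h1 : max 0 (|q.2| - M) ≤ |q.2| := max_le (abs_nonneg _) (by have := Nat.cast_nonneg (α := ℝ) M; linarith)
    have h2 : 0 ≤ max 0 (|q.2| - (M:ℝ)) := le_max_left _ _
    nlinarith [sq_nonneg q.1, sq_abs q.2]⟩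
  rw [integral_fun_snd (μ := μβ) (ν := gaussianReal 0 1) (fun t => (max 0 (|t| - M)) ^ 2)] at h1
  simp only [probReal_univ, one_smul] at h1
  filter_upwards [h1.eventually (gt_mem_nhds hM), eventually_gt_atTop 0] with p hp hp0 x
  have hp0' : (0 : ℝ) < p := by exact_mod_cast hp0
  rw [div_lt_iff₀ hp0'] at hp
  have h2 := Real.sum_mul_le_sqrt_mul_sqrt Finset.univ (fun i => max 0 (|h p i| - (M:ℝ))) (fun i => |x i|)
  have h3 : Real.sqrt (∑ i, (max 0 (|h p i| - (M:ℝ))) ^ 2) ≤ ε * Real.sqrt p := by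
    rw [Real.sqrt_le_iff]
    refine ⟨by positivity, ?_⟩
    rw [mul_pow, Real.sq_sqrt hp0'.le]; exact hp.le
  have h4 : Real.sqrt (∑ i, |x i| ^ 2) = nrm x := by
    simp only [sq_abs]
    rw [← nrm_sq', Real.sqrt_sq (nrm_nonneg x)]
  rw [h4] at h2
  calc |h p ⬝ᵥ x| ≤ ∑ i, |h p i| * |x i| := by
        unfold dotProduct
        refine (Finset.abs_sum_le_sum_abs _ _).trans (le_of_eq (Finset.sum_congr rfl fun i _ => abs_mul _ _))
    _ ≤ ∑ i, (M * |x i| + max 0 (|h p i| - (M:ℝ)) * |x i|) := by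
        gcongr with i
        have := le_max_right 0 (|h p i| - (M:ℝ))
        nlinarith [abs_nonneg (x i)]
    _ = M * ∑ i, |x i| + ∑ i, max 0 (|h p i| - (M:ℝ)) * |x i| := by
        rw [Finset.sum_add_distrib, Finset.mul_sum]
    _ ≤ _ := by
        gcongr
        refine h2.trans ?_
        have := nrm_nonneg x
        gcongr

lemma eta_abs {η : ℝ → ℝ} (hodd : ∀ t, η (-t) = -η t)
    (hlip : ∀ t₁ t₂ : ℝ, t₂ ≤ t₁ → 0 ≤ η t₁ - η t₂ ∧ η t₁ - η t₂ ≤ t₁ - t₂) :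
    Continuous η ∧ ∀ t, |η t| ≤ |t| := by
  have hl : ∀ s t, |η s - η t| ≤ |s - t| := by
    intro s t
    rcases le_total t s with h | h
    · obtain ⟨a, b⟩ := hlip s t h
      rw [abs_of_nonneg a, abs_of_nonneg (by linarith)]; exact b
    · obtain ⟨a, b⟩ := hlip t s h
      rw [abs_sub_comm, abs_of_nonneg a, abs_sub_comm, abs_of_nonneg (by linarith)]; exact b
  have h0 : η 0 = 0 := by have := hodd 0; rw [neg_zero] at this; linarith
  refine ⟨?_, fun t => by simpa [h0] using hl t 0⟩
  refine (LipschitzWith.of_dist_le_mul (K := 1) fun s t => ?_).continuous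
  simpa [Real.dist_eq] using hl s t

lemma pl_lim (hh : GoodH β μβ h) {η : ℝ → ℝ} (hodd : ∀ t, η (-t) = -η t)
    (hlip : ∀ t₁ t₂ : ℝ, t₂ ≤ t₁ → 0 ≤ η t₁ - η t₂ ∧ η t₁ - η t₂ ≤ t₁ - t₂) (σ : ℝ)
    {φ : ℕ → ℕ} (hφ : Tendsto φ atTop atTop) (x : (k : ℕ) → Fin (φ k) → ℝ)
    (hx : Tendsto (fun k => (∑ i, (x k i - η (β (φ k) i + σ * h (φ k) i)) ^ 2) / (φ k : ℝ)) atTop (𝓝 0))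
    {Ψ : ℝ → ℝ → ℝ → ℝ} (hΨ : Continuous fun q : ℝ × ℝ × ℝ => Ψ q.1 q.2.1 q.2.2) {L C : ℝ} (hL0 : 0 ≤ L)
    (hL : ∀ a a' b z, |Ψ a b z - Ψ a' b z| ≤ L * (1 + |a| + |a'| + |b| + |z|) * |a - a'|)
    (hC0 : 0 ≤ C) (hC : ∀ a b z, |Ψ a b z| ≤ C * (1 + a ^ 2 + b ^ 2 + z ^ 2)) :
    Tendsto (fun k => (∑ i, Ψ (x k i) (β (φ k) i) (h (φ k) i)) / (φ k : ℝ)) atTop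
      (𝓝 (∫ q, Ψ (η (q.1 + σ * q.2)) q.1 q.2 ∂(μβ.prod (gaussianReal 0 1)))) := by
  obtain ⟨hηc, hηb⟩ := eta_abs hodd hlip
  have hη2 : ∀ b z, η (b + σ * z) ^ 2 ≤ (2 + 2 * σ ^ 2) * (1 + b ^ 2 + z ^ 2) := by
    intro b z
    have h1 : η (b + σ * z) ^ 2 ≤ (b + σ * z) ^ 2 := sq_le_sq.2 (hηb _)
    nlinarith [sq_nonneg (b - σ * z), sq_nonneg (σ * b), sq_nonneg z, sq_nonneg σ, sq_nonneg b]
  have hA := (hh (fun q => Ψ (η (q.1 + σ * q.2)) q.1 q.2)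
    (hΨ.comp (f := fun q : ℝ × ℝ => (η (q.1 + σ * q.2), q.1, q.2)) (by fun_prop))
    ⟨C * (1 + (2 + 2 * σ ^ 2)), fun q => by
      refine (hC _ _ _).trans ?_
      rw [mul_assoc]
      gcongr
      have := hη2 q.1 q.2
      nlinarith⟩).comp hφ
  have hW := (hh (fun q => (1 + 2 * |η (q.1 + σ * q.2)| + |q.1| + |q.2|) ^ 2) (by fun_prop)
    ⟨4 * (1 + 4 * (2 + 2 * σ ^ 2)), fun q => by
      rw [abs_of_nonneg (sq_nonneg _)]
      have h1 := hη2 q.1 q.2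
      have h2 : ∀ a b c d : ℝ, (a + b + c + d) ^ 2 ≤ 4 * (a ^ 2 + b ^ 2 + c ^ 2 + d ^ 2) := fun a b c d => by
        nlinarith [sq_nonneg (a - b), sq_nonneg (a - c), sq_nonneg (a - d), sq_nonneg (b - c), sq_nonneg (b - d), sq_nonneg (c - d)]
      refine (h2 _ _ _ _).trans ?_
      rw [mul_pow, sq_abs, sq_abs, sq_abs]
      nlinarith⟩).comp hφ
  set W := ∫ q : ℝ × ℝ, (1 + 2 * |η (q.1 + σ * q.2)| + |q.1| + |q.2|) ^ 2 ∂(μβ.prod (gaussianReal 0 1))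
  have hB : Tendsto (fun k => L * ((∑ i, (x k i - η (β (φ k) i + σ * h (φ k) i)) ^ 2) / (φ k : ℝ) +
      Real.sqrt ((∑ i, (1 + 2 * |η (β (φ k) i + σ * h (φ k) i)| + |β (φ k) i| + |h (φ k) i|) ^ 2) / (φ k : ℝ)) *
      Real.sqrt ((∑ i, (x k i - η (β (φ k) i + σ * h (φ k) i)) ^ 2) / (φ k : ℝ)))) atTop (𝓝 0) := by
    have := (hx.add ((Real.continuous_sqrt.tendsto _).comp hW |>.mul ((Real.continuous_sqrt.tendsto _).comp hx))).const_mul L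
    simpa using this
  have hdiff : Tendsto (fun k => (∑ i, Ψ (x k i) (β (φ k) i) (h (φ k) i)) / (φ k : ℝ) -
      (∑ i, Ψ (η (β (φ k) i + σ * h (φ k) i)) (β (φ k) i) (h (φ k) i)) / (φ k : ℝ)) atTop (𝓝 0) := by
    refine squeeze_zero_norm (fun k => ?_) hB
    rw [Real.norm_eq_abs, ← sub_div, ← Finset.sum_sub_distrib, abs_div, abs_of_nonneg (Nat.cast_nonneg (φ k) : (0:ℝ) ≤ φ k)]
    set e : Fin (φ k) → ℝ := fun i => x k i - η (β (φ k) i + σ * h (φ k) i)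
    set W' : Fin (φ k) → ℝ := fun i => 1 + 2 * |η (β (φ k) i + σ * h (φ k) i)| + |β (φ k) i| + |h (φ k) i|
    have h2 := Real.sum_mul_le_sqrt_mul_sqrt Finset.univ W' (fun i => |e i|)
    simp only [sq_abs] at h2
    have h3 : |∑ i, (Ψ (x k i) (β (φ k) i) (h (φ k) i) - Ψ (η (β (φ k) i + σ * h (φ k) i)) (β (φ k) i) (h (φ k) i))| ≤
        L * (∑ i, e i ^ 2 + Real.sqrt (∑ i, W' i ^ 2) * Real.sqrt (∑ i, e i ^ 2)) := by
      calc _ ≤ ∑ i, L * (e i ^ 2 + W' i * |e i|) := by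
            refine (Finset.abs_sum_le_sum_abs _ _).trans (Finset.sum_le_sum fun i _ => ?_)
            refine (hL _ _ _ _).trans ?_
            rw [mul_assoc]
            gcongr
            have h4 : |x k i| ≤ |e i| + |η (β (φ k) i + σ * h (φ k) i)| := by
              have := abs_add_le (e i) (η (β (φ k) i + σ * h (φ k) i))
              simpa [e] using this
            have h5 : (1 + |x k i| + |η (β (φ k) i + σ * h (φ k) i)| + |β (φ k) i| + |h (φ k) i|) ≤ |e i| + W' i := by
              simp only [W']; linarith
            calc _ ≤ (|e i| + W' i) * |e i| := by gcongr
              _ = _ := by rw [add_mul, ← sq, sq_abs]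
        _ = L * (∑ i, e i ^ 2 + ∑ i, W' i * |e i|) := by rw [← Finset.mul_sum, Finset.sum_add_distrib]
        _ ≤ _ := by gcongr
    calc _ ≤ L * (∑ i, e i ^ 2 + Real.sqrt (∑ i, W' i ^ 2) * Real.sqrt (∑ i, e i ^ 2)) / (φ k : ℝ) := by gcongr
      _ = _ := by
        rw [Real.sqrt_div' _ (Nat.cast_nonneg _), Real.sqrt_div' _ (Nat.cast_nonneg _), div_mul_div_comm,
          Real.mul_self_sqrt (Nat.cast_nonneg _)]
        ring
  have := hdiff.add hA
  simp only [zero_add] at this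
  refine this.congr fun k => ?_
  simp
end

set_option linter.unusedSectionVars false

section
variable {δ : ℝ} {n : ℕ → ℕ}

lemma pn_lim (hδ : 0 < δ) (hn : Tendsto (fun p => (n p : ℝ) / (p : ℝ)) atTop (𝓝 δ)) :
    Tendsto (fun p : ℕ => (p : ℝ) / (n p : ℝ)) atTop (𝓝 (1 / δ)) := by
  have := hn.inv₀ hδ.ne'
  rw [one_div]
  refine this.congr fun p => ?_
  rw [inv_div]

lemma pn_ev (hδ : 0 < δ) (hn : Tendsto (fun p => (n p : ℝ) / (p : ℝ)) atTop (𝓝 δ)) :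
    ∀ᶠ p : ℕ in atTop, 0 < p ∧ 0 < n p ∧ (p : ℝ) ≤ 2 / δ * n p := by
  have h1 : 1 / δ < 2 / δ := by gcongr; norm_num
  filter_upwards [eventually_gt_atTop 0, (n_atTop hδ hn).eventually_gt_atTop 0,
    (pn_lim hδ hn).eventually (gt_mem_nhds h1)] with p a b c
  refine ⟨a, b, ?_⟩
  have : (0:ℝ) < n p := by exact_mod_cast b
  rw [div_lt_iff₀ this] at c
  exact c.le

lemma scale_lim (hδ : 0 < δ) (hn : Tendsto (fun p => (n p : ℝ) / (p : ℝ)) atTop (𝓝 δ))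
    {f : ℕ → ℝ} {a : ℝ} (hf : Tendsto (fun p => f p / (p : ℝ)) atTop (𝓝 a)) :
    Tendsto (fun p => f p / (n p : ℝ)) atTop (𝓝 (a / δ)) := by
  have := hf.mul (pn_lim hδ hn)
  rw [mul_one_div] at this
  refine this.congr' ?_
  filter_upwards [eventually_gt_atTop 0] with p hp
  have : (p : ℝ) ≠ 0 := by positivity
  field_simp

lemma nrm_ev (hδ : 0 < δ) (hn : Tendsto (fun p => (n p : ℝ) / (p : ℝ)) atTop (𝓝 δ))
    {x : (p : ℕ) → Fin p → ℝ} {a : ℝ} (hx : Tendsto (fun p => (∑ i, (x p i) ^ 2) / (p : ℝ)) atTop (𝓝 a)) :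
    ∃ C : ℝ, 0 ≤ C ∧ ∀ᶠ p in atTop, nrm (x p) ≤ C * Real.sqrt (n p) := by
  refine ⟨Real.sqrt (a / δ + 1), Real.sqrt_nonneg _, ?_⟩
  filter_upwards [(scale_lim hδ hn hx).eventually (gt_mem_nhds (lt_add_one _)), pn_ev hδ hn] with p h1 h2
  have h3 : (0:ℝ) < n p := by exact_mod_cast h2.2.1
  have h4 : 0 ≤ a / δ + 1 := by
    refine le_trans ?_ h1.le
    have : 0 ≤ ∑ i, (x p i) ^ 2 := Finset.sum_nonneg fun i _ => sq_nonneg _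
    positivity
  rw [div_lt_iff₀ h3, ← nrm_sq'] at h1
  rw [← Real.sqrt_mul h4]
  exact Real.le_sqrt_of_sq_le h1.le

lemma lam_mean {lam : (p : ℕ) → Fin p → ℝ} {μlam : Measure ℝ} [IsProbabilityMeasure μlam]
    (hlc : EmpConverges lam μlam) (h0 : ∀ p i, 0 ≤ lam p i) (hpos : 0 < μlam ({0}ᶜ)) :
    ∃ l0 : ℝ, 0 < l0 ∧ ∀ᶠ p : ℕ in atTop, l0 * p ≤ ∑ i, lam p i := by
  let f : BoundedContinuousFunction ℝ ℝ := BoundedContinuousFunction.ofNormedAddCommGroup (fun t => min |t| 1)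
    (by fun_prop) 1 (fun t => by
      rw [Real.norm_eq_abs, abs_of_nonneg (by positivity)]; exact min_le_right _ _)
  have hf : ∀ t, f t = min |t| 1 := fun t => rfl
  have hi : 0 < ∫ t, f t ∂μlam := by
    rw [integral_pos_iff_support_of_nonneg (fun t => by rw [hf]; positivity) (f.integrable μlam)]
    refine hpos.trans_le (measure_mono ?_)
    intro t ht
    have : 0 < |t| := abs_pos.2 ht
    simp only [Function.mem_support, hf]
    positivity
  refine ⟨(∫ t, f t ∂μlam) / 2, by positivity, ?_⟩
  filter_upwards [(hlc f).eventually (lt_mem_nhds (half_lt_self hi)), eventually_gt_atTop 0] with p h1 h2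
  have h3 : (0:ℝ) < p := by exact_mod_cast h2
  rw [lt_div_iff₀ h3] at h1
  refine h1.le.trans (Finset.sum_le_sum fun i _ => ?_)
  rw [hf, ← abs_of_nonneg (h0 p i)]
  rw [abs_abs]
  exact min_le_left _ _

lemma good_tail' (hδ : 0 < δ) (hn : Tendsto (fun p => (n p : ℝ) / (p : ℝ)) atTop (𝓝 δ))
    {β h : (p : ℕ) → Fin p → ℝ} {μβ : Measure ℝ} [IsProbabilityMeasure μβ]
    (hh : GoodH β μβ h) {ε : ℝ} (hε : 0 < ε) :
    ∃ M : ℝ, 0 ≤ M ∧ ∀ᶠ p : ℕ in atTop, ∀ x : Fin p → ℝ,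
      |h p ⬝ᵥ x| ≤ M * ∑ i, |x i| + ε * Real.sqrt (n p) * nrm x := by
  have hs : 0 < Real.sqrt (2 / δ) := Real.sqrt_pos.2 (by positivity)
  obtain ⟨M, hM, h1⟩ := good_tail hh (div_pos hε hs)
  refine ⟨M, hM, ?_⟩
  filter_upwards [h1, pn_ev hδ hn] with p h2 h3 x
  refine (h2 x).trans ?_
  have := nrm_nonneg x
  refine add_le_add_right (mul_le_mul_of_nonneg_right ?_ this) _
  rw [div_mul_eq_mul_div, div_le_iff₀ hs, mul_assoc, ← Real.sqrt_mul (Nat.cast_nonneg _)]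
  gcongr
  rw [mul_comm]; exact h3.2.2

set_option maxHeartbeats 800000 in
lemma fp_seq {σw : ℝ} (hσ : 0 < σw) (hδ : 0 < δ) (hn : Tendsto (fun p => (n p : ℝ) / (p : ℝ)) atTop (𝓝 δ))
    {β h lam : (p : ℕ) → Fin p → ℝ} {μβ μlam : Measure ℝ} [IsProbabilityMeasure μβ] [IsProbabilityMeasure μlam]
    (hh : GoodH β μβ h) (h0 : ∀ p i, 0 ≤ lam p i) (hl : ∀ p, Monotone (lam p))
    (hlc : EmpConverges lam μlam) (hpos : 0 < μlam ({0}ᶜ)) {a b : ℝ}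
    (hβ2 : Tendsto (fun p => (∑ i, (β p i) ^ 2) / (p : ℝ)) atTop (𝓝 a))
    (hlam2 : Tendsto (fun p => (∑ i, (lam p i) ^ 2) / (p : ℝ)) atTop (𝓝 b)) :
    ∃ c C : ℝ, 0 < c ∧ ∀ᶠ p : ℕ in atTop, ∃ s t : ℝ, ∃ x : Fin p → ℝ, σw ≤ s ∧ s ≤ C ∧ c ≤ t ∧ t ≤ C ∧
      x = slopeProx (fun i => t * lam p i) (β p + s • h p) ∧ s ^ 2 = σw ^ 2 + nrm (x - β p) ^ 2 / (n p : ℝ) ∧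
      s = t * (s - h p ⬝ᵥ (x - β p) / (n p : ℝ)) := by
  obtain ⟨Cb, hCb0, hCb⟩ := nrm_ev hδ hn hβ2
  obtain ⟨Cl, hCl0, hCl⟩ := nrm_ev hδ hn hlam2
  obtain ⟨Ch, hCh0, hCh⟩ := nrm_ev hδ hn (good_sq hh)
  obtain ⟨l0, hl0, hlm⟩ := lam_mean hlc h0 hpos
  obtain ⟨M, hM, htail⟩ := good_tail' hδ hn hh (ε := 1 / 2) (by norm_num)
  set E := 1 / 2 * σw ^ 2 + Cl * Cb with hE
  have hE0 : 0 < E := by positivity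
  set R := 2 * (E + 1 / 2 + M * (E / l0) + Ch * Cb + Cb) with hR
  have hR0 : 0 < R := by positivity
  obtain ⟨M', hM', htail'⟩ := good_tail' hδ hn hh (ε := σw / 4 / R) (by positivity)
  set f0 := σw / 2 / (1 + M' * (R + Ch * R) / l0) with hf0
  have hf0p : 0 < f0 := by positivity
  have hcr := (scale_lim hδ hn (good_cross hh)).abs
  rw [zero_div, abs_zero] at hcr
  set C0 := σw + R + Cb with hC0
  refine ⟨σw / (E + 1 / 2), max C0 (C0 / f0), by positivity, ?_⟩
  filter_upwards [hCb, hCl, hCh, hlm, htail, htail', pn_ev hδ hn, hcr.eventually (gt_mem_nhds (show 0 < σw / 4 by positivity))]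
    with p e1 e2 e3 e4 e5 e6 e7 e8
  have hp : (0:ℝ) < p := by exact_mod_cast e7.1
  have hN : (0:ℝ) < n p := by exact_mod_cast e7.2.1
  have hsum : 0 < ∑ i, lam p i := lt_of_lt_of_le (by positivity) e4
  obtain ⟨x, hx⟩ := ell_min (σw := σw) (N := n p) (β := β p) (h := h p) hN (h0 p) (hl p) hsum
  have hJ : ∀ x : Fin p → ℝ, l0 * ∑ i, |x i| ≤ sortedL1 (lam p) x := fun x => by
    have h1 := sortedL1_ge_mean (hl p) x
    have h2 : 0 ≤ ∑ i, |x i| := Finset.sum_nonneg fun i _ => abs_nonneg _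
    refine le_of_mul_le_mul_left ?_ hp
    nlinarith
  obtain ⟨b1, b2, b3⟩ := ell_bound hσ hN (hl p) (h0 p) hx hCb0 hCh0 hCl0 hM hM' e1 e3 e2 hl0 hJ e5 e6 hE hR
    (by positivity) (le_of_eq (by field_simp)) (by
      rw [← abs_of_pos hN, ← abs_div]; exact e8.le)
  have hF : 0 < Fl σw (n p) (β p) (h p) x := hf0p.trans_le b2
  set S := Sx σw (n p) (β p) x with hS
  set F := Fl σw (n p) (β p) (h p) x with hFd
  have hS1 : σw ≤ S := Sx_ge hσ hN x
  have hS2 : S ≤ C0 := by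
    have hs : 0 < Real.sqrt (n p) := Real.sqrt_pos.2 hN
    have hv : nrm (x - β p) / Real.sqrt (n p) ≤ R + Cb := by
      rw [div_le_iff₀ hs]
      have := nrm_sub_le x (β p)
      nlinarith
    have hv0 : 0 ≤ nrm (x - β p) / Real.sqrt (n p) := by have := nrm_nonneg (x - β p); positivity
    rw [hS, Sx, Real.sqrt_le_iff]
    refine ⟨by positivity, ?_⟩
    have : nrm (x - β p) ^ 2 / (n p : ℝ) = (nrm (x - β p) / Real.sqrt (n p)) ^ 2 := by
      rw [div_pow, Real.sq_sqrt hN.le]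
    rw [this]
    have h9 : (nrm (x - β p) / Real.sqrt (n p)) ^ 2 ≤ (R + Cb) ^ 2 := pow_le_pow_left₀ hv0 hv 2
    have h10 : 0 ≤ σw * (R + Cb) := by positivity
    have h11 : C0 ^ 2 = σw ^ 2 + 2 * (σw * (R + Cb)) + (R + Cb) ^ 2 := by rw [hC0]; ring
    linarith
  have hC00 : 0 < C0 := by positivity
  refine ⟨S, S / F, x, hS1, hS2.trans (le_max_left _ _), ?_, ?_, (ell_prox hσ hN (h0 p) (hl p) hx hF).symm, Sx_sq hN x, ?_⟩
  · have : 0 ≤ S := hσ.le.trans hS1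
    gcongr
  · refine le_trans ?_ (le_max_right _ _)
    gcongr
  · have : F = S - h p ⬝ᵥ (x - β p) / (n p : ℝ) := rfl
    rw [← this]
    field_simp
end

set_option linter.unusedSectionVars false

section
variable {β h : (p : ℕ) → Fin p → ℝ} {μβ : Measure ℝ} [IsProbabilityMeasure μβ]

lemma quad_int (hβ2int : Integrable (fun t => t ^ 2) μβ) {f : ℝ × ℝ → ℝ} (hf : Continuous f)
    (hC : ∃ C, ∀ q, |f q| ≤ C * (1 + q.1 ^ 2 + q.2 ^ 2)) : Integrable f (μβ.prod (gaussianReal 0 1)) := by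
  obtain ⟨C, hC⟩ := hC
  exact ((quad_integrable hβ2int).const_mul C).mono' hf.aestronglyMeasurable (Eventually.of_forall hC)

/-- law of `B + σ Z` -/
noncomputable def lawS (μβ : Measure ℝ) (σ : ℝ) : Measure ℝ :=
  (μβ.prod (gaussianReal 0 1)).map (fun q => q.1 + σ * q.2)

instance lawS_prob (σ : ℝ) : IsProbabilityMeasure (lawS μβ σ) :=
  Measure.isProbabilityMeasure_map (by fun_prop)

lemma sq_growth (σ : ℝ) (q : ℝ × ℝ) : (q.1 + σ * q.2) ^ 2 ≤ (2 + 2 * σ ^ 2) * (1 + q.1 ^ 2 + q.2 ^ 2) := by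
  nlinarith [sq_nonneg (q.1 - σ * q.2), sq_nonneg (σ * q.1), sq_nonneg q.2, sq_nonneg σ, sq_nonneg q.1]

lemma lawS_sq (hβ2int : Integrable (fun t => t ^ 2) μβ) (σ : ℝ) : Integrable (fun t => t ^ 2) (lawS μβ σ) := by
  rw [lawS, integrable_map_measure (by fun_prop) (by fun_prop)]
  refine quad_int hβ2int (by fun_prop) ⟨2 + 2 * σ ^ 2, fun q => ?_⟩
  simp only [Function.comp]
  rw [abs_of_nonneg (sq_nonneg _)]
  exact sq_growth σ q

lemma good_emp (hh : GoodH β μβ h) (σ : ℝ) :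
    EmpConverges (fun p i => β p i + σ * h p i) (lawS μβ σ) ∧
    Tendsto (fun p => (∑ i, (β p i + σ * h p i) ^ 2) / (p : ℝ)) atTop (𝓝 (∫ t, t ^ 2 ∂(lawS μβ σ))) := by
  constructor
  · intro f
    rw [lawS, integral_map (by fun_prop) f.continuous.aestronglyMeasurable]
    refine hh (fun q => f (q.1 + σ * q.2)) (by fun_prop) ⟨‖f‖, fun q => ?_⟩
    have := f.norm_coe_le_norm (q.1 + σ * q.2)
    rw [Real.norm_eq_abs] at this
    nlinarith [norm_nonneg f, mul_nonneg (norm_nonneg f) (sq_nonneg q.1), mul_nonneg (norm_nonneg f) (sq_nonneg q.2)]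
  · rw [lawS, integral_map (by fun_prop) (by fun_prop)]
    refine hh (fun q => (q.1 + σ * q.2) ^ 2) (by fun_prop) ⟨2 + 2 * σ ^ 2, fun q => ?_⟩
    rw [abs_of_nonneg (sq_nonneg _)]
    exact sq_growth σ q

lemma emp_scale {lam : (p : ℕ) → Fin p → ℝ} {μlam : Measure ℝ} [IsProbabilityMeasure μlam]
    (hlc : EmpConverges lam μlam) (hl2i : Integrable (fun t => t ^ 2) μlam)
    (hl2 : Tendsto (fun p => (∑ i, (lam p i) ^ 2) / (p : ℝ)) atTop (𝓝 (∫ t, t ^ 2 ∂μlam))) (τ : ℝ) :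
    EmpConverges (fun p i => τ * lam p i) (μlam.map (fun t => τ * t)) ∧
    Integrable (fun t => t ^ 2) (μlam.map (fun t => τ * t)) ∧
    Tendsto (fun p => (∑ i, (τ * lam p i) ^ 2) / (p : ℝ)) atTop (𝓝 (∫ t, t ^ 2 ∂(μlam.map (fun t => τ * t)))) := by
  refine ⟨fun f => ?_, ?_, ?_⟩
  · rw [integral_map (by fun_prop) f.continuous.aestronglyMeasurable]
    exact hlc (f.compContinuous ⟨fun t => τ * t, by fun_prop⟩)
  · rw [integrable_map_measure (by fun_prop) (by fun_prop)]
    simpa [Function.comp_def, mul_pow] using hl2i.const_mul (τ ^ 2)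
  · rw [integral_map (by fun_prop) (by fun_prop)]
    simp only [mul_pow]
    rw [integral_const_mul]
    refine (hl2.const_mul (τ ^ 2)).congr fun p => ?_
    rw [← Finset.mul_sum, mul_div_assoc]

lemma psi_sq_lip (a a' b z : ℝ) : |(a - b) ^ 2 - (a' - b) ^ 2| ≤ 2 * (1 + |a| + |a'| + |b| + |z|) * |a - a'| := by
  have : (a - b) ^ 2 - (a' - b) ^ 2 = (a + a' - 2 * b) * (a - a') := by ring
  rw [this, abs_mul]
  gcongr
  rw [abs_le]
  constructor <;> linarith [abs_nonneg z, le_abs_self a, le_abs_self a', le_abs_self b, neg_abs_le a, neg_abs_le a', neg_abs_le b, abs_nonneg a, abs_nonneg a']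

lemma psi_sq_gr (a b z : ℝ) : |(a - b) ^ 2| ≤ 2 * (1 + a ^ 2 + b ^ 2 + z ^ 2) := by
  rw [abs_of_nonneg (sq_nonneg _)]
  nlinarith [sq_nonneg (a + b), sq_nonneg z]

lemma psi_cr_lip (a a' b z : ℝ) : |z * (a - b) - z * (a' - b)| ≤ 1 * (1 + |a| + |a'| + |b| + |z|) * |a - a'| := by
  have : z * (a - b) - z * (a' - b) = z * (a - a') := by ring
  rw [this, abs_mul]
  gcongr
  linarith [abs_nonneg a, abs_nonneg a', abs_nonneg b]

lemma psi_cr_gr (a b z : ℝ) : |z * (a - b)| ≤ 2 * (1 + a ^ 2 + b ^ 2 + z ^ 2) := by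
  rw [abs_le]
  constructor <;> nlinarith [sq_nonneg (z - (a - b)), sq_nonneg (z + (a - b)), sq_nonneg (a + b), sq_nonneg z]

theorem fixed_point {δ σw : ℝ} {n : ℕ → ℕ} (hσ : 0 < σw) (hδ : 0 < δ)
    (hn : Tendsto (fun p => (n p : ℝ) / (p : ℝ)) atTop (𝓝 δ))
    {lam : (p : ℕ) → Fin p → ℝ} {μlam : Measure ℝ} [IsProbabilityMeasure μlam]
    (hh : GoodH β μβ h) (h0 : ∀ p i, 0 ≤ lam p i) (hl : ∀ p, Monotone (lam p))
    (hlc : EmpConverges lam μlam) (hpos : 0 < μlam ({0}ᶜ)) (hβ2int : Integrable (fun t => t ^ 2) μβ)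
    (hβ2 : Tendsto (fun p => (∑ i, (β p i) ^ 2) / (p : ℝ)) atTop (𝓝 (∫ t, t ^ 2 ∂μβ)))
    (hl2i : Integrable (fun t => t ^ 2) μlam)
    (hl2 : Tendsto (fun p => (∑ i, (lam p i) ^ 2) / (p : ℝ)) atTop (𝓝 (∫ t, t ^ 2 ∂μlam))) :
    ∃ (σ τ : ℝ) (η : ℝ → ℝ), σw ≤ σ ∧ 0 < τ ∧ (∀ t, η (-t) = - η t) ∧
      (∀ t₁ t₂ : ℝ, t₂ ≤ t₁ → 0 ≤ η t₁ - η t₂ ∧ η t₁ - η t₂ ≤ t₁ - t₂) ∧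
      (∀ u : (p : ℕ) → Fin p → ℝ, EmpConverges u (lawS μβ σ) →
        Tendsto (fun p => (∑ i, (u p i) ^ 2) / (p : ℝ)) atTop (𝓝 (∫ t, t ^ 2 ∂(lawS μβ σ))) →
        Tendsto (fun p => (∑ i, (slopeProx (fun i => τ * lam p i) (u p) i - η (u p i)) ^ 2) / (p : ℝ)) atTop (𝓝 0)) ∧
      σ ^ 2 = σw ^ 2 + (∫ q, (η (q.1 + σ * q.2) - q.1) ^ 2 ∂(μβ.prod (gaussianReal 0 1))) / δ ∧
      σ = τ * (σ - (∫ q, q.2 * (η (q.1 + σ * q.2) - q.1) ∂(μβ.prod (gaussianReal 0 1))) / δ) := by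
  obtain ⟨c, C, hc, hev⟩ := fp_seq hσ hδ hn hh h0 hl hlc hpos hβ2 hl2
  obtain ⟨P, hP⟩ := eventually_atTop.1 hev
  choose s t x hs1 hs2 ht1 ht2 hx hS hT using fun k => hP (P + k) (Nat.le_add_right P k)
  obtain ⟨⟨σ, τ⟩, hmem, φ0, hφ0, hlim⟩ := (isCompact_Icc (a := σw) (b := C) |>.prod (isCompact_Icc (a := c) (b := C))).tendsto_subseq
    (x := fun k => (s k, t k)) (fun k => ⟨⟨hs1 k, hs2 k⟩, ⟨ht1 k, ht2 k⟩⟩)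
  have hsl : Tendsto (fun k => s (φ0 k)) atTop (𝓝 σ) := (continuous_fst.tendsto _).comp hlim
  have htl : Tendsto (fun k => t (φ0 k)) atTop (𝓝 τ) := (continuous_snd.tendsto _).comp hlim
  have hσ1 : σw ≤ σ := hmem.1.1
  have hτ : 0 < τ := hc.trans_le hmem.2.1
  have hφ : Tendsto (fun k => P + φ0 k) atTop atTop := tendsto_atTop_mono (fun k => Nat.le_add_left _ _) hφ0.tendsto_atTop
  obtain ⟨es1, es2, es3⟩ := emp_scale hlc hl2i hl2 τ
  have : IsProbabilityMeasure (μlam.map (fun t => τ * t)) := Measure.isProbabilityMeasure_map (by fun_prop)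
  obtain ⟨η, hodd, hlip, hprox⟩ := thmB (lam := fun p i => τ * lam p i) (μ := lawS μβ σ)
    (fun p i => mul_nonneg hτ.le (h0 p i)) (fun p => (hl p).const_mul hτ.le) es1 es2 es3 (lawS_sq hβ2int σ)
  obtain ⟨ge1, ge2⟩ := good_emp hh σ
  have hpu := (hprox _ ge1 ge2).comp hφ
  have hstab : Tendsto (fun k => (∑ i, (x (φ0 k) i - η (β (P + φ0 k) i + σ * h (P + φ0 k) i)) ^ 2) / ((P + φ0 k : ℕ) : ℝ)) atTop (𝓝 0) := by
    have hb : Tendsto (fun k => 4 * (s (φ0 k) - σ) ^ 2 * ((∑ i, (h (P + φ0 k) i) ^ 2) / ((P + φ0 k : ℕ) : ℝ)) +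
        4 * (t (φ0 k) - τ) ^ 2 * ((∑ i, (lam (P + φ0 k) i) ^ 2) / ((P + φ0 k : ℕ) : ℝ)) +
        2 * ((∑ i, (slopeProx (fun i => τ * lam (P + φ0 k) i) (fun i => β (P + φ0 k) i + σ * h (P + φ0 k) i) i -
          η (β (P + φ0 k) i + σ * h (P + φ0 k) i)) ^ 2) / ((P + φ0 k : ℕ) : ℝ))) atTop (𝓝 0) := by
      have a1 := (((hsl.sub_const σ).pow 2).const_mul 4).mul ((good_sq hh).comp hφ)
      have a2 := (((htl.sub_const τ).pow 2).const_mul 4).mul (hl2.comp hφ)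
      have := (a1.add a2).add (hpu.const_mul 2)
      simpa [Function.comp_def] using this
    refine squeeze_zero (fun k => div_nonneg (Finset.sum_nonneg fun i _ => sq_nonneg _) (Nat.cast_nonneg _)) (fun k => ?_) hb
    set p := P + φ0 k with hp
    set xs := slopeProx (fun i => τ * lam p i) (fun i => β p i + σ * h p i) with hxs
    have hst := slopeProx_stab (h0 p) (hl p) (hc.le.trans (ht1 (φ0 k))) hτ.le (β p + s (φ0 k) • h p) (fun i => β p i + σ * h p i)
    rw [← hx (φ0 k), ← hxs] at hst
    have e1 : (β p + s (φ0 k) • h p) - (fun i => β p i + σ * h p i) = (s (φ0 k) - σ) • h p := by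
      funext i; simp; ring
    rw [e1, nrm_smul] at hst
    have e2 : nrm (x (φ0 k) - xs) ^ 2 ≤ 2 * (s (φ0 k) - σ) ^ 2 * nrm (h p) ^ 2 + 2 * (t (φ0 k) - τ) ^ 2 * nrm (lam p) ^ 2 := by
      calc _ ≤ (|s (φ0 k) - σ| * nrm (h p) + |t (φ0 k) - τ| * nrm (lam p)) ^ 2 := pow_le_pow_left₀ (nrm_nonneg _) hst 2
        _ ≤ 2 * (|s (φ0 k) - σ| * nrm (h p)) ^ 2 + 2 * (|t (φ0 k) - τ| * nrm (lam p)) ^ 2 := by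
          nlinarith [sq_nonneg (|s (φ0 k) - σ| * nrm (h p) - |t (φ0 k) - τ| * nrm (lam p))]
        _ = _ := by rw [mul_pow, mul_pow, sq_abs, sq_abs]; ring
    rw [nrm_sq', nrm_sq', nrm_sq'] at e2
    have e3 : ∑ i, (x (φ0 k) i - η (β p i + σ * h p i)) ^ 2 ≤
        2 * ∑ i, ((x (φ0 k) - xs) i) ^ 2 + 2 * ∑ i, (xs i - η (β p i + σ * h p i)) ^ 2 := by
      rw [Finset.mul_sum, Finset.mul_sum, ← Finset.sum_add_distrib]
      refine Finset.sum_le_sum fun i _ => ?_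
      simp only [Pi.sub_apply]
      nlinarith [sq_nonneg ((x (φ0 k) i - xs i) - (xs i - η (β p i + σ * h p i)))]
    rw [← mul_div_assoc, ← mul_div_assoc, ← mul_div_assoc, ← add_div, ← add_div]
    refine div_le_div_of_nonneg_right ?_ (Nat.cast_nonneg _)
    linarith
  have L1 := pl_lim hh hodd hlip σ hφ (fun k => x (φ0 k)) hstab (Ψ := fun a b z => (a - b) ^ 2) (by fun_prop) (L := 2) (C := 2)
    (by norm_num) psi_sq_lip (by norm_num) psi_sq_gr
  have L2 := pl_lim hh hodd hlip σ hφ (fun k => x (φ0 k)) hstab (Ψ := fun a b z => z * (a - b)) (by fun_prop) (L := 1) (C := 2)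
    (by norm_num) psi_cr_lip (by norm_num) psi_cr_gr
  have hpn := (pn_lim hδ hn).comp hφ
  have hppos : ∀ᶠ k in atTop, ((P + φ0 k : ℕ) : ℝ) ≠ 0 := by
    filter_upwards [hφ.eventually_gt_atTop 0] with k hk
    exact_mod_cast hk.ne'
  refine ⟨σ, τ, η, hσ1, hτ, hodd, hlip, hprox, ?_, ?_⟩
  · refine tendsto_nhds_unique (hsl.pow 2) ?_
    have := (L1.mul hpn).const_add (σw ^ 2)
    rw [mul_one_div] at this
    refine this.congr' ?_
    filter_upwards [hppos] with k hk
    rw [hS (φ0 k), nrm_sq']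
    simp only [Function.comp, Pi.sub_apply]
    rw [div_mul_div_cancel₀ hk]
  · refine tendsto_nhds_unique hsl ?_
    have := htl.mul (hsl.sub (L2.mul hpn))
    rw [mul_one_div] at this
    refine this.congr' ?_
    filter_upwards [hppos] with k hk
    simp only [Function.comp]
    rw [div_mul_div_cancel₀ hk]
    exact (hT (φ0 k)).symm
end

set_option linter.unusedSectionVars false

lemma alg_S {σw K r r' S S' : ℝ} (hσw : 0 < σw) (hr : 0 ≤ r) (hrK : r ≤ K) (hr' : 0 ≤ r') (hrK' : r' ≤ K)
    (hS : 0 ≤ S) (hS2 : S ^ 2 = σw ^ 2 + r ^ 2) (hS' : 0 ≤ S') (hS2' : S' ^ 2 = σw ^ 2 + r' ^ 2) :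
    (σw ^ 2 + K ^ 2) * (S - S') ^ 2 ≤ K ^ 2 * (r - r') ^ 2 := by
  have hK : 0 ≤ K := hr.trans hrK
  set M := Real.sqrt (σw ^ 2 + K ^ 2) with hM
  have hM2 : M ^ 2 = σw ^ 2 + K ^ 2 := Real.sq_sqrt (by positivity)
  have hM0 : 0 ≤ M := Real.sqrt_nonneg _
  have a1 : r * M ≤ K * S := by
    refine le_of_sq_le_sq ?_ (by positivity)
    rw [mul_pow, mul_pow, hM2, hS2]
    nlinarith [mul_le_mul_of_nonneg_left (pow_le_pow_left₀ hr hrK 2) (sq_nonneg σw)]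
  have a2 : r' * M ≤ K * S' := by
    refine le_of_sq_le_sq ?_ (by positivity)
    rw [mul_pow, mul_pow, hM2, hS2']
    nlinarith [mul_le_mul_of_nonneg_left (pow_le_pow_left₀ hr' hrK' 2) (sq_nonneg σw)]
  have a3 : ((r + r') * M) ^ 2 ≤ (K * (S + S')) ^ 2 := pow_le_pow_left₀ (by positivity) (by linarith) 2
  have hSp : 0 < S := by
    rcases hS.eq_or_lt with h | h
    · rw [← h] at hS2; nlinarith [sq_nonneg r]
    · exact h
  have a4 : 0 < (S + S') ^ 2 := by positivity
  refine le_of_mul_le_mul_right ?_ a4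
  have e1 : (S - S') ^ 2 * (S + S') ^ 2 = (r - r') ^ 2 * (r + r') ^ 2 := by
    have : (S - S') * (S + S') = (r - r') * (r + r') := by ring_nf; linarith
    rw [← mul_pow, this, mul_pow]
  rw [mul_assoc, e1, ← hM2]
  calc _ = (r - r') ^ 2 * ((r + r') * M) ^ 2 := by ring
    _ ≤ (r - r') ^ 2 * (K * (S + S')) ^ 2 := by gcongr
    _ = _ := by ring

lemma alg_low {σ σw K r r' S S' d : ℝ} (hσ : 0 < σ) (hσw : 0 < σw) (hr : 0 ≤ r) (hrK : r ≤ K) (hr' : 0 ≤ r')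
    (hrK' : r' ≤ K) (hS : 0 ≤ S) (hS2 : S ^ 2 = σw ^ 2 + r ^ 2) (hS' : 0 ≤ S') (hS2' : S' ^ 2 = σw ^ 2 + r' ^ 2)
    (hd : (r - r') ^ 2 ≤ d) :
    σ + (σw ^ 2 / (σw ^ 2 + K ^ 2)) / (2 * σ) * d
      - (|S' ^ 2 - σ ^ 2| + 2 * K * |S' - σ| + (S' - σ) ^ 2) / (2 * σ) ≤ S - ((r ^ 2 + r' ^ 2 - d) / 2 - r' ^ 2) / σ := by
  have hK : 0 ≤ K := hr.trans hrK
  set D := σw ^ 2 + K ^ 2 with hD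
  have hD0 : 0 < D := by positivity
  have b1 := alg_S hσw hr hrK hr' hrK' hS hS2 hS' hS2'
  have b2 : (S - S') ^ 2 ≤ (1 - σw ^ 2 / D) * d := by
    have e : 1 - σw ^ 2 / D = K ^ 2 / D := by rw [hD]; field_simp; ring
    rw [e, div_mul_eq_mul_div, le_div_iff₀ hD0, mul_comm]
    exact b1.trans (by gcongr)
  have b3 : |S - S'| ≤ K := by
    rw [← abs_of_nonneg hK, ← sq_le_sq]
    have : (r - r') ^ 2 ≤ K ^ 2 := sq_le_sq' (by linarith) (by linarith)
    have h2 : D * (S - S') ^ 2 ≤ D * (r - r') ^ 2 := b1.trans (by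
      refine mul_le_mul_of_nonneg_right ?_ (sq_nonneg _); rw [hD]; linarith [sq_nonneg σw])
    exact (le_of_mul_le_mul_left h2 hD0).trans this
  have b4 : (S - σ) ^ 2 ≤ (1 - σw ^ 2 / D) * d + 2 * K * |S' - σ| + (S' - σ) ^ 2 := by
    have h1 : (S - σ) ^ 2 = (S - S') ^ 2 + 2 * ((S - S') * (S' - σ)) + (S' - σ) ^ 2 := by ring
    have h2 : (S - S') * (S' - σ) ≤ K * |S' - σ| := by
      refine (le_abs_self _).trans ?_
      rw [abs_mul]; gcongr
    linarith
  have b5 := neg_abs_le (S' ^ 2 - σ ^ 2)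
  have e : S - ((r ^ 2 + r' ^ 2 - d) / 2 - r' ^ 2) / σ = σ + (d + (S' ^ 2 - σ ^ 2) - (S - σ) ^ 2) / (2 * σ) := by
    have h1 : r ^ 2 = S ^ 2 - σw ^ 2 := by linarith
    have h2 : r' ^ 2 = S' ^ 2 - σw ^ 2 := by linarith
    rw [h1, h2]; field_simp; ring
  rw [e]
  have : σ + σw ^ 2 / D / (2 * σ) * d - (|S' ^ 2 - σ ^ 2| + 2 * K * |S' - σ| + (S' - σ) ^ 2) / (2 * σ)
      = σ + (σw ^ 2 / D * d - (|S' ^ 2 - σ ^ 2| + 2 * K * |S' - σ| + (S' - σ) ^ 2)) / (2 * σ) := by ring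
  rw [this]
  refine add_le_add_right (div_le_div_of_nonneg_right ?_ (by positivity)) _
  linarith

lemma ao_norm {n : ℕ} (hn : 0 < n) {σw r K : ℝ} (hσw : 0 < σw) (hr : 0 ≤ r) (hrK : r ≤ K) (g w : Fin n → ℝ) :
    |nrm (r • g - w) / Real.sqrt n - Real.sqrt (σw ^ 2 + r ^ 2)| ≤
      (K ^ 2 * |nrm g ^ 2 / n - 1| + 2 * K * |(w ⬝ᵥ g) / n| + |nrm w ^ 2 / n - σw ^ 2|) / σw := by
  have hn' : (0:ℝ) < n := by exact_mod_cast hn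
  have hK : 0 ≤ K := hr.trans hrK
  set X := nrm (r • g - w) / Real.sqrt n with hX
  set Y := Real.sqrt (σw ^ 2 + r ^ 2) with hY
  have hX0 : 0 ≤ X := div_nonneg (nrm_nonneg _) (Real.sqrt_nonneg _)
  have hX2 : X ^ 2 = r ^ 2 * (nrm g ^ 2 / n) - 2 * r * ((w ⬝ᵥ g) / n) + nrm w ^ 2 / n := by
    rw [hX, div_pow, Real.sq_sqrt hn'.le, nrm_sq, nrm_sq, nrm_sq]
    simp only [sub_dotProduct, dotProduct_sub, smul_dotProduct, dotProduct_smul, smul_eq_mul, dotProduct_comm g w]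
    field_simp; ring
  have hY2 : Y ^ 2 = σw ^ 2 + r ^ 2 := Real.sq_sqrt (by positivity)
  have hYσ : σw ≤ Y := Real.le_sqrt_of_sq_le (by nlinarith [sq_nonneg r])
  rw [le_div_iff₀ hσw]
  have h1 : |X - Y| * (X + Y) = |X ^ 2 - Y ^ 2| := by
    rw [← abs_of_nonneg (show 0 ≤ X + Y by linarith), ← abs_mul]; congr 1; ring
  calc |X - Y| * σw ≤ |X - Y| * (X + Y) := by gcongr; linarith
    _ = |X ^ 2 - Y ^ 2| := h1
    _ = |r ^ 2 * (nrm g ^ 2 / n - 1) + -(2 * r * ((w ⬝ᵥ g) / n)) + (nrm w ^ 2 / n - σw ^ 2)| := by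
      congr 1; rw [hX2, hY2]; ring
    _ ≤ r ^ 2 * |nrm g ^ 2 / n - 1| + 2 * r * |(w ⬝ᵥ g) / n| + |nrm w ^ 2 / n - σw ^ 2| := by
      refine (abs_add_le _ _).trans (add_le_add_left ((abs_add_le _ _).trans ?_) _)
      rw [abs_neg, abs_mul, abs_mul (2 * r), abs_of_nonneg (sq_nonneg r), abs_of_nonneg (show 0 ≤ 2 * r by linarith)]
    _ ≤ _ := by gcongr

/-- error in the norm -/
noncomputable def errN {n : ℕ} (σw K : ℝ) (w g : Fin n → ℝ) : ℝ :=
  (K ^ 2 * |nrm g ^ 2 / n - 1| + 2 * K * |(w ⬝ᵥ g) / n| + |nrm w ^ 2 / n - σw ^ 2|) / σw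

section
variable {n p : ℕ} {σ σw τ K : ℝ} {lam β h : Fin p → ℝ} {g w : Fin n → ℝ}

lemma ao_low (hn : 0 < n) (hσ : 0 < σ) (hσw : 0 < σw) (hτ : 0 < τ) (h0 : ∀ i, 0 ≤ lam i) (hl : Monotone lam)
    {x : Fin p → ℝ} (hx : x = slopeProx (fun i => τ * lam i) (β + σ • h)) (hxK : nrm (x - β) ≤ K * Real.sqrt n)
    {v : Fin p → ℝ} (hv : nrm v ≤ K * Real.sqrt n) :
    (σ / τ * σ - σ / τ * ((h ⬝ᵥ (x - β)) / n) + sortedL1 lam x / n - 1 / 2 * (σ / τ) ^ 2)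
      + σ / τ * ((σw ^ 2 / (σw ^ 2 + K ^ 2)) / (2 * σ)) * (nrm (v - (x - β)) ^ 2 / n)
      - σ / τ * ((|Real.sqrt (σw ^ 2 + nrm (x - β) ^ 2 / n) ^ 2 - σ ^ 2| + 2 * K * |Real.sqrt (σw ^ 2 + nrm (x - β) ^ 2 / n) - σ|
        + (Real.sqrt (σw ^ 2 + nrm (x - β) ^ 2 / n) - σ) ^ 2) / (2 * σ) + errN σw K w g)
      ≤ AOb w (fun v => sortedL1 lam (β + v)) (g, h) v / n := by
  have hn' : (0:ℝ) < n := by exact_mod_cast hn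
  have hs : 0 < Real.sqrt n := Real.sqrt_pos.2 hn'
  have hs2 : Real.sqrt n ^ 2 = n := Real.sq_sqrt hn'.le
  set Fs := σ / τ with hFs
  have hFs0 : 0 < Fs := div_pos hσ hτ
  set y := x - β with hy
  set r := nrm v / Real.sqrt n with hr
  set r' := nrm y / Real.sqrt n with hr'
  have hr2 : r ^ 2 = nrm v ^ 2 / n := by rw [hr, div_pow, hs2]
  have hr2' : r' ^ 2 = nrm y ^ 2 / n := by rw [hr', div_pow, hs2]
  rw [← hr2']
  set d := nrm (v - y) ^ 2 / n with hd
  have hrr : (r - r') ^ 2 ≤ d := by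
    have h1 := abs_nrm_sub_le v y
    rw [hr, hr', ← sub_div, div_pow, hs2, hd, ← sq_abs]
    gcongr
  have hA := alg_low (d := d) hσ hσw (div_nonneg (nrm_nonneg v) hs.le) ((div_le_iff₀ hs).2 hv) (div_nonneg (nrm_nonneg y) hs.le)
    ((div_le_iff₀ hs).2 hxK) (Real.sqrt_nonneg (σw ^ 2 + r ^ 2)) (Real.sq_sqrt (by positivity))
    (Real.sqrt_nonneg (σw ^ 2 + r' ^ 2)) (Real.sq_sqrt (by positivity)) hrr
  rw [← hr, ← hr'] at hA
  have hip : (r ^ 2 + r' ^ 2 - d) / 2 = (y ⬝ᵥ v) / n := by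
    rw [hr2, hr2', hd, nrm_sq, nrm_sq, nrm_sq]
    simp only [sub_dotProduct, dotProduct_sub, dotProduct_comm v y]
    field_simp; ring
  rw [hip] at hA
  have hN := ao_norm hn hσw (div_nonneg (nrm_nonneg v) hs.le) ((div_le_iff₀ hs).2 hv) g w
  rw [← hr] at hN
  have hN' := (abs_le.1 hN).1
  change -(errN σw K w g) ≤ _ at hN'
  have hAOF : AOF w (g, h) v / Real.sqrt n = nrm (r • g - w) / Real.sqrt n - (h ⬝ᵥ v) / n := by
    unfold AOF
    simp only
    rw [sub_div, div_div, Real.mul_self_sqrt hn'.le]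
  have hvi := slopeProx_vi (fun i => mul_nonneg hτ.le (h0 i)) (hl.const_mul hτ.le) (β + σ • h) (β + v)
  rw [← hx, sortedL1_lam_smul, sortedL1_lam_smul] at hvi
  have e1 : β + v - x = v - y := by rw [hy]; abel
  have e2 : β + σ • h - x = σ • h - y := by rw [hy]; abel
  rw [e1, e2] at hvi
  have hvi' : sortedL1 lam x / n + Fs * ((h ⬝ᵥ v) / n) - Fs * ((h ⬝ᵥ y) / n) - Fs * ((y ⬝ᵥ v - y ⬝ᵥ y) / n / σ) ≤ sortedL1 lam (β + v) / n := by
    simp only [sub_dotProduct, dotProduct_sub, smul_dotProduct, smul_eq_mul] at hvi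
    have : sortedL1 lam x + (σ * (h ⬝ᵥ v) - σ * (h ⬝ᵥ y) - (y ⬝ᵥ v - y ⬝ᵥ y)) / τ ≤ sortedL1 lam (β + v) := by
      rw [← le_sub_iff_add_le', div_le_iff₀ hτ]; linarith
    refine le_trans (le_of_eq ?_) (div_le_div_of_nonneg_right this hn'.le)
    rw [hFs]; field_simp; ring
  have hsq : Fs * (AOF w (g, h) v / Real.sqrt n) - 1 / 2 * Fs ^ 2 ≤ 1 / 2 * (max 0 (AOF w (g, h) v)) ^ 2 / n := by
    set m := max 0 (AOF w (g, h) v) / Real.sqrt n with hm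
    have h1 : AOF w (g, h) v / Real.sqrt n ≤ m := by rw [hm]; gcongr; exact le_max_right _ _
    have h2 : 1 / 2 * (max 0 (AOF w (g, h) v)) ^ 2 / n = 1 / 2 * m ^ 2 := by rw [hm, div_pow, hs2]; ring
    rw [h2]
    nlinarith [sq_nonneg (m - Fs), mul_le_mul_of_nonneg_left h1 hFs0.le]
  have e5 : AOb w (fun v => sortedL1 lam (β + v)) (g, h) v / n = 1 / 2 * (max 0 (AOF w (g, h) v)) ^ 2 / n + sortedL1 lam (β + v) / n := by
    unfold AOb; rw [add_div]
  rw [e5]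
  rw [hAOF] at hsq
  have hA' := mul_le_mul_of_nonneg_left hA hFs0.le
  have hN'' := mul_le_mul_of_nonneg_left hN' hFs0.le
  have e3 : (y ⬝ᵥ v - y ⬝ᵥ y) / n / σ = ((y ⬝ᵥ v) / n - r' ^ 2) / σ := by
    rw [hr2', nrm_sq, sub_div]
  rw [e3] at hvi'
  generalize (|Real.sqrt (σw ^ 2 + r' ^ 2) ^ 2 - σ ^ 2| + 2 * K * |Real.sqrt (σw ^ 2 + r' ^ 2) - σ|
        + (Real.sqrt (σw ^ 2 + r' ^ 2) - σ) ^ 2) / (2 * σ) = E1 at hA' ⊢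
  generalize σw ^ 2 / (σw ^ 2 + K ^ 2) / (2 * σ) = E2 at hA' ⊢
  generalize ((y ⬝ᵥ v) / n - r' ^ 2) / σ = E3 at hA' hvi'
  generalize 1 / 2 * (max 0 (AOF w (g, h) v)) ^ 2 / n = E4 at hsq ⊢
  generalize sortedL1 lam (β + v) / n = E5 at hvi' ⊢
  generalize nrm (r • g - w) / Real.sqrt n = E6 at hsq hN''
  generalize Real.sqrt (σw ^ 2 + r ^ 2) = E7 at hA' hN''
  linarith
end

set_option linter.unusedSectionVars false

section
variable {β h lam : (p : ℕ) → Fin p → ℝ} {μβ : Measure ℝ} [IsProbabilityMeasure μβ] {δ σ σw τ : ℝ} {n : ℕ → ℕ}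
  {w g : (p : ℕ) → Fin (n p) → ℝ} {η : ℝ → ℝ}

/-- the auxiliary solution -/
noncomputable def xst (σ τ : ℝ) (lam β h : (p : ℕ) → Fin p → ℝ) (p : ℕ) : Fin p → ℝ :=
  slopeProx (fun i => τ * lam p i) (β p + σ • h p)

lemma xst_lim (hh : GoodH β μβ h)
    (hprox : ∀ u : (p : ℕ) → Fin p → ℝ, EmpConverges u (lawS μβ σ) →
        Tendsto (fun p => (∑ i, (u p i) ^ 2) / (p : ℝ)) atTop (𝓝 (∫ t, t ^ 2 ∂(lawS μβ σ))) →
        Tendsto (fun p => (∑ i, (slopeProx (fun i => τ * lam p i) (u p) i - η (u p i)) ^ 2) / (p : ℝ)) atTop (𝓝 0)) :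
    Tendsto (fun p => (∑ i, (xst σ τ lam β h p i - η (β p i + σ * h p i)) ^ 2) / (p : ℝ)) atTop (𝓝 0) := by
  obtain ⟨a, b⟩ := good_emp hh σ
  exact hprox _ a b

lemma xst_psi (hh : GoodH β μβ h) (hodd : ∀ t, η (-t) = -η t)
    (hlip : ∀ t₁ t₂ : ℝ, t₂ ≤ t₁ → 0 ≤ η t₁ - η t₂ ∧ η t₁ - η t₂ ≤ t₁ - t₂)
    (hx : Tendsto (fun p => (∑ i, (xst σ τ lam β h p i - η (β p i + σ * h p i)) ^ 2) / (p : ℝ)) atTop (𝓝 0))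
    {Ψ : ℝ → ℝ → ℝ → ℝ} (hΨ : Continuous fun q : ℝ × ℝ × ℝ => Ψ q.1 q.2.1 q.2.2) {L C : ℝ} (hL0 : 0 ≤ L)
    (hL : ∀ a a' b z, |Ψ a b z - Ψ a' b z| ≤ L * (1 + |a| + |a'| + |b| + |z|) * |a - a'|)
    (hC0 : 0 ≤ C) (hC : ∀ a b z, |Ψ a b z| ≤ C * (1 + a ^ 2 + b ^ 2 + z ^ 2)) :
    Tendsto (fun p => (∑ i, Ψ (xst σ τ lam β h p i) (β p i) (h p i)) / (p : ℝ)) atTop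
      (𝓝 (∫ q, Ψ (η (q.1 + σ * q.2)) q.1 q.2 ∂(μβ.prod (gaussianReal 0 1)))) :=
  pl_lim hh hodd hlip σ (φ := fun p => p) tendsto_id (fun p => xst σ τ lam β h p) hx hΨ hL0 hL hC0 hC

lemma psi_J_lip (σ a a' b z : ℝ) : |(b + σ * z - a) * a - (b + σ * z - a') * a'| ≤
    (1 + |σ|) * (1 + |a| + |a'| + |b| + |z|) * |a - a'| := by
  have : (b + σ * z - a) * a - (b + σ * z - a') * a' = (b + σ * z - a - a') * (a - a') := by ring
  rw [this, abs_mul]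
  gcongr
  have h1 : |b + σ * z - a - a'| ≤ |b| + |σ| * |z| + |a| + |a'| := by
    rw [← abs_mul]
    refine (abs_sub _ _).trans (add_le_add_left ((abs_sub _ _).trans (add_le_add_left (abs_add_le _ _) _)) _)
  nlinarith [abs_nonneg σ, abs_nonneg z, abs_nonneg a, abs_nonneg a', abs_nonneg b, mul_nonneg (abs_nonneg σ) (abs_nonneg a), mul_nonneg (abs_nonneg σ) (abs_nonneg a'), mul_nonneg (abs_nonneg σ) (abs_nonneg b)]

lemma psi_J_gr (σ a b z : ℝ) : |(b + σ * z - a) * a| ≤ (2 + σ ^ 2) * (1 + a ^ 2 + b ^ 2 + z ^ 2) := by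
  have h1 := sq_nonneg (b - a)
  have h2 := sq_nonneg (b + a)
  have h3 := sq_nonneg (σ * z - a)
  have h4 := sq_nonneg (σ * z + a)
  have h5 := sq_nonneg (σ * a)
  have h6 := sq_nonneg (σ * b)
  have h7 := sq_nonneg (σ * z)
  rw [abs_le]
  constructor <;> nlinarith [sq_nonneg a, sq_nonneg b, sq_nonneg z, sq_nonneg σ]

/-- limiting penalty -/
noncomputable def jlim (μβ : Measure ℝ) (δ σ τ : ℝ) (η : ℝ → ℝ) : ℝ :=
  (∫ q, (q.1 + σ * q.2 - η (q.1 + σ * q.2)) * η (q.1 + σ * q.2) ∂(μβ.prod (gaussianReal 0 1))) / τ / δ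

lemma ao_lims (hδ : 0 < δ) (hn : Tendsto (fun p => (n p : ℝ) / (p : ℝ)) atTop (𝓝 δ)) (hτ : 0 < τ)
    (h0 : ∀ p i, 0 ≤ lam p i) (hl : ∀ p, Monotone (lam p))
    (hh : GoodH β μβ h) (hodd : ∀ t, η (-t) = -η t)
    (hlip : ∀ t₁ t₂ : ℝ, t₂ ≤ t₁ → 0 ≤ η t₁ - η t₂ ∧ η t₁ - η t₂ ≤ t₁ - t₂)
    (hx : Tendsto (fun p => (∑ i, (xst σ τ lam β h p i - η (β p i + σ * h p i)) ^ 2) / (p : ℝ)) atTop (𝓝 0))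
    (hfp1 : σ ^ 2 = σw ^ 2 + (∫ q, (η (q.1 + σ * q.2) - q.1) ^ 2 ∂(μβ.prod (gaussianReal 0 1))) / δ)
    (hfp2 : σ = τ * (σ - (∫ q, q.2 * (η (q.1 + σ * q.2) - q.1) ∂(μβ.prod (gaussianReal 0 1))) / δ)) :
    Tendsto (fun p => nrm (xst σ τ lam β h p - β p) ^ 2 / (n p : ℝ)) atTop (𝓝 (σ ^ 2 - σw ^ 2)) ∧
    Tendsto (fun p => (h p ⬝ᵥ (xst σ τ lam β h p - β p)) / (n p : ℝ)) atTop (𝓝 (σ - σ / τ)) ∧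
    Tendsto (fun p => sortedL1 (lam p) (xst σ τ lam β h p) / (n p : ℝ)) atTop (𝓝 (jlim μβ δ σ τ η)) := by
  refine ⟨?_, ?_, ?_⟩
  · have := scale_lim hδ hn (xst_psi hh hodd hlip hx (Ψ := fun a b z => (a - b) ^ 2) (by fun_prop) (L := 2) (C := 2)
      (by norm_num) psi_sq_lip (by norm_num) psi_sq_gr)
    rw [hfp1, add_sub_cancel_left]
    refine this.congr fun p => ?_
    rw [nrm_sq']; rfl
  · have := scale_lim hδ hn (xst_psi hh hodd hlip hx (Ψ := fun a b z => z * (a - b)) (by fun_prop) (L := 1) (C := 2)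
      (by norm_num) psi_cr_lip (by norm_num) psi_cr_gr)
    have e : σ - σ / τ = (∫ q, q.2 * (η (q.1 + σ * q.2) - q.1) ∂(μβ.prod (gaussianReal 0 1))) / δ := by
      have : σ / τ = σ - (∫ q, q.2 * (η (q.1 + σ * q.2) - q.1) ∂(μβ.prod (gaussianReal 0 1))) / δ := by
        rw [div_eq_iff hτ.ne', mul_comm]; exact hfp2
      linarith
    rw [e]
    refine this.congr fun p => rfl
  · have := (scale_lim hδ hn (xst_psi hh hodd hlip hx (Ψ := fun a b z => (b + σ * z - a) * a) (by fun_prop) (L := 1 + |σ|) (C := 2 + σ ^ 2)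
      (by positivity) (psi_J_lip σ) (by positivity) (psi_J_gr σ))).div_const τ
    rw [jlim, div_right_comm]
    refine this.congr fun p => ?_
    have he := slopeProx_euler (fun i => mul_nonneg hτ.le (h0 p i)) ((hl p).const_mul hτ.le) (β p + σ • h p)
    rw [sortedL1_lam_smul] at he
    change (β p + σ • h p - xst σ τ lam β h p) ⬝ᵥ xst σ τ lam β h p = τ * sortedL1 (lam p) (xst σ τ lam β h p) at he
    have e2 : ∑ i, (β p i + σ * h p i - xst σ τ lam β h p i) * xst σ τ lam β h p i = τ * sortedL1 (lam p) (xst σ τ lam β h p) := he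
    rw [e2]; field_simp

lemma errN_lim (hg : GoodG w g) (hw2 : Tendsto (fun p => (∑ i, (w p i) ^ 2) / (n p : ℝ)) atTop (𝓝 (σw ^ 2))) (K : ℝ) :
    Tendsto (fun p => errN σw K (w p) (g p)) atTop (𝓝 0) := by
  obtain ⟨h1, h2⟩ := hg
  have := (((((h1.sub_const 1).abs.const_mul (K ^ 2)).add ((h2.abs).const_mul (2 * K))).add (hw2.sub_const (σw ^ 2)).abs)).div_const σw
  simp only [sub_self, abs_zero, mul_zero, add_zero, zero_div] at this
  refine this.congr fun p => ?_
  unfold errN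
  rw [nrm_sq', nrm_sq']; rfl

lemma ao_main (hσ : 0 < σ) (hσw : 0 < σw) (hδ : 0 < δ) (hn : Tendsto (fun p => (n p : ℝ) / (p : ℝ)) atTop (𝓝 δ)) (hτ : 0 < τ)
    (h0 : ∀ p i, 0 ≤ lam p i) (hl : ∀ p, Monotone (lam p))
    (hw2 : Tendsto (fun p => (∑ i, (w p i) ^ 2) / (n p : ℝ)) atTop (𝓝 (σw ^ 2)))
    (hg : GoodG w g)
    (hh : GoodH β μβ h) (hodd : ∀ t, η (-t) = -η t)
    (hlip : ∀ t₁ t₂ : ℝ, t₂ ≤ t₁ → 0 ≤ η t₁ - η t₂ ∧ η t₁ - η t₂ ≤ t₁ - t₂)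
    (hx : Tendsto (fun p => (∑ i, (xst σ τ lam β h p i - η (β p i + σ * h p i)) ^ 2) / (p : ℝ)) atTop (𝓝 0))
    (hfp1 : σ ^ 2 = σw ^ 2 + (∫ q, (η (q.1 + σ * q.2) - q.1) ^ 2 ∂(μβ.prod (gaussianReal 0 1))) / δ)
    (hfp2 : σ = τ * (σ - (∫ q, q.2 * (η (q.1 + σ * q.2) - q.1) ∂(μβ.prod (gaussianReal 0 1))) / δ))
    {K0 K : ℝ} (hK0 : 0 ≤ K0) (hK0' : σ ^ 2 - σw ^ 2 < K0 ^ 2) (hK : K0 ≤ K) {ε : ℝ} (hε : 0 < ε) :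
    ∀ᶠ p in atTop, nrm (xst σ τ lam β h p - β p) ≤ K0 * Real.sqrt (n p) ∧
      (∀ v, nrm v ≤ K * Real.sqrt (n p) → (1 / 2 * (σ / τ) ^ 2 + jlim μβ δ σ τ η)
        + σ / τ * ((σw ^ 2 / (σw ^ 2 + K ^ 2)) / (2 * σ)) * (nrm (v - (xst σ τ lam β h p - β p)) ^ 2 / n p) - ε
          < AOb (w p) (fun v => sortedL1 (lam p) (β p + v)) (g p, h p) v / n p) ∧
      AOb (w p) (fun v => sortedL1 (lam p) (β p + v)) (g p, h p) (xst σ τ lam β h p - β p) / n p <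
        (1 / 2 * (σ / τ) ^ 2 + jlim μβ δ σ τ η) + ε := by
  obtain ⟨l1, l2, l3⟩ := ao_lims hδ hn hτ h0 hl hh hodd hlip hx hfp1 hfp2
  have l4 := errN_lim hg hw2 K
  set x := xst σ τ lam β h with hxd
  have lS : Tendsto (fun p => Real.sqrt (σw ^ 2 + nrm (x p - β p) ^ 2 / (n p : ℝ))) atTop (𝓝 σ) := by
    have := (l1.const_add (σw ^ 2)).sqrt
    rw [add_sub_cancel, Real.sqrt_sq hσ.le] at this
    exact this
  -- lower bound limit
  have lA : Tendsto (fun p => σ / τ * σ - σ / τ * ((h p ⬝ᵥ (x p - β p)) / n p) + sortedL1 (lam p) (x p) / n p - 1 / 2 * (σ / τ) ^ 2)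
      atTop (𝓝 (1 / 2 * (σ / τ) ^ 2 + jlim μβ δ σ τ η)) := by
    have := (((l2.const_mul (σ / τ)).const_sub (σ / τ * σ)).add l3).sub_const (1 / 2 * (σ / τ) ^ 2)
    convert this using 2
    ring
  have lB : Tendsto (fun p => σ / τ * ((|Real.sqrt (σw ^ 2 + nrm (x p - β p) ^ 2 / n p) ^ 2 - σ ^ 2| + 2 * K * |Real.sqrt (σw ^ 2 + nrm (x p - β p) ^ 2 / n p) - σ|
        + (Real.sqrt (σw ^ 2 + nrm (x p - β p) ^ 2 / n p) - σ) ^ 2) / (2 * σ) + errN σw K (w p) (g p))) atTop (𝓝 0) := by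
    have := ((((((lS.pow 2).sub_const (σ ^ 2)).abs.add ((lS.sub_const σ).abs.const_mul (2 * K))).add
      ((lS.sub_const σ).pow 2)).div_const (2 * σ)).add l4).const_mul (σ / τ)
    simpa using this
  have lN : Tendsto (fun p => nrm ((nrm (x p - β p) / Real.sqrt (n p)) • g p - w p) / Real.sqrt (n p)) atTop (𝓝 σ) := by
    have hsmall : ∀ᶠ p in atTop, |nrm ((nrm (x p - β p) / Real.sqrt (n p)) • g p - w p) / Real.sqrt (n p)
        - Real.sqrt (σw ^ 2 + nrm (x p - β p) ^ 2 / n p)| ≤ errN σw K (w p) (g p) := by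
      filter_upwards [pn_ev hδ hn, l1.eventually (gt_mem_nhds hK0')] with p hp hp2
      have hn' : (0:ℝ) < n p := by exact_mod_cast hp.2.1
      have e : nrm (x p - β p) ^ 2 / n p = (nrm (x p - β p) / Real.sqrt (n p)) ^ 2 := by
        rw [div_pow, Real.sq_sqrt hn'.le]
      have h1 : 0 ≤ nrm (x p - β p) / Real.sqrt (n p) := div_nonneg (nrm_nonneg _) (Real.sqrt_nonneg _)
      rw [e] at hp2 ⊢
      exact ao_norm hp.2.1 hσw h1 ((abs_le_of_sq_le_sq' hp2.le hK0).2.trans hK) (g p) (w p)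
    have h2 := squeeze_zero_norm' (hsmall.mono fun p hp => by rw [Real.norm_eq_abs]; exact hp) l4
    have h3 := h2.add lS
    simpa using h3
  have lU : Tendsto (fun p => AOb (w p) (fun v => sortedL1 (lam p) (β p + v)) (g p, h p) (x p - β p) / n p) atTop
      (𝓝 (1 / 2 * (σ / τ) ^ 2 + jlim μβ δ σ τ η)) := by
    have h1 := ((tendsto_const_nhds (x := (0:ℝ)).max (lN.sub l2)).pow 2).const_mul (1 / 2) |>.add l3
    have e : max 0 (σ - (σ - σ / τ)) = σ / τ := by
      rw [sub_sub_cancel]; exact max_eq_right (by positivity)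
    rw [e] at h1
    refine h1.congr' ?_
    filter_upwards [pn_ev hδ hn] with p hp
    have hn' : (0:ℝ) < n p := by exact_mod_cast hp.2.1
    have hs : 0 < Real.sqrt (n p) := Real.sqrt_pos.2 hn'
    have e1 : nrm ((nrm (x p - β p) / Real.sqrt (n p)) • g p - w p) / Real.sqrt (n p) - (h p ⬝ᵥ (x p - β p)) / n p =
      AOF (w p) (g p, h p) (x p - β p) / Real.sqrt (n p) := by
      unfold AOF
      simp only
      rw [sub_div, div_div, Real.mul_self_sqrt hn'.le]
    rw [e1]
    unfold AOb
    have e2 : max 0 (AOF (w p) (g p, h p) (x p - β p) / Real.sqrt (n p)) = max 0 (AOF (w p) (g p, h p) (x p - β p)) / Real.sqrt (n p) := by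
      rw [← max_div_div_right hs.le, zero_div]
    rw [e2, div_pow, Real.sq_sqrt hn'.le]
    simp only [add_sub_cancel]
    ring
  filter_upwards [pn_ev hδ hn, l1.eventually (gt_mem_nhds hK0'), lU.eventually (gt_mem_nhds (lt_add_of_pos_right _ hε)),
    (lA.sub lB).eventually (lt_mem_nhds (show (1 / 2 * (σ / τ) ^ 2 + jlim μβ δ σ τ η) - ε < (1 / 2 * (σ / τ) ^ 2 + jlim μβ δ σ τ η) - 0 by linarith))]
    with p hp hp1 hp2 hp3
  have hn' : (0:ℝ) < n p := by exact_mod_cast hp.2.1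
  have hs : 0 < Real.sqrt (n p) := Real.sqrt_pos.2 hn'
  have hv0 : nrm (x p - β p) ≤ K0 * Real.sqrt (n p) := by
    rw [div_lt_iff₀ hn'] at hp1
    refine (abs_le_of_sq_le_sq' ?_ (by positivity)).2
    rw [mul_pow, Real.sq_sqrt hn'.le]; exact hp1.le
  refine ⟨hv0, fun v hv => ?_, hp2⟩
  have := ao_low (K := K) (g := g p) (w := w p) hp.2.1 hσ hσw hτ (h0 p) (hl p) (x := x p) rfl (hv0.trans (by gcongr)) hv
  linarith
end

set_option linter.unusedSectionVars false

section psi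
variable {ψ : ℝ → ℝ → ℝ} {L : ℝ}

lemma sqrt_le_abs (a b : ℝ) : Real.sqrt (a ^ 2 + b ^ 2) ≤ |a| + |b| := by
  rw [Real.sqrt_le_iff]
  refine ⟨by positivity, ?_⟩
  nlinarith [sq_abs a, sq_abs b, mul_nonneg (abs_nonneg a) (abs_nonneg b)]

lemma psi_lip (hL : 0 < L) (hψ : ∀ x₁ x₂ y₁ y₂ : ℝ,
      |ψ x₁ x₂ - ψ y₁ y₂| ≤ L * (1 + Real.sqrt (x₁ ^ 2 + x₂ ^ 2)
        + Real.sqrt (y₁ ^ 2 + y₂ ^ 2)) * Real.sqrt ((x₁ - y₁) ^ 2 + (x₂ - y₂) ^ 2)) (a a' b z : ℝ) :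
    |ψ a b - ψ a' b| ≤ (2 * L) * (1 + |a| + |a'| + |b| + |z|) * |a - a'| := by
  refine (hψ a b a' b).trans ?_
  have e : Real.sqrt ((a - a') ^ 2 + (b - b) ^ 2) = |a - a'| := by
    rw [sub_self, zero_pow two_ne_zero, add_zero, Real.sqrt_sq_eq_abs]
  rw [e]
  have h1 := sqrt_le_abs a b
  have h2 := sqrt_le_abs a' b
  have h3 : L * (1 + Real.sqrt (a ^ 2 + b ^ 2) + Real.sqrt (a' ^ 2 + b ^ 2)) ≤ 2 * L * (1 + |a| + |a'| + |b| + |z|) := by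
    rw [mul_comm 2 L, mul_assoc]
    gcongr
    linarith [abs_nonneg a, abs_nonneg a', abs_nonneg b, abs_nonneg z]
  gcongr

lemma psi_gr (hL : 0 < L) (hψ : ∀ x₁ x₂ y₁ y₂ : ℝ,
      |ψ x₁ x₂ - ψ y₁ y₂| ≤ L * (1 + Real.sqrt (x₁ ^ 2 + x₂ ^ 2)
        + Real.sqrt (y₁ ^ 2 + y₂ ^ 2)) * Real.sqrt ((x₁ - y₁) ^ 2 + (x₂ - y₂) ^ 2)) (a b z : ℝ) :
    |ψ a b| ≤ (|ψ 0 0| + 2 * L) * (1 + a ^ 2 + b ^ 2 + z ^ 2) := by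
  have h1 := hψ a b 0 0
  simp only [sub_zero] at h1
  rw [show (0:ℝ) ^ 2 + 0 ^ 2 = 0 by norm_num, Real.sqrt_zero, add_zero] at h1
  set r := Real.sqrt (a ^ 2 + b ^ 2) with hr
  have hr2 : r ^ 2 = a ^ 2 + b ^ 2 := Real.sq_sqrt (by positivity)
  have h2 : |ψ a b| ≤ |ψ a b - ψ 0 0| + |ψ 0 0| := by
    have := abs_add_le (ψ a b - ψ 0 0) (ψ 0 0)
    simpa using this
  have h3 : (1 + r) * r ≤ 2 * (1 + r ^ 2) := by nlinarith [sq_nonneg (r - 1)]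
  have h4 : L * (1 + r) * r ≤ L * (2 * (1 + r ^ 2)) := by rw [mul_assoc]; gcongr
  rw [hr2] at h4
  have h5 : 0 ≤ |ψ 0 0| * (a ^ 2 + b ^ 2 + z ^ 2) := by positivity
  have h6 : 0 ≤ L * z ^ 2 := by positivity
  nlinarith

lemma psi_cont (hψ : ∀ x₁ x₂ y₁ y₂ : ℝ,
      |ψ x₁ x₂ - ψ y₁ y₂| ≤ L * (1 + Real.sqrt (x₁ ^ 2 + x₂ ^ 2)
        + Real.sqrt (y₁ ^ 2 + y₂ ^ 2)) * Real.sqrt ((x₁ - y₁) ^ 2 + (x₂ - y₂) ^ 2)) :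
    Continuous fun q : ℝ × ℝ => ψ q.1 q.2 := by
  rw [continuous_iff_continuousAt]
  intro q0
  have h1 : Tendsto (fun q : ℝ × ℝ => L * (1 + Real.sqrt (q.1 ^ 2 + q.2 ^ 2)
        + Real.sqrt (q0.1 ^ 2 + q0.2 ^ 2)) * Real.sqrt ((q.1 - q0.1) ^ 2 + (q.2 - q0.2) ^ 2)) (𝓝 q0) (𝓝 0) := by
    have hc : Continuous (fun q : ℝ × ℝ => L * (1 + Real.sqrt (q.1 ^ 2 + q.2 ^ 2)
        + Real.sqrt (q0.1 ^ 2 + q0.2 ^ 2)) * Real.sqrt ((q.1 - q0.1) ^ 2 + (q.2 - q0.2) ^ 2)) := by fun_prop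
    have := hc.tendsto q0
    simpa using this
  have h2 : Tendsto (fun q : ℝ × ℝ => ψ q.1 q.2 - ψ q0.1 q0.2) (𝓝 q0) (𝓝 0) :=
    squeeze_zero_norm (fun q => by rw [Real.norm_eq_abs]; exact hψ _ _ _ _) h1
  have := h2.add_const (ψ q0.1 q0.2)
  simpa [ContinuousAt] using this

lemma psi_sep (hL : 0 < L) (hψ : ∀ x₁ x₂ y₁ y₂ : ℝ,
      |ψ x₁ x₂ - ψ y₁ y₂| ≤ L * (1 + Real.sqrt (x₁ ^ 2 + x₂ ^ 2)
        + Real.sqrt (y₁ ^ 2 + y₂ ^ 2)) * Real.sqrt ((x₁ - y₁) ^ 2 + (x₂ - y₂) ^ 2))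
    {p : ℕ} {N δ K Cb : ℝ} (hp : 0 < p) (hN : 0 < N) (hδ : 0 < δ) (hpN : (p : ℝ) ≤ 2 / δ * N) (hNp : N ≤ 2 * δ * p)
    (hK : 0 ≤ K) (hCb : 0 ≤ Cb)
    {β v v' : Fin p → ℝ} (hβ : nrm β ≤ Cb * Real.sqrt N) (hv : nrm v ≤ K * Real.sqrt N) (hv' : nrm v' ≤ K * Real.sqrt N) :
    |(∑ i, ψ ((β + v) i) (β i)) / (p : ℝ) - (∑ i, ψ ((β + v') i) (β i)) / (p : ℝ)| ≤
      (2 * L * Real.sqrt (4 * (2 / δ + 2 * (K + Cb) ^ 2 + Cb ^ 2)) * (2 * δ)) * Real.sqrt (nrm (v - v') ^ 2 / N) := by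
  have hp' : (0:ℝ) < p := by exact_mod_cast hp
  have hs2 : Real.sqrt N ^ 2 = N := Real.sq_sqrt hN.le
  set D := 4 * (2 / δ + 2 * (K + Cb) ^ 2 + Cb ^ 2) with hD
  have hD0 : 0 ≤ D := by positivity
  set x := β + v with hx
  set x' := β + v' with hx'
  have hnx : nrm x ^ 2 ≤ (K + Cb) ^ 2 * N := by
    rw [← hs2, ← mul_pow]
    exact pow_le_pow_left₀ (nrm_nonneg _) ((nrm_add_le _ _).trans (by linarith)) 2
  have hnx' : nrm x' ^ 2 ≤ (K + Cb) ^ 2 * N := by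
    rw [← hs2, ← mul_pow]
    exact pow_le_pow_left₀ (nrm_nonneg _) ((nrm_add_le _ _).trans (by linarith)) 2
  have hnb : nrm β ^ 2 ≤ Cb ^ 2 * N := by
    rw [← hs2, ← mul_pow]
    exact pow_le_pow_left₀ (nrm_nonneg _) hβ 2
  set W : Fin p → ℝ := fun i => 1 + |x i| + |x' i| + |β i| with hW
  have hW2 : ∑ i, W i ^ 2 ≤ D * N := by
    calc ∑ i, W i ^ 2 ≤ ∑ i, 4 * (1 + x i ^ 2 + x' i ^ 2 + β i ^ 2) := by
          refine Finset.sum_le_sum fun i _ => ?_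
          have h2 : ∀ a b c d : ℝ, (a + b + c + d) ^ 2 ≤ 4 * (a ^ 2 + b ^ 2 + c ^ 2 + d ^ 2) := fun a b c d => by
            nlinarith [sq_nonneg (a - b), sq_nonneg (a - c), sq_nonneg (a - d), sq_nonneg (b - c), sq_nonneg (b - d), sq_nonneg (c - d)]
          have := h2 1 |x i| |x' i| |β i|
          simpa only [sq_abs, one_pow] using this
      _ = 4 * (p + nrm x ^ 2 + nrm x' ^ 2 + nrm β ^ 2) := by
          rw [nrm_sq', nrm_sq', nrm_sq', ← Finset.mul_sum, Finset.sum_add_distrib, Finset.sum_add_distrib, Finset.sum_add_distrib]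
          simp
      _ ≤ _ := by rw [hD]; linarith
  have h1 : |∑ i, (ψ (x i) (β i) - ψ (x' i) (β i))| ≤ 2 * L * (Real.sqrt (D * N) * nrm (v - v')) := by
    calc _ ≤ ∑ i, 2 * L * (W i * |(v - v') i|) := by
          refine (Finset.abs_sum_le_sum_abs _ _).trans (Finset.sum_le_sum fun i _ => ?_)
          have := psi_lip hL hψ (x i) (x' i) (β i) 0
          rw [abs_zero, add_zero] at this
          have e : (v - v') i = x i - x' i := by simp [hx, hx']
          rw [e, ← mul_assoc]; exact this
      _ = 2 * L * ∑ i, W i * |(v - v') i| := by rw [Finset.mul_sum]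
      _ ≤ 2 * L * (Real.sqrt (∑ i, W i ^ 2) * Real.sqrt (∑ i, |(v - v') i| ^ 2)) := by
          gcongr; exact Real.sum_mul_le_sqrt_mul_sqrt _ _ _
      _ = 2 * L * (Real.sqrt (∑ i, W i ^ 2) * nrm (v - v')) := by
          simp only [sq_abs]; rw [← nrm_sq' (v - v'), Real.sqrt_sq (nrm_nonneg _)]
      _ ≤ _ := by have := nrm_nonneg (v - v'); gcongr
  rw [← sub_div, ← Finset.sum_sub_distrib, abs_div, abs_of_pos hp', div_le_iff₀ hp']
  refine h1.trans ?_
  rw [Real.sqrt_mul hD0, Real.sqrt_div' _ hN.le, Real.sqrt_sq (nrm_nonneg _)]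
  have hs : 0 < Real.sqrt N := Real.sqrt_pos.2 hN
  have hv0 := nrm_nonneg (v - v')
  have key : Real.sqrt N * nrm (v - v') ≤ 2 * δ * (nrm (v - v') / Real.sqrt N) * p := by
    have e : 2 * δ * (nrm (v - v') / Real.sqrt N) * p = (2 * δ * p) * nrm (v - v') / Real.sqrt N := by ring
    rw [e, le_div_iff₀ hs]
    have : Real.sqrt N * nrm (v - v') * Real.sqrt N = N * nrm (v - v') := by nlinarith
    rw [this]; gcongr
  calc _ = 2 * L * Real.sqrt D * (Real.sqrt N * nrm (v - v')) := by ring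
    _ ≤ 2 * L * Real.sqrt D * (2 * δ * (nrm (v - v') / Real.sqrt N) * p) := by gcongr
    _ = _ := by ring
end psi

section convex
variable {n p : ℕ}

lemma POb_convex (w : Fin n → ℝ) {Q : (Fin p → ℝ) → ℝ}
    (hconv : ∀ x y t, 0 ≤ t → t ≤ 1 → Q (x + t • (y - x)) ≤ Q x + t * (Q y - Q x))
    (A : Fin n → Fin p → ℝ) (x y : Fin p → ℝ) {t : ℝ} (h0 : 0 ≤ t) (h1 : t ≤ 1) :
    POb w Q A (x + t • (y - x)) ≤ POb w Q A x + t * (POb w Q A y - POb w Q A x) := by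
  unfold POb
  have hQ := hconv x y t h0 h1
  set a := mv A x - w with ha
  set b := mv A y - w with hb
  have e : mv A (x + t • (y - x)) - w = a + t • (b - a) := by
    have e2 : mv A (y - x) = b - a := by
      have := mv_add A (y - x) x
      rw [sub_add_cancel] at this
      rw [ha, hb, this]; abel
    rw [mv_add, mv_smul, e2, ha]; abel
  rw [e]
  have h3 : nrm (a + t • (b - a)) ^ 2 = nrm a ^ 2 + t * (nrm b ^ 2 - nrm a ^ 2) - t * (1 - t) * nrm (b - a) ^ 2 := by
    simp only [nrm_sq, add_dotProduct, dotProduct_add, sub_dotProduct, dotProduct_sub, smul_dotProduct, dotProduct_smul, smul_eq_mul, dotProduct_comm b a]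
    ring
  have h4 : 0 ≤ t * (1 - t) * nrm (b - a) ^ 2 := mul_nonneg (mul_nonneg h0 (by linarith)) (sq_nonneg _)
  nlinarith

/-- deterministic localisation -/
lemma localise (w : Fin n → ℝ) {Q : (Fin p → ℝ) → ℝ}
    (hconv : ∀ x y t, 0 ≤ t → t ≤ 1 → Q (x + t • (y - x)) ≤ Q x + t * (Q y - Q x))
    (A : Fin n → Fin p → ℝ) {v0 vh : Fin p → ℝ} (hmin : ∀ v, POb w Q A vh ≤ POb w Q A v) {R0 R c1 c2 : ℝ}
    (hR : R0 ≤ R) (hc : c1 < c2) (hv0 : nrm v0 ≤ R0) (hv0c : POb w Q A v0 ≤ c1)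
    (hshell : ∀ v, nrm v = R → c2 ≤ POb w Q A v) : nrm vh ≤ R := by
  by_contra hcon
  push Not at hcon
  have hcont : Continuous fun t : ℝ => nrm (v0 + t • (vh - v0)) := continuous_nrm.comp (by fun_prop)
  have hmem : R ∈ Set.Icc (nrm (v0 + (0:ℝ) • (vh - v0))) (nrm (v0 + (1:ℝ) • (vh - v0))) := by
    rw [zero_smul, add_zero, one_smul, add_sub_cancel]
    exact ⟨hv0.trans hR, hcon.le⟩
  obtain ⟨t, ht, hteq⟩ := intermediate_value_Icc zero_le_one hcont.continuousOn hmem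
  have h1 := hshell _ hteq
  have h2 := POb_convex w hconv A v0 vh ht.1 ht.2
  have h3 := hmin v0
  nlinarith [ht.1, mul_nonneg ht.1 (sub_nonneg.2 h3)]
end convex

set_option linter.unusedSectionVars false

section final
variable {δ σw σ τ : ℝ} {n : ℕ → ℕ} {lam β h : (p : ℕ) → Fin p → ℝ} {w g : (p : ℕ) → Fin (n p) → ℝ}
  {μβ : Measure ℝ} [IsProbabilityMeasure μβ] {η : ℝ → ℝ} {ψ : ℝ → ℝ → ℝ} {L : ℝ}

/-- the set of perturbations excluded by the auxiliary problem -/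
def excl {p : ℕ} (β : Fin p → ℝ) (ψ : ℝ → ℝ → ℝ) (E ε R : ℝ) : Set (Fin p → ℝ) :=
  {v | nrm v = R ∨ (nrm v ≤ R ∧ ε ≤ |(∑ i, ψ ((β + v) i) (β i)) / (p : ℝ) - E|)}

lemma excl_far (hL : 0 < L) (hψ : ∀ x₁ x₂ y₁ y₂ : ℝ,
      |ψ x₁ x₂ - ψ y₁ y₂| ≤ L * (1 + Real.sqrt (x₁ ^ 2 + x₂ ^ 2)
        + Real.sqrt (y₁ ^ 2 + y₂ ^ 2)) * Real.sqrt ((x₁ - y₁) ^ 2 + (x₂ - y₂) ^ 2))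
    {δ K0 Cb E ε : ℝ} (hδ : 0 < δ) (hK0 : 0 ≤ K0) (hCb : 0 ≤ Cb) (hε : 0 < ε) :
    ∃ d0 : ℝ, 0 < d0 ∧ ∀ {p : ℕ} {N : ℝ}, 0 < p → 0 < N → (p : ℝ) ≤ 2 / δ * N → N ≤ 2 * δ * p →
      ∀ β v0 : Fin p → ℝ, nrm β ≤ Cb * Real.sqrt N → nrm v0 ≤ K0 * Real.sqrt N →
      |(∑ i, ψ ((β + v0) i) (β i)) / (p : ℝ) - E| < ε / 2 →
      ∀ v ∈ excl β ψ E ε ((K0 + 1) * Real.sqrt N), d0 ≤ nrm (v - v0) ^ 2 / N := by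
  set C := 2 * L * Real.sqrt (4 * (2 / δ + 2 * (K0 + 1 + Cb) ^ 2 + Cb ^ 2)) * (2 * δ) + 1 with hC
  have hC0 : 0 < C := by positivity
  refine ⟨min 1 ((ε / (2 * C)) ^ 2), by positivity, ?_⟩
  intro p N hp hN hpN hNp β v0 hβ hv0 hE v hv
  have hs : 0 < Real.sqrt N := Real.sqrt_pos.2 hN
  have hs2 : Real.sqrt N ^ 2 = N := Real.sq_sqrt hN.le
  rcases hv with hv | ⟨hv, hb⟩
  · refine (min_le_left _ _).trans ?_
    rw [le_div_iff₀ hN, one_mul]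
    have h1 : Real.sqrt N ≤ nrm (v - v0) := by
      have := abs_nrm_sub_le v v0
      have := (le_abs_self _).trans this
      rw [hv] at this
      linarith
    calc N = Real.sqrt N ^ 2 := hs2.symm
      _ ≤ _ := pow_le_pow_left₀ hs.le h1 2
  · refine (min_le_right _ _).trans ?_
    have h1 := psi_sep hL hψ hp hN hδ hpN hNp (K := K0 + 1) (by linarith) hCb hβ hv
      (hv0.trans (by gcongr; linarith))
    set r := nrm (v - v0) ^ 2 / N with hr
    have hr0 : 0 ≤ r := by positivity
    have h2 : ε / 2 ≤ C * Real.sqrt r := by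
      have h3 := abs_sub_abs_le_abs_sub ((∑ i, ψ ((β + v) i) (β i)) / (p : ℝ) - E) ((∑ i, ψ ((β + v0) i) (β i)) / (p : ℝ) - E)
      rw [sub_sub_sub_cancel_right] at h3
      have : 0 ≤ Real.sqrt r := Real.sqrt_nonneg _
      rw [hC, add_mul]
      linarith
    have h4 : ε / (2 * C) ≤ Real.sqrt r := by
      rw [div_le_iff₀ (by positivity)]; linarith
    calc (ε / (2 * C)) ^ 2 ≤ Real.sqrt r ^ 2 := pow_le_pow_left₀ (by positivity) h4 2
      _ = r := Real.sq_sqrt hr0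

lemma final_prob (hσ : 0 < σ) (hσw : 0 < σw) (hδ : 0 < δ)
    (hn : Tendsto (fun p => (n p : ℝ) / (p : ℝ)) atTop (𝓝 δ)) (hτ : 0 < τ)
    (h0 : ∀ p i, 0 ≤ lam p i) (hl : ∀ p, Monotone (lam p))
    (hβconv : EmpConverges β μβ)
    (hβ2int : Integrable (fun t => t ^ 2) μβ)
    (hβ2 : Tendsto (fun p => (∑ i, (β p i) ^ 2) / (p : ℝ)) atTop (𝓝 (∫ t, t ^ 2 ∂μβ)))
    (hw2 : Tendsto (fun p => (∑ i, (w p i) ^ 2) / (n p : ℝ)) atTop (𝓝 (σw ^ 2)))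
    (hodd : ∀ t, η (-t) = -η t)
    (hlip : ∀ t₁ t₂ : ℝ, t₂ ≤ t₁ → 0 ≤ η t₁ - η t₂ ∧ η t₁ - η t₂ ≤ t₁ - t₂)
    (hprox : ∀ u : (p : ℕ) → Fin p → ℝ, EmpConverges u (lawS μβ σ) →
        Tendsto (fun p => (∑ i, (u p i) ^ 2) / (p : ℝ)) atTop (𝓝 (∫ t, t ^ 2 ∂(lawS μβ σ))) →
        Tendsto (fun p => (∑ i, (slopeProx (fun i => τ * lam p i) (u p) i - η (u p i)) ^ 2) / (p : ℝ)) atTop (𝓝 0))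
    (hfp1 : σ ^ 2 = σw ^ 2 + (∫ q, (η (q.1 + σ * q.2) - q.1) ^ 2 ∂(μβ.prod (gaussianReal 0 1))) / δ)
    (hfp2 : σ = τ * (σ - (∫ q, q.2 * (η (q.1 + σ * q.2) - q.1) ∂(μβ.prod (gaussianReal 0 1))) / δ))
    (hL : 0 < L) (hψ : ∀ x₁ x₂ y₁ y₂ : ℝ,
      |ψ x₁ x₂ - ψ y₁ y₂| ≤ L * (1 + Real.sqrt (x₁ ^ 2 + x₂ ^ 2)
        + Real.sqrt (y₁ ^ 2 + y₂ ^ 2)) * Real.sqrt ((x₁ - y₁) ^ 2 + (x₂ - y₂) ^ 2))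
    {ε : ℝ} (hε : 0 < ε)
    (βhat : (p : ℕ) → (Fin (n p) → Fin p → ℝ) → Fin p → ℝ)
    (hmin : ∀ p A v, POb (w p) (fun v => sortedL1 (lam p) (β p + v)) A (βhat p A - β p) ≤
      POb (w p) (fun v => sortedL1 (lam p) (β p + v)) A v) :
    Tendsto (fun p => gaussMatrix (n p) p {A | ε ≤ |(∑ i, ψ (βhat p A i) (β p i)) / (p : ℝ)
      - ∫ q, ψ (η (q.1 + σ * q.2)) q.1 ∂(μβ.prod (gaussianReal 0 1))|}) atTop (𝓝 0) := by
  set E := ∫ q, ψ (η (q.1 + σ * q.2)) q.1 ∂(μβ.prod (gaussianReal 0 1)) with hE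
  set K0 := Real.sqrt (σ ^ 2 - σw ^ 2) + 1 with hK0d
  have hK0 : 0 ≤ K0 := by positivity
  have hK0' : σ ^ 2 - σw ^ 2 < K0 ^ 2 := by
    have h1 := Real.sqrt_nonneg (σ ^ 2 - σw ^ 2)
    rcases le_total 0 (σ ^ 2 - σw ^ 2) with h2 | h2
    · have := Real.sq_sqrt h2
      nlinarith
    · have : 0 < K0 ^ 2 := by positivity
      nlinarith
  set K := K0 + 1 with hKd
  set c := σ / τ * ((σw ^ 2 / (σw ^ 2 + K ^ 2)) / (2 * σ)) with hc
  have hc0 : 0 < c := by positivity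
  set φ := 1 / 2 * (σ / τ) ^ 2 + jlim μβ δ σ τ η with hφ
  obtain ⟨Cb, hCb, hβev⟩ := nrm_ev hδ hn hβ2
  obtain ⟨d0, hd0, hfar⟩ := excl_far (E := E) hL hψ hδ hK0 hCb hε
  set θ := c * d0 / 4 with hθ
  have hθ0 : 0 < θ := by positivity
  set Q : (p : ℕ) → (Fin p → ℝ) → ℝ := fun p v => sortedL1 (lam p) (β p + v) with hQ
  have hQc : ∀ p, Continuous (Q p) := fun p =>
    (continuous_sortedL1 (h0 p) (hl p)).comp (continuous_const.add continuous_id)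
  have hQconv : ∀ p x y t, 0 ≤ t → t ≤ 1 → Q p (x + t • (y - x)) ≤ Q p x + t * (Q p y - Q p x) := by
    intro p x y t ht0 ht1
    have := sortedL1_convex (h0 p) (hl p) (β p + x) (β p + y) ht0 ht1
    rw [add_sub_add_left_eq_sub, add_assoc] at this
    exact this
  obtain ⟨-, hgood⟩ := thmGood hδ hn hβconv hβ2int hβ2 hw2
  set S : (p : ℕ) → Set (Fin p → ℝ) := fun p => excl (β p) ψ E ε (K * Real.sqrt (n p)) with hS
  set B1 : (p : ℕ) → Set ((Fin (n p) → ℝ) × (Fin p → ℝ)) := fun p =>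
    {q | ∃ v ∈ S p, AOb (w p) (Q p) q v ≤ n p * (φ + 2 * θ)} with hB1
  set B2 : (p : ℕ) → Set ((Fin (n p) → ℝ) × (Fin p → ℝ)) := fun p =>
    {q | ∀ v, nrm v ≤ K0 * Real.sqrt (n p) → n p * (φ + θ) ≤ AOb (w p) (Q p) q v} with hB2
  have hnp : ∀ᶠ p : ℕ in atTop, (n p : ℝ) ≤ 2 * δ * p := by
    filter_upwards [hn.eventually (gt_mem_nhds (by linarith : δ < 2 * δ)), eventually_gt_atTop 0] with p a b
    have : (0:ℝ) < p := by exact_mod_cast b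
    rw [div_lt_iff₀ this] at a
    exact a.le
  have hb : ∀ (g : (p : ℕ) → Fin (n p) → ℝ) (h : (p : ℕ) → Fin p → ℝ), GoodG w g → GoodH β μβ h →
        ∀ᶠ p in atTop, (g p, h p) ∉ B1 p ∧ (g p, h p) ∉ B2 p := by
    intro g h hg hh
    have hx := xst_lim hh hprox
    have hpsi := xst_psi hh hodd hlip hx (Ψ := fun a b z => ψ a b)
      ((psi_cont hψ).comp (continuous_fst.prodMk (continuous_fst.comp continuous_snd))) (L := 2 * L)
      (C := |ψ 0 0| + 2 * L) (by positivity) (psi_lip hL hψ) (by positivity) (psi_gr hL hψ)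
    have hpsi' := (tendsto_iff_norm_sub_tendsto_zero.1 hpsi).eventually (gt_mem_nhds (half_pos hε))
    filter_upwards [ao_main hσ hσw hδ hn hτ h0 hl hw2 hg hh hodd hlip hx hfp1 hfp2 hK0 hK0'
      (by linarith : K0 ≤ K) hθ0, hpsi', hβev, hnp, pn_ev hδ hn] with p ⟨a1, a2, a3⟩ a4 a5 a6 ⟨a7, a8, a9⟩
    have hN : (0:ℝ) < n p := by exact_mod_cast a8
    constructor
    · rintro ⟨v, hv, hle⟩
      have hvK : nrm v ≤ K * Real.sqrt (n p) := by
        rcases hv with hv | hv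
        · exact hv.le
        · exact hv.1
      have h1 := a2 v hvK
      have h2 := hfar a7 hN a9 a6 (β p) (xst σ τ lam β h p - β p) a5 a1
        (by rw [add_sub_cancel]; exact a4) v hv
      have h3 : c * d0 ≤ c * (nrm (v - (xst σ τ lam β h p - β p)) ^ 2 / n p) := by gcongr
      have h4 : AOb (w p) (Q p) (g p, h p) v / n p ≤ φ + 2 * θ := by
        rw [div_le_iff₀ hN, mul_comm]; exact hle
      have h5 : c * d0 = 4 * θ := by rw [hθ]; ring
      linarith
    · intro hall
      have h1 := hall _ a1
      rw [div_lt_iff₀ hN, mul_comm] at a3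
      exact absurd h1 (not_le.2 a3)
  have l1 := hgood B1 fun g h hg hh => (hb g h hg hh).mono fun p hp => hp.1
  have l2 := hgood B2 fun g h hg hh => (hb g h hg hh).mono fun p hp => hp.2
  have lim : Tendsto (fun p => 2 * ((gam (Fin (n p))).prod (gam (Fin p))) (B1 p)
      + 2 * ((gam (Fin (n p))).prod (gam (Fin p))) (B2 p)) atTop (𝓝 0) := by
    have e1 := ENNReal.Tendsto.const_mul l1 (Or.inr (by norm_num : (2 : ENNReal) ≠ ⊤))
    have e2 := ENNReal.Tendsto.const_mul l2 (Or.inr (by norm_num : (2 : ENNReal) ≠ ⊤))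
    simpa using e1.add e2
  refine tendsto_of_tendsto_of_tendsto_of_le_of_le' tendsto_const_nhds lim (Eventually.of_forall fun p => zero_le) ?_
  filter_upwards [pn_ev hδ hn] with p ⟨a7, a8, a9⟩
  have hN : (0:ℝ) < n p := by exact_mod_cast a8
  have g1 := G1 a8 (w p) (hQc p) (S p) (n p * (φ + 2 * θ))
  have g2 := G2 a8 (w p) (hQc p) (hQconv p) (K := K0 * Real.sqrt (n p)) (by positivity) (n p * (φ + θ))
  refine le_trans ?_ (add_le_add g1 g2)
  refine le_trans (measure_mono ?_) (measure_union_le _ _)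
  intro A hA
  by_contra hcon
  rw [Set.mem_union, not_or] at hcon
  obtain ⟨c1, c2⟩ := hcon
  simp only [Set.mem_ofPred_eq] at c1 c2 hA
  push Not at c1 c2
  obtain ⟨v0, hv0, hv0c⟩ := c2
  have hlt : n p * (φ + θ) < n p * (φ + 2 * θ) := by
    have : 0 < n p * θ := by positivity
    nlinarith
  have hloc := localise (w p) (hQconv p) A (hmin p A) (R0 := K0 * Real.sqrt (n p)) (R := K * Real.sqrt (n p))
    (by gcongr; linarith) hlt hv0 hv0c (fun v hv => c1 v (Or.inl hv))
  have hin : βhat p A - β p ∈ S p := Or.inr ⟨hloc, by rw [add_sub_cancel]; exact hA⟩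
  have h1 := c1 _ hin
  have h2 := hmin p A v0
  linarith
end final

theorem statement1
    (δ ρ σw : ℝ) (hδ : 0 < δ) (hρ : 0 < ρ) (hρ1 : ρ ≤ 1) (hσw : 0 < σw)
    -- (A.1)  n/p → δ
    (n : ℕ → ℕ) (hn : Tendsto (fun p => (n p : ℝ) / (p : ℝ)) atTop (𝓝 δ))
    (β : (p : ℕ) → Fin p → ℝ) (w : (p : ℕ) → Fin (n p) → ℝ)
    (lam : (p : ℕ) → Fin p → ℝ)
    (μβ μw μlam : Measure ℝ)
    (hμβ : IsProbabilityMeasure μβ) (hμw : IsProbabilityMeasure μw)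
    (hμlam : IsProbabilityMeasure μlam)
    -- (A.2)  k/p → ρ
    (hsparse : Tendsto
      (fun p => ((Finset.univ.filter fun i : Fin p => β p i ≠ 0).card : ℝ) / (p : ℝ))
      atTop (𝓝 ρ))
    -- (A.4)  converging sequences, moments, and λ conditions
    (hβconv : EmpConverges β μβ)
    (hwconv : ∀ f : BoundedContinuousFunction ℝ ℝ,
      Tendsto (fun p => (∑ i, f (w p i)) / (n p : ℝ)) atTop (𝓝 (∫ t, f t ∂μw)))
    (hlamconv : EmpConverges lam μlam)
    (hlam_nonneg : ∀ p i, 0 ≤ lam p i) (hlam_mono : ∀ p, Monotone (lam p))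
    (hlam_pos : 0 < μlam ({0}ᶜ))
    (hβ2int : Integrable (fun t => t ^ 2) μβ)
    (hβ2 : Tendsto (fun p => (∑ i, (β p i) ^ 2) / (p : ℝ)) atTop (𝓝 (∫ t, t ^ 2 ∂μβ)))
    (hw2 : Tendsto (fun p => (∑ i, (w p i) ^ 2) / (n p : ℝ)) atTop (𝓝 (σw ^ 2)))
    (hw2int : (∫ t, t ^ 2 ∂μw) = σw ^ 2)
    (hlam2int : Integrable (fun t => t ^ 2) μlam)
    (hlam2 : Tendsto (fun p => (∑ i, (lam p i) ^ 2) / (p : ℝ))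
      atTop (𝓝 (∫ t, t ^ 2 ∂μlam)))
    -- the SLOPE estimator `β̂`, as a minimizer of the SLOPE cost for each design matrix A
    (βhat : (p : ℕ) → (Fin (n p) → Fin p → ℝ) → Fin p → ℝ)
    (hβhat : ∀ p A (b : Fin p → ℝ),
      (1 / 2) * (∑ j, ((∑ k, A j k * β p k) + w p j - ∑ k, A j k * βhat p A k) ^ 2)
          + sortedL1 (lam p) (βhat p A)
        ≤ (1 / 2) * (∑ j, ((∑ k, A j k * β p k) + w p j - ∑ k, A j k * b k) ^ 2)
          + sortedL1 (lam p) b) :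
    ∃ (σ τ : ℝ) (η : ℝ → ℝ), σw ≤ σ ∧ 0 < τ ∧
      (∀ t, η (-t) = -η t) ∧
      (∀ t₁ t₂ : ℝ, t₂ ≤ t₁ → 0 ≤ η t₁ - η t₂ ∧ η t₁ - η t₂ ≤ t₁ - t₂) ∧
      -- (i) asymptotic separability of the proximal operator with weights τ·λ
      (∀ u : (p : ℕ) → Fin p → ℝ,
        (∀ f : BoundedContinuousFunction ℝ ℝ,
          Tendsto (fun p => (∑ i, f (u p i)) / (p : ℝ)) atTop
            (𝓝 (∫ b, ∫ z, f (b + σ * z) ∂gaussianReal 0 1 ∂μβ))) →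
        Tendsto (fun p => (∑ i, (u p i) ^ 2) / (p : ℝ)) atTop
            (𝓝 (∫ b, ∫ z, (b + σ * z) ^ 2 ∂gaussianReal 0 1 ∂μβ)) →
        Tendsto
          (fun p => (∑ i, (slopeProx (fun i => τ * lam p i) (u p) i - η (u p i)) ^ 2) / (p : ℝ))
          atTop (𝓝 0)) ∧
      -- (ii) the fixed point equation for σ
      σ ^ 2 = σw ^ 2
        + (1 / δ) * ∫ b, ∫ z, (η (b + σ * z) - b) ^ 2 ∂gaussianReal 0 1 ∂μβ ∧
      -- (iii) the fixed point equation for τ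
      1 = τ * (1 - (1 / (δ * σ)) * ∫ b, ∫ z, z * η (b + σ * z) ∂gaussianReal 0 1 ∂μβ) ∧
      -- (iv) convergence in probability for pseudo-Lipschitz observables
      (∀ ψ : ℝ → ℝ → ℝ,
        (∃ L > 0, ∀ x₁ x₂ y₁ y₂ : ℝ,
          |ψ x₁ x₂ - ψ y₁ y₂| ≤ L * (1 + Real.sqrt (x₁ ^ 2 + x₂ ^ 2)
            + Real.sqrt (y₁ ^ 2 + y₂ ^ 2)) * Real.sqrt ((x₁ - y₁) ^ 2 + (x₂ - y₂) ^ 2)) →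
        ∀ ε : ℝ, 0 < ε →
          Tendsto (fun p => gaussMatrix (n p) p
            {A | ε ≤ |(∑ i, ψ (βhat p A i) (β p i)) / (p : ℝ)
              - ∫ b, ∫ z, ψ (η (b + σ * z)) b ∂gaussianReal 0 1 ∂μβ|})
            atTop (𝓝 0)) := by
  have := hμβ
  have := hμw
  have := hμlam
  obtain ⟨⟨g, h, hg, hh⟩, -⟩ := thmGood hδ hn hβconv hβ2int hβ2 hw2
  obtain ⟨σ, τ, η, hσ1, hτ, hodd, hlip, hprox, hfp1, hfp2⟩ :=
    fixed_point hσw hδ hn hh hlam_nonneg hlam_mono hlamconv hlam_pos hβ2int hβ2 hlam2int hlam2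
  have hσ : 0 < σ := hσw.trans_le hσ1
  obtain ⟨hηc, hηa⟩ := eta_abs hodd hlip
  have hη2 : ∀ b z : ℝ, η (b + σ * z) ^ 2 ≤ (b + σ * z) ^ 2 := fun b z => sq_le_sq.2 (hηa _)
  have hη3 : ∀ b z : ℝ, η (b + σ * z) ^ 2 ≤ (2 + 2 * σ ^ 2) * (1 + b ^ 2 + z ^ 2) := fun b z => by
    nlinarith [hη2 b z, sq_nonneg (b - σ * z), mul_nonneg (sq_nonneg σ) (sq_nonneg b), sq_nonneg b, sq_nonneg z, sq_nonneg σ]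
  have law : ∀ f : ℝ → ℝ, Continuous f → (∃ C, ∀ q : ℝ × ℝ, |f (q.1 + σ * q.2)| ≤ C * (1 + q.1 ^ 2 + q.2 ^ 2)) →
      ∫ t, f t ∂(lawS μβ σ) = ∫ b, ∫ z, f (b + σ * z) ∂gaussianReal 0 1 ∂μβ := by
    intro f hf hC
    have hm : Continuous fun q : ℝ × ℝ => q.1 + σ * q.2 := by fun_prop
    unfold lawS
    rw [integral_map hm.aemeasurable hf.aestronglyMeasurable]
    exact integral_prod _ (quad_int hβ2int (hf.comp hm) hC)
  refine ⟨σ, τ, η, hσ1, hτ, hodd, hlip, ?_, ?_, ?_, ?_⟩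
  · intro u hu hu2
    refine hprox u ?_ ?_
    · intro f
      rw [law f f.continuous ⟨‖f‖, fun q => ?_⟩]
      · exact hu f
      · refine (f.norm_coe_le_norm _).trans ?_
        nlinarith [norm_nonneg f, mul_nonneg (norm_nonneg f) (sq_nonneg q.1), mul_nonneg (norm_nonneg f) (sq_nonneg q.2)]
    · rw [law (fun t => t ^ 2) (by fun_prop) ⟨2 + 2 * σ ^ 2, fun q => ?_⟩]
      · exact hu2
      · rw [abs_of_nonneg (sq_nonneg _)]
        nlinarith [sq_nonneg (q.1 - σ * q.2), mul_nonneg (sq_nonneg σ) (sq_nonneg q.1), sq_nonneg q.1, sq_nonneg q.2, sq_nonneg σ]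
  · rw [integral_prod _ (quad_int hβ2int (by fun_prop) ⟨2 * (2 + 2 * σ ^ 2) + 2, fun q => ?_⟩)] at hfp1
    · rw [one_div, inv_mul_eq_div]; exact hfp1
    · rw [abs_of_nonneg (sq_nonneg _)]
      nlinarith [hη3 q.1 q.2, sq_nonneg (η (q.1 + σ * q.2) + q.1), sq_nonneg q.1, sq_nonneg q.2]
  · have i1 : Integrable (fun q : ℝ × ℝ => q.2 * η (q.1 + σ * q.2)) (μβ.prod (gaussianReal 0 1)) := by
      refine quad_int hβ2int (by fun_prop) ⟨(2 + 2 * σ ^ 2) + 1, fun q => ?_⟩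
      rw [abs_le]
      constructor <;> nlinarith [hη3 q.1 q.2, sq_nonneg (η (q.1 + σ * q.2) + q.2), sq_nonneg (η (q.1 + σ * q.2) - q.2), sq_nonneg q.1, sq_nonneg q.2]
    have i2 : Integrable (fun q : ℝ × ℝ => q.2 * q.1) (μβ.prod (gaussianReal 0 1)) := by
      refine quad_int hβ2int (by fun_prop) ⟨1, fun q => ?_⟩
      rw [abs_le]
      constructor <;> nlinarith [sq_nonneg (q.1 + q.2), sq_nonneg (q.1 - q.2)]
    have e : ∫ q : ℝ × ℝ, q.2 * (η (q.1 + σ * q.2) - q.1) ∂(μβ.prod (gaussianReal 0 1))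
        = ∫ b, ∫ z, z * η (b + σ * z) ∂gaussianReal 0 1 ∂μβ := by
      rw [← integral_prod (fun q : ℝ × ℝ => q.2 * η (q.1 + σ * q.2)) i1]
      simp only [mul_sub]
      rw [integral_sub i1 i2, int_cross, sub_zero]
    rw [e] at hfp2
    generalize (∫ b, ∫ z, z * η (b + σ * z) ∂gaussianReal 0 1 ∂μβ) = I at hfp2 ⊢
    have : σ * 1 = σ * (τ * (1 - (1 / (δ * σ)) * I)) := by
      have e2 : σ * (τ * (1 - (1 / (δ * σ)) * I)) = τ * (σ - I / δ) := by field_simp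
      rw [e2, mul_one]; exact hfp2
    exact mul_left_cancel₀ hσ.ne' this
  · rintro ψ ⟨L, hL, hψ⟩ ε hε
    have hmin : ∀ p A v, POb (w p) (fun v => sortedL1 (lam p) (β p + v)) A (βhat p A - β p) ≤
        POb (w p) (fun v => sortedL1 (lam p) (β p + v)) A v := by
      intro p A v
      have := hβhat p A (β p + v)
      have e : ∀ b : Fin p → ℝ, ∑ j, ((∑ k, A j k * β p k) + w p j - ∑ k, A j k * b k) ^ 2
          = nrm (mv A (b - β p) - w p) ^ 2 := by
        intro b
        rw [nrm_sq']
        refine Finset.sum_congr rfl fun j _ => ?_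
        simp only [mv, Pi.sub_apply, mul_sub, Finset.sum_sub_distrib]
        ring
      rw [e, e, add_sub_cancel_left] at this
      unfold POb
      simp only [add_sub_cancel]
      exact this
    have := final_prob hσ hσw hδ hn hτ hlam_nonneg hlam_mono hβconv hβ2int hβ2 hw2 hodd hlip hprox hfp1 hfp2
      hL hψ hε βhat hmin
    rw [integral_prod (fun q : ℝ × ℝ => ψ (η (q.1 + σ * q.2)) q.1) (quad_int hβ2int ((psi_cont hψ).comp (by fun_prop :
      Continuous fun q : ℝ × ℝ => (η (q.1 + σ * q.2), q.1))) ⟨(|ψ 0 0| + 2 * L) * (3 + 2 * σ ^ 2), fun q => ?_⟩)] at this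
    · exact this
    · refine (psi_gr hL hψ _ _ 0).trans ?_
      rw [mul_assoc]
      have : 0 ≤ |ψ 0 0| + 2 * L := by positivity
      refine mul_le_mul_of_nonneg_left ?_ this
      nlinarith [hη3 q.1 q.2, sq_nonneg q.2, sq_nonneg q.1, sq_nonneg σ]
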